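/- Let K be a global function field of characteristic p, let q ≠ p be a prime, let 𝐊 be a (possibly infinite) algebraic extension of K, and let 𝔭_K be a prime of K. If 𝔭_K has uniformly absolutely bounded ramification and uniformly q-bounded relative degree in 𝐊, then the integral closure O_{𝔭_K,𝐊} in 𝐊 of the valuation ring O_{𝔭_K} = {x ∈ K : ord_{𝔭_K} x ≥ 0} is existentially (diophantine) definable over 𝐊 in the language of rings with parameters from 𝐊. -/

import Mathlib

noncomputable section

/-- A normalized (surjective onto `ℤ`) discrete valuation on a field `K`, i.e. a
"prime" of a global function field. -/
structure FFPrime (K : Type) [Field K] where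
  ord : K → WithTop ℤ
  ord_zero : ord 0 = ⊤
  ord_ne_top : ∀ x : K, x ≠ 0 → ord x ≠ ⊤
  ord_one : ord 1 = 0
  ord_mul : ∀ x y : K, ord (x * y) = ord x + ord y
  ord_add : ∀ x y : K, min (ord x) (ord y) ≤ ord (x + y)
  ord_surj : ∀ n : ℤ, ∃ x : K, ord x = (n : WithTop ℤ)

namespace FFPrime

variable {K L : Type} [Field K] [Field L]

/-- `w` lies over `v` along `φ`, with ramification index `e`. -/
def LiesOverWith (w : FFPrime L) (v : FFPrime K) (φ : K →+* L) (e : ℕ) : Prop :=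
  0 < e ∧ ∀ x : K, w.ord (φ x) = ((e : ℤ) : WithTop ℤ) * v.ord x

/-- `w` lies over `v` along `φ`. -/
def LiesOver (w : FFPrime L) (v : FFPrime K) (φ : K →+* L) : Prop :=
  ∃ e : ℕ, w.LiesOverWith v φ e

open Classical in
/-- The ramification index `e(w/v)`. -/
noncomputable def ramIdx (w : FFPrime L) (v : FFPrime K) (φ : K →+* L) : ℕ :=
  if h : ∃ e : ℕ, w.LiesOverWith v φ e then h.choose else 0

/-- The residue field of `v` has exactly `n` elements. -/
def HasResidueCard (v : FFPrime K) (n : ℕ) : Prop :=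
  ∃ s : Finset K, s.card = n ∧ (∀ x ∈ s, 0 ≤ v.ord x) ∧
    (∀ x ∈ s, ∀ y ∈ s, x ≠ y → ¬ 0 < v.ord (x - y)) ∧
    (∀ z : K, 0 ≤ v.ord z → ∃ x ∈ s, 0 < v.ord (z - x))

open Classical in
/-- The residue (relative) degree `f(w/v)`: the unique `f ≥ 1` with
`#κ_w = (#κ_v) ^ f` (residue fields of global function fields are finite). -/
noncomputable def resDeg (w : FFPrime L) (v : FFPrime K) : ℕ :=
  if h : ∃ f : ℕ, 0 < f ∧ ∃ m n : ℕ, 1 < m ∧ v.HasResidueCard m ∧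
      w.HasResidueCard n ∧ n = m ^ f then h.choose else 0

/-- `v` splits completely in the extension given by `φ`: every prime above it has
ramification index and residue degree `1`. -/
def SplitsCompletely (v : FFPrime K) (φ : K →+* L) : Prop :=
  ∀ w : FFPrime L, w.LiesOver v φ → w.ramIdx v φ = 1 ∧ w.resDeg v = 1

/-- `v` is inert in the finite extension `M/K`: there is a unique prime above it, with
ramification index `1` and residue degree `[M : K]`. -/
def IsInert (v : FFPrime K) (M : Type) [Field M] [Algebra K M] : Prop :=
  (∃! w : FFPrime M, w.LiesOver v (algebraMap K M)) ∧
    ∀ w : FFPrime M, w.LiesOver v (algebraMap K M) →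
      w.ramIdx v (algebraMap K M) = 1 ∧ w.resDeg v = Module.finrank K M

/-- `v` ramifies in the extension given by `φ`: some prime above it has ramification
index `> 1`. -/
def Ramifies (v : FFPrime K) (φ : K →+* L) : Prop :=
  ∃ w : FFPrime L, w.LiesOver v φ ∧ 2 ≤ w.ramIdx v φ

/-- `ord_v z ≡ 0 mod q`. -/
def OrdDvd (v : FFPrime K) (q : ℕ) (z : K) : Prop :=
  ∃ n : ℤ, v.ord z = (((q : ℤ) * n : ℤ) : WithTop ℤ)

end FFPrime

/-- A nontrivial (rank one) valuation on a possibly infinite algebraic extension of a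
global function field, with values in `ℚ ∪ {∞}`. -/
structure FFVal (B : Type) [Field B] where
  ord : B → WithTop ℚ
  ord_zero : ord 0 = ⊤
  ord_ne_top : ∀ x : B, x ≠ 0 → ord x ≠ ⊤
  ord_one : ord 1 = 0
  ord_mul : ∀ x y : B, ord (x * y) = ord x + ord y
  ord_add : ∀ x y : B, min (ord x) (ord y) ≤ ord (x + y)
  nontrivial : ∃ x : B, ord x ≠ 0 ∧ ord x ≠ ⊤

/-- The valuation `V` of the big field restricts, up to a normalization factor `c`, to
the (normalized discrete) prime `v` of `K` along `φ`; i.e. `v` is the prime of `K`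
lying below `V`. -/
def FFVal.RestrictsTo {K B : Type} [Field K] [Field B] (V : FFVal B) (v : FFPrime K)
    (φ : K →+* B) : Prop :=
  ∃ c : ℚ, 0 < c ∧
    ∀ x : K, V.ord (φ x) = ((c : ℚ) : WithTop ℚ) * WithTop.map (fun n : ℤ => (n : ℚ)) (v.ord x)

/-- The algebraic extension `B` of the rational function field `F0 = 𝔽_p(t)` is
`q`-bounded: for every valuation of `B`, the `q`-adic valuations of the ramification
indices and residue degrees along every finite subextension are bounded. -/
def IsQBounded (q : ℕ) (F0 B : Type) [Field F0] [Field B] [Algebra F0 B] : Prop :=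
  ∀ V : FFVal B, ∃ C : ℕ,
    ∀ L : IntermediateField F0 B, FiniteDimensional F0 L →
      ∀ v0 : FFPrime F0, ∀ vL : FFPrime L,
        V.RestrictsTo v0 (algebraMap F0 B) →
        V.RestrictsTo vL L.val.toRingHom →
        padicValNat q (vL.ramIdx v0 (algebraMap F0 L)) ≤ C ∧
        padicValNat q (vL.resDeg v0) ≤ C

/-- The prime `v` of `K` has uniformly `q`-bounded ramification in `B`. -/
def UnifQBoundedRam (q : ℕ) {K : Type} [Field K] (B : Type) [Field B] [Algebra K B]
    (v : FFPrime K) : Prop :=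
  ∃ C : ℕ, ∀ F : IntermediateField K B, FiniteDimensional K F →
    ∀ w : FFPrime F, w.LiesOver v (algebraMap K F) →
      padicValNat q (w.ramIdx v (algebraMap K F)) ≤ C

/-- The prime `v` of `K` has uniformly absolutely bounded ramification in `B`. -/
def UnifAbsBoundedRam {K : Type} [Field K] (B : Type) [Field B] [Algebra K B]
    (v : FFPrime K) : Prop :=
  ∃ C : ℕ, ∀ F : IntermediateField K B, FiniteDimensional K F →
    ∀ w : FFPrime F, w.LiesOver v (algebraMap K F) →
      w.ramIdx v (algebraMap K F) ≤ C

/-- The prime `v` of `K` has uniformly `q`-bounded relative (residue) degree in `B`. -/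
def UnifQBoundedRes (q : ℕ) {K : Type} [Field K] (B : Type) [Field B] [Algebra K B]
    (v : FFPrime K) : Prop :=
  ∃ C : ℕ, ∀ F : IntermediateField K B, FiniteDimensional K F →
    ∀ w : FFPrime F, w.LiesOver v (algebraMap K F) →
      padicValNat q (w.resDeg v) ≤ C

/-- The prime `v` of `K` is uniformly `q`-bounded in `B`. -/
def UniformlyQBoundedAt (q : ℕ) {K : Type} [Field K] (B : Type) [Field B] [Algebra K B]
    (v : FFPrime K) : Prop :=
  UnifQBoundedRam q B v ∧ UnifQBoundedRes q B v

/-- The integral closure in `B` of the valuation ring `O_v = {x ∈ K : ord_v x ≥ 0}`. -/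
def valIntegralClosure {K : Type} [Field K] (v : FFPrime K) (B : Type) [Field B]
    [Algebra K B] : Set B :=
  {x : B | ∃ P : Polynomial K, P.Monic ∧ (∀ n : ℕ, 0 ≤ v.ord (P.coeff n)) ∧
    Polynomial.aeval x P = 0}

/-- The integral closure in `B` of the ring `O_{K,S}` of `S`-integers of `K`. -/
def sIntegralClosure {K : Type} [Field K] (S : Set (FFPrime K)) (B : Type) [Field B]
    [Algebra K B] : Set B :=
  {x : B | ∃ P : Polynomial K, P.Monic ∧
    (∀ n : ℕ, ∀ v : FFPrime K, v ∉ S → 0 ≤ v.ord (P.coeff n)) ∧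
    Polynomial.aeval x P = 0}

/-- Elements of `B` that are units at every prime of `B` lying over a prime of `S`. -/
def unitsAtS {K : Type} [Field K] (S : Set (FFPrime K)) (B : Type) [Field B]
    [Algebra K B] : Set B :=
  {x : B | ∀ V : FFVal B, (∃ v ∈ S, V.RestrictsTo v (algebraMap K B)) → V.ord x = 0}

/-- Elements `x` of `B` with `ord (x - 1) > 0` at every prime of `B` lying over a
prime of `S`. -/
def onesAtS {K : Type} [Field K] (S : Set (FFPrime K)) (B : Type) [Field B]
    [Algebra K B] : Set B :=
  {x : B | ∀ V : FFVal B, (∃ v ∈ S, V.RestrictsTo v (algebraMap K B)) → 0 < V.ord (x - 1)}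

/-- A subset of a commutative ring is first-order definable in the language of rings
`{0, 1, +, ·}` with parameters from the ring. -/
def FODefinable {R : Type} [CommRing R] (X : Set R) : Prop :=
  letI : FirstOrder.Ring.CompatibleRing R := FirstOrder.Ring.compatibleRingOfRing R
  Set.Definable₁ (Set.univ : Set R) FirstOrder.Language.ring X

/-- A subset of a commutative ring is existentially (diophantine) definable: it is cut
out by a block of existential quantifiers followed by a system of polynomial equations,
with parameters (coefficients) from the ring. -/
def ExistDefinable {R : Type} [CommRing R] (X : Set R) : Prop :=
  ∃ (k m : ℕ) (P : Fin m → MvPolynomial (Fin (k + 1)) R),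
    ∀ x : R, x ∈ X ↔ ∃ y : Fin k → R, ∀ i : Fin m,
      MvPolynomial.eval (Fin.cons x y) (P i) = 0

/-- Solvability of the norm equation `N(y) = b·x^q + b^q` over (every realization of)
the tower `L₂(a^{1/q})/L₂`, where `L₁ = F((1+(b x^q+b^q)⁻¹)^{1/q})` and
`L₂ = L₁((1+(a+a⁻¹)b⁻¹)^{1/q})`. -/
def NormTower2Solvable (q : ℕ) (F : Type) [Field F] (a b x : F) : Prop :=
  ∀ (M1 : Type) [Field M1] [Algebra F M1] (α1 : M1),
    α1 ^ q = algebraMap F M1 (1 + (b * x ^ q + b ^ q)⁻¹) →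
    IntermediateField.adjoin F {α1} = ⊤ →
    ∀ (M2 : Type) [Field M2] [Algebra M1 M2] (α2 : M2),
      α2 ^ q = algebraMap M1 M2 (algebraMap F M1 (1 + (a + a⁻¹) * b⁻¹)) →
      IntermediateField.adjoin M1 {α2} = ⊤ →
      ∀ (M3 : Type) [Field M3] [Algebra M2 M3] (α3 : M3),
        α3 ^ q = algebraMap M2 M3 (algebraMap M1 M2 (algebraMap F M1 a)) →
        IntermediateField.adjoin M2 {α3} = ⊤ →
        ∃ y : M3, Algebra.norm M2 y = algebraMap M1 M2 (algebraMap F M1 (b * x ^ q + b ^ q))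

/-- Solvability of the norm equation `N(y) = b·x^q + b^q` over (every realization of)
the tower `L₄(a^{1/q})/L₄`, where `L₁ = F((1+(b x^q+b^q)⁻¹)^{1/q})`,
`L₃ = L₁((1+x⁻¹)^{1/q})` and `L₄ = L₃((1+(a+a⁻¹)x⁻¹)^{1/q})`. -/
def NormTower4Solvable (q : ℕ) (F : Type) [Field F] (a b x : F) : Prop :=
  ∀ (M1 : Type) [Field M1] [Algebra F M1] (α1 : M1),
    α1 ^ q = algebraMap F M1 (1 + (b * x ^ q + b ^ q)⁻¹) →
    IntermediateField.adjoin F {α1} = ⊤ →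
    ∀ (M3 : Type) [Field M3] [Algebra M1 M3] (α3 : M3),
      α3 ^ q = algebraMap M1 M3 (algebraMap F M1 (1 + x⁻¹)) →
      IntermediateField.adjoin M1 {α3} = ⊤ →
      ∀ (M4 : Type) [Field M4] [Algebra M3 M4] (α4 : M4),
        α4 ^ q = algebraMap M3 M4 (algebraMap M1 M3 (algebraMap F M1 (1 + (a + a⁻¹) * x⁻¹))) →
        IntermediateField.adjoin M3 {α4} = ⊤ →
        ∀ (M5 : Type) [Field M5] [Algebra M4 M5] (α5 : M5),
          α5 ^ q = algebraMap M4 M5 (algebraMap M3 M4 (algebraMap M1 M3 (algebraMap F M1 a))) →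
          IntermediateField.adjoin M4 {α5} = ⊤ →
          ∃ y : M5, Algebra.norm M4 y =
            algebraMap M3 M4 (algebraMap M1 M3 (algebraMap F M1 (b * x ^ q + b ^ q)))

/-- Unsolvability of the norm equation `N(y) = b·x^q + b^q` over (every realization of)
the tower `L₄(a^{1/q})/L₄` as in `NormTower4Solvable`. -/
def NormTower4Unsolvable (q : ℕ) (F : Type) [Field F] (a b x : F) : Prop :=
  ∀ (M1 : Type) [Field M1] [Algebra F M1] (α1 : M1),
    α1 ^ q = algebraMap F M1 (1 + (b * x ^ q + b ^ q)⁻¹) →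
    IntermediateField.adjoin F {α1} = ⊤ →
    ∀ (M3 : Type) [Field M3] [Algebra M1 M3] (α3 : M3),
      α3 ^ q = algebraMap M1 M3 (algebraMap F M1 (1 + x⁻¹)) →
      IntermediateField.adjoin M1 {α3} = ⊤ →
      ∀ (M4 : Type) [Field M4] [Algebra M3 M4] (α4 : M4),
        α4 ^ q = algebraMap M3 M4 (algebraMap M1 M3 (algebraMap F M1 (1 + (a + a⁻¹) * x⁻¹))) →
        IntermediateField.adjoin M3 {α4} = ⊤ →
        ∀ (M5 : Type) [Field M5] [Algebra M4 M5] (α5 : M5),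
          α5 ^ q = algebraMap M4 M5 (algebraMap M3 M4 (algebraMap M1 M3 (algebraMap F M1 a))) →
          IntermediateField.adjoin M4 {α5} = ⊤ →
          ¬ ∃ y : M5, Algebra.norm M4 y =
            algebraMap M3 M4 (algebraMap M1 M3 (algebraMap F M1 (b * x ^ q + b ^ q)))


section
set_option linter.all false

namespace FFPrime
variable {F : Type} [Field F] (w : FFPrime F)

/-- Integer valued version of `ord`. -/
def z (x : F) : ℤ := (w.ord x).untopD 0

lemma ord_eq {x : F} (hx : x ≠ 0) : w.ord x = ((w.z x : ℤ) : WithTop ℤ) := by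
  unfold z
  cases h : w.ord x with
  | top => exact absurd h (w.ord_ne_top x hx)
  | coe a => simp

lemma z_one : w.z 1 = 0 := by simp [z, w.ord_one]

lemma z_mul {x y : F} (hx : x ≠ 0) (hy : y ≠ 0) : w.z (x * y) = w.z x + w.z y := by
  have h := w.ord_mul x y
  rw [w.ord_eq hx, w.ord_eq hy, w.ord_eq (mul_ne_zero hx hy)] at h
  exact_mod_cast h

lemma z_inv {x : F} (hx : x ≠ 0) : w.z x⁻¹ = - w.z x := by
  have h := w.z_mul hx (inv_ne_zero hx)
  rw [mul_inv_cancel₀ hx, z_one] at h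
  lia

lemma z_div {x y : F} (hx : x ≠ 0) (hy : y ≠ 0) : w.z (x / y) = w.z x - w.z y := by
  rw [div_eq_mul_inv, w.z_mul hx (inv_ne_zero hy), w.z_inv hy]; ring

lemma z_pow {x : F} (hx : x ≠ 0) (n : ℕ) : w.z (x ^ n) = n * w.z x := by
  induction n with
  | zero => simp [z_one]
  | succ n ih => rw [pow_succ, w.z_mul (pow_ne_zero n hx) hx, ih]; push_cast; ring

lemma z_zpow {x : F} (hx : x ≠ 0) (n : ℤ) : w.z (x ^ n) = n * w.z x := by
  obtain ⟨m, rfl | rfl⟩ := n.eq_nat_or_neg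
  · rw [zpow_natCast, z_pow _ hx]
  · rw [zpow_neg, zpow_natCast, z_inv _ (pow_ne_zero _ hx), z_pow _ hx]; ring

lemma z_neg_one : w.z (-1) = 0 := by
  have h := w.z_mul (x := (-1 : F)) (y := -1) (by simp) (by simp)
  simp only [neg_mul_neg, mul_one, z_one] at h
  lia

lemma z_neg (x : F) : w.z (-x) = w.z x := by
  by_cases hx : x = 0
  · simp [hx]
  · rw [neg_eq_neg_one_mul, z_mul _ (by simp) hx, z_neg_one, zero_add]

lemma ord_neg (x : F) : w.ord (-x) = w.ord x := by
  by_cases hx : x = 0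
  · simp [hx]
  · rw [w.ord_eq hx, w.ord_eq (neg_ne_zero.mpr hx), z_neg]

lemma z_add {x y : F} (hx : x ≠ 0) (hy : y ≠ 0) (hxy : x + y ≠ 0) :
    min (w.z x) (w.z y) ≤ w.z (x + y) := by
  have h := w.ord_add x y
  rw [w.ord_eq hx, w.ord_eq hy, w.ord_eq hxy] at h
  exact_mod_cast h

lemma nonneg_iff {x : F} : 0 ≤ w.ord x ↔ x = 0 ∨ 0 ≤ w.z x := by
  by_cases hx : x = 0
  · simp [hx, w.ord_zero]
  · rw [w.ord_eq hx]; simp [hx]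

lemma pos_iff {x : F} : 0 < w.ord x ↔ x = 0 ∨ 0 < w.z x := by
  by_cases hx : x = 0
  · simp [hx, w.ord_zero]
  · rw [w.ord_eq hx]; simp [hx]

lemma le_ord_iff {x : F} {n : ℤ} : (n : WithTop ℤ) ≤ w.ord x ↔ x = 0 ∨ n ≤ w.z x := by
  by_cases hx : x = 0
  · simp [hx, w.ord_zero]
  · rw [w.ord_eq hx]; simp [hx]

lemma exists_z (n : ℤ) : ∃ x : F, x ≠ 0 ∧ w.z x = n := by
  obtain ⟨x, hx⟩ := w.ord_surj n
  refine ⟨x, ?_, by simp [z, hx]⟩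
  rintro rfl
  rw [w.ord_zero] at hx
  exact absurd hx (by simp)

/-- valuation ring -/
def V : ValuationSubring F where
  carrier := {x | 0 ≤ w.ord x}
  mul_mem' := by
    intro a b ha hb
    simp only [Set.mem_ofPred_eq] at *
    rw [w.ord_mul]; exact add_nonneg ha hb
  one_mem' := by simp [w.ord_one]
  add_mem' := by
    intro a b ha hb
    exact le_trans (le_min ha hb) (w.ord_add a b)
  zero_mem' := by simp [w.ord_zero]
  neg_mem' := by
    intro a ha
    simp only [Set.mem_ofPred_eq] at *
    rwa [w.ord_neg]
  mem_or_inv_mem' := by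
    intro a
    simp only [Set.mem_ofPred_eq, Subring.mem_mk]
    change 0 ≤ w.ord a ∨ 0 ≤ w.ord a⁻¹
    by_cases ha : a = 0
    · simp [ha, w.ord_zero]
    · rw [w.nonneg_iff, w.nonneg_iff, w.z_inv ha]
      simp only [ha, false_or, inv_eq_zero]
      lia

lemma mem_V {x : F} : x ∈ w.V ↔ 0 ≤ w.ord x := Iff.rfl

lemma mem_V' {x : F} : x ∈ w.V ↔ x = 0 ∨ 0 ≤ w.z x := w.nonneg_iff

lemma z_nonneg_of_mem {x : F} (h : x ∈ w.V) : 0 ≤ w.z x := by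
  rcases w.mem_V'.1 h with rfl | h
  · simp [z, w.ord_zero]
  · exact h

lemma V_ne_top : w.V ≠ ⊤ := by
  intro h
  obtain ⟨x, hx, hz⟩ := w.exists_z (-1)
  have : x ∈ w.V := by rw [h]; trivial
  rw [mem_V'] at this
  rcases this with h | h
  · exact hx h
  · lia

lemma ord_nonneg_iff_z {x : F} (hx : x ≠ 0) : 0 ≤ w.ord x ↔ 0 ≤ w.z x := by
  rw [w.nonneg_iff]; simp [hx]

/-- maximality of discrete valuation rings -/
lemma V_maximal {U : ValuationSubring F} (h : w.V ≤ U) (hU : U ≠ ⊤) : U = w.V := by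
  refine le_antisymm ?_ h
  intro x hx
  by_contra hxV
  apply hU
  rw [mem_V'] at hxV
  push Not at hxV
  obtain ⟨hx0, hz⟩ := hxV
  rw [eq_top_iff]
  intro y _
  by_cases hy : y = 0
  · rw [hy]; exact zero_mem _
  have : y = (y * (x⁻¹) ^ (w.z y).natAbs) * x ^ (w.z y).natAbs := by
    rw [mul_assoc, ← mul_pow, inv_mul_cancel₀ hx0, one_pow, mul_one]
  rw [this]
  refine mul_mem (h ?_) (pow_mem hx _)
  rw [mem_V', w.z_mul hy (pow_ne_zero _ (inv_ne_zero hx0)), w.z_pow (inv_ne_zero hx0),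
    w.z_inv hx0]
  right
  have : (w.z y).natAbs * (1 : ℤ) ≤ (w.z y).natAbs * (-w.z x) :=
    mul_le_mul_of_nonneg_left (by lia) (by lia)
  lia

lemma z_eq_zero_iff {x : F} (hx : x ≠ 0) : w.z x = 0 ↔ x ∈ w.V ∧ x⁻¹ ∈ w.V := by
  rw [mem_V', mem_V', w.z_inv hx]
  simp [hx]
  lia

lemma liesOverWith_of_comap {L : Type} [Field L] (W : FFPrime L) (φ : F →+* L)
    (h : ∀ x : F, φ x ∈ W.V ↔ x ∈ w.V) : ∃ e : ℕ, W.LiesOverWith w φ e := by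
  obtain ⟨t, ht, hzt⟩ := w.exists_z 1
  have hφ : ∀ x : F, x ≠ 0 → φ x ≠ 0 := fun x hx => by simpa using hx
  have hunit : ∀ x : F, x ≠ 0 → w.z x = 0 → W.z (φ x) = 0 := by
    intro x hx h0
    rw [W.z_eq_zero_iff (hφ x hx), ← map_inv₀, h, h]
    exact (w.z_eq_zero_iff hx).1 h0
  have hpos : 0 < W.z (φ t) := by
    have h1 : 0 ≤ W.z (φ t) := W.z_nonneg_of_mem ((h t).2 (by rw [mem_V']; right; lia))
    rcases h1.lt_or_eq with h2 | h2
    · exact h2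
    · have := (W.z_eq_zero_iff (hφ t ht)).1 h2.symm
      rw [← map_inv₀, h, h] at this
      have := (w.z_eq_zero_iff ht).2 this
      lia
  refine ⟨(W.z (φ t)).toNat, by lia, ?_⟩
  intro x
  by_cases hx : x = 0
  · simp only [hx, map_zero, W.ord_zero, w.ord_zero]
    rw [WithTop.mul_top]
    have : (((W.z (φ t)).toNat : ℤ)) ≠ 0 := by lia
    exact_mod_cast this
  · have hu := hunit (x * t ^ (- w.z x)) (mul_ne_zero hx (zpow_ne_zero _ ht)) (by
      rw [w.z_mul hx (zpow_ne_zero _ ht), w.z_zpow ht, hzt]; ring)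
    rw [map_mul, W.z_mul (hφ _ hx) (hφ _ (zpow_ne_zero _ ht)), map_zpow₀,
      W.z_zpow (hφ _ ht)] at hu
    rw [W.ord_eq (hφ _ hx), w.ord_eq hx, ← WithTop.coe_mul]
    congr 1
    rw [Int.toNat_of_nonneg hpos.le]
    linarith

lemma LiesOverWith.z_eq {L : Type} [Field L] {W : FFPrime L} {w : FFPrime F} {φ : F →+* L} {e : ℕ}
    (h : W.LiesOverWith w φ e) (x : F) : W.z (φ x) = e * w.z x := by
  by_cases hx : x = 0
  · simp [hx, z, W.ord_zero, w.ord_zero]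
  · have := h.2 x
    rw [W.ord_eq (by simpa using hx), w.ord_eq hx, ← WithTop.coe_mul] at this
    exact_mod_cast this

lemma LiesOverWith.ramIdx_eq {L : Type} [Field L] {W : FFPrime L} {w : FFPrime F} {φ : F →+* L}
    {e : ℕ} (h : W.LiesOverWith w φ e) : W.ramIdx w φ = e := by
  have hex : ∃ e : ℕ, W.LiesOverWith w φ e := ⟨e, h⟩
  unfold ramIdx
  rw [dif_pos hex]
  obtain ⟨t, ht, hzt⟩ := w.exists_z 1
  have h1 := hex.choose_spec.z_eq t
  rw [h.z_eq t, hzt] at h1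
  simp only [mul_one] at h1
  exact_mod_cast h1.symm

lemma ext_V {w w' : FFPrime F} (h : w.V = w'.V) : ∀ x, w.ord x = w'.ord x := by
  obtain ⟨e, he⟩ := w.liesOverWith_of_comap w' (RingHom.id F) (by intro x; rw [h]; rfl)
  obtain ⟨t, ht, hzt⟩ := w.exists_z 1
  obtain ⟨s, hs, hzs⟩ := w'.exists_z 1
  have h2 := he.z_eq s
  simp only [RingHom.id_apply, hzs] at h2
  have : (e : ℤ) ∣ 1 := ⟨_, h2⟩
  have he1 : e = 1 := by
    have := Int.natCast_dvd_natCast.1 (by simpa using this : (e : ℤ) ∣ ((1 : ℕ) : ℤ))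
    simpa using this
  intro x
  have := he.2 x
  simp only [he1, RingHom.id_apply, Nat.cast_one, WithTop.coe_one, one_mul] at this
  exact this.symm

open Classical in
/-- construct from a surjective valuation -/
def ofValuation (v : Valuation F (WithZero (Multiplicative ℤ))) (hv : Function.Surjective v) :
    FFPrime F where
  ord x := if x = 0 then ⊤ else ((-WithZero.log (v x) : ℤ) : WithTop ℤ)
  ord_zero := by simp
  ord_ne_top x hx := by simp [hx]
  ord_one := by simp
  ord_mul x y := by
    by_cases hx : x = 0
    · simp [hx]
    by_cases hy : y = 0
    · simp [hy]
    simp only [hx, hy, mul_eq_zero, or_self, if_false, map_mul]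
    rw [WithZero.log_mul (by simpa using hx) (by simpa using hy), neg_add, WithTop.coe_add]
  ord_add x y := by
    by_cases hx : x = 0
    · simp [hx]
    by_cases hy : y = 0
    · simp [hy]
    by_cases hxy : x + y = 0
    · simp [hxy]
    simp only [hx, hy, hxy, if_false]
    rw [← WithTop.coe_min, WithTop.coe_le_coe]
    have h := v.map_add x y
    rw [le_max_iff] at h
    rw [min_le_iff]
    have hx' : v x ≠ 0 := by simpa using hx
    have hy' : v y ≠ 0 := by simpa using hy
    have hxy' : v (x + y) ≠ 0 := by simpa using hxy
    rcases h with h | h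
    · left; exact neg_le_neg ((WithZero.log_le_log hxy' hx').2 h)
    · right; exact neg_le_neg ((WithZero.log_le_log hxy' hy').2 h)
  ord_surj n := by
    obtain ⟨x, hx⟩ := hv (WithZero.exp (-n))
    refine ⟨x, ?_⟩
    have : x ≠ 0 := by
      rintro rfl
      simp at hx
      exact WithZero.exp_ne_zero hx.symm
    simp [this, hx]

lemma mem_V_ofValuation (v : Valuation F (WithZero (Multiplicative ℤ)))
    (hv : Function.Surjective v) (x : F) : x ∈ (ofValuation v hv).V ↔ v x ≤ 1 := by
  rw [mem_V]
  by_cases hx : x = 0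
  · simp [hx, ofValuation]
  · simp only [ofValuation, hx, if_false]
    have hx' : v x ≠ 0 := by simpa using hx
    rw [← WithTop.coe_zero, WithTop.coe_le_coe, neg_nonneg, ← WithZero.log_one,
      WithZero.log_le_log hx' one_ne_zero]

end FFPrime

end

section
set_option linter.all false
open Polynomial IntermediateField

namespace HW
/-- global function field of characteristic `p` -/
def GFF (p : ℕ) [Fact p.Prime] (F : Type) [Field F] : Prop :=
  ∃ φ : RatFunc (ZMod p) →+* F, φ.Finite

def SepAt (p : ℕ) [Fact p.Prime] (F : Type) [Field F] (y : F) : Prop :=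
  ∃ φ : RatFunc (ZMod p) →+* F, φ RatFunc.X = y ∧ φ.Finite ∧
    @Algebra.IsSeparable (RatFunc (ZMod p)) F _ _ φ.toAlgebra

variable {p : ℕ} [Fact p.Prime] {F : Type} [Field F]

lemma GFF.charP (h : GFF p F) : CharP F p := by
  obtain ⟨φ, _⟩ := h
  exact (RingHom.charP_iff φ φ.injective p).1 inferInstance

lemma GFF.of_finite (h : GFF p F) {L : Type} [Field L] [Algebra F L] [FiniteDimensional F L] :
    GFF p L := by
  obtain ⟨φ, hφ⟩ := h
  refine ⟨(algebraMap F L).comp φ, RingHom.Finite.comp ?_ hφ⟩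
  rw [RingHom.finite_algebraMap]; infer_instance

variable [Algebra (ZMod p) F]

lemma zmod_tower {A B : Type*} [CommRing A] [CommRing B] [Algebra (ZMod p) A] [Algebra (ZMod p) B]
    [Algebra A B] : IsScalarTower (ZMod p) A B :=
  IsScalarTower.of_algebraMap_eq' (RingHom.ext_zmod _ _)

lemma GFF.ess (h : GFF p F) : Algebra.EssFiniteType (ZMod p) F := by
  obtain ⟨φ, hφ⟩ := h
  letI := φ.toAlgebra
  haveI : Module.Finite (RatFunc (ZMod p)) F := hφ
  haveI : IsScalarTower (ZMod p) (RatFunc (ZMod p)) F := zmod_tower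
  have h1 : Algebra.EssFiniteType (ZMod p)[X] (RatFunc (ZMod p)) :=
    Algebra.EssFiniteType.of_isLocalization _ (nonZeroDivisors (ZMod p)[X])
  have h2 : Algebra.EssFiniteType (ZMod p) (RatFunc (ZMod p)) :=
    Algebra.EssFiniteType.comp _ (ZMod p)[X] _
  exact Algebra.EssFiniteType.comp _ (RatFunc (ZMod p)) _

lemma GFF.trdeg (h : GFF p F) : Algebra.trdeg (ZMod p) F = 1 := by
  obtain ⟨φ, hφ⟩ := h
  letI := φ.toAlgebra
  haveI : Module.Finite (RatFunc (ZMod p)) F := hφ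
  haveI : IsScalarTower (ZMod p) (RatFunc (ZMod p)) F := zmod_tower
  rw [← _root_.trdeg_add_eq (ZMod p) (RatFunc (ZMod p)) (A := F),
    ← _root_.trdeg_add_eq (ZMod p) (ZMod p)[X] (A := RatFunc (ZMod p))]
  have : Algebra.IsAlgebraic (ZMod p)[X] (RatFunc (ZMod p)) :=
    IsLocalization.isAlgebraic _ (nonZeroDivisors (ZMod p)[X])
  simp [trdeg_eq_zero]

lemma GFF.algebraic (h : GFF p F) {y : F} (hy : Transcendental (ZMod p) y) :
    Algebra.IsAlgebraic (ZMod p)⟮y⟯ F := by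
  have h1 := _root_.trdeg_add_eq (ZMod p) (ZMod p)⟮y⟯ (A := F)
  rw [h.trdeg] at h1
  have h2 : Algebra.trdeg (ZMod p) (ZMod p)⟮y⟯ ≠ 0 := by
    rw [trdeg_ne_zero_iff]
    refine ⟨⟨AdjoinSimple.gen _ y, ?_⟩⟩
    intro h
    apply hy
    exact h.algebraMap (A := F)
  rw [← trdeg_eq_zero_iff]
  have h3 : 1 ≤ Algebra.trdeg (ZMod p) (ZMod p)⟮y⟯ := Cardinal.one_le_iff_ne_zero.2 h2
  by_contra h4
  have h5 := Cardinal.one_le_iff_ne_zero.2 h4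
  have := add_le_add h3 h5
  rw [h1] at this
  norm_num at this

lemma GFF.sepAt_of (h : GFF p F) {y : F} (hy : Transcendental (ZMod p) y)
    (hs : Algebra.IsSeparable (ZMod p)⟮y⟯ F) : SepAt p F y := by
  haveI := h.ess
  let e := RatFunc.algEquivOfTranscendental y hy
  let φ : RatFunc (ZMod p) →+* F := (algebraMap (ZMod p)⟮y⟯ F).comp e.toRingEquiv.toRingHom
  haveI : Algebra.EssFiniteType (ZMod p)⟮y⟯ F := Algebra.EssFiniteType.of_comp (ZMod p) _ _
  haveI : FiniteDimensional (ZMod p)⟮y⟯ F :=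
    Algebra.finite_of_essFiniteType_of_isAlgebraic
  refine ⟨φ, ?_, ?_, ?_⟩
  · simp [φ, e, RatFunc.algEquivOfTranscendental_X]
  · refine RingHom.Finite.comp ?_ (RingHom.Finite.of_surjective _ e.surjective)
    rw [RingHom.finite_algebraMap]; infer_instance
  · letI := φ.toAlgebra
    exact Algebra.IsSeparable.of_equiv_equiv e.symm.toRingEquiv (RingEquiv.refl F) (by
      ext x
      change φ (e.symm x) = _
      simp [φ])

lemma GFF.exists_sep (h : GFF p F) : ∃ t : F, Transcendental (ZMod p) t ∧ SepAt p F t ∧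
    Algebra.IsSeparable (ZMod p)⟮t⟯ F := by
  haveI := h.ess
  obtain ⟨s, hs, hsep⟩ := exists_isTranscendenceBasis_and_isSeparable_of_perfectField (ZMod p) F
  have h1 := hs.cardinalMk_eq_trdeg
  rw [h.trdeg] at h1
  have : s.card = 1 := by
    simpa using h1
  obtain ⟨t, rfl⟩ := Finset.card_eq_one.1 this
  have ht : Transcendental (ZMod p) t := hs.1.transcendental ⟨t, by simp⟩
  have hsep' : Algebra.IsSeparable (ZMod p)⟮t⟯ F := by
    convert hsep <;> simp
  exact ⟨t, ht, h.sepAt_of ht hsep', hsep'⟩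

end HW

end

section
set_option linter.all false
open Polynomial IntermediateField

namespace HW
variable {p : ℕ} [Fact p.Prime] {F : Type} [Field F] [Algebra (ZMod p) F]

lemma D_inv_mem (N : Submodule F (Ω[F⁄ZMod p])) {x : F}
    (hx : KaehlerDifferential.D (ZMod p) F x ∈ N) : KaehlerDifferential.D (ZMod p) F x⁻¹ ∈ N := by
  by_cases h0 : x = 0
  · simp [h0]
  have h : KaehlerDifferential.D (ZMod p) F (x * x⁻¹) = 0 := by
    rw [mul_inv_cancel₀ h0]; simp
  rw [Derivation.leibniz] at h
  have h2 : KaehlerDifferential.D (ZMod p) F x⁻¹ =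
      -(x⁻¹ • x⁻¹ • KaehlerDifferential.D (ZMod p) F x) := by
    have h3 := congrArg (fun m => x⁻¹ • m) h
    simp only [smul_add, smul_zero, inv_smul_smul₀ h0] at h3
    exact eq_neg_of_add_eq_zero_left h3
  rw [h2]
  exact N.neg_mem (N.smul_mem _ (N.smul_mem _ hx))

lemma D_mem_of_adjoin (N : Submodule F (Ω[F⁄ZMod p])) {s : Set F}
    (hs : ∀ x ∈ s, KaehlerDifferential.D (ZMod p) F x ∈ N) {x : F}
    (hx : x ∈ adjoin (ZMod p) s) :
    KaehlerDifferential.D (ZMod p) F x ∈ N := by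
  induction hx using IntermediateField.adjoin_induction with
  | mem x h => exact hs x h
  | algebraMap r => simp
  | add x y _ _ h1 h2 => rw [map_add]; exact N.add_mem h1 h2
  | inv x _ h => exact D_inv_mem N h
  | mul x y _ _ h1 h2 =>
    rw [Derivation.leibniz]; exact N.add_mem (N.smul_mem _ h2) (N.smul_mem _ h1)

lemma span_D_eq_top {t : F} (hs : Algebra.IsSeparable (ZMod p)⟮t⟯ F) :
    Submodule.span F {KaehlerDifferential.D (ZMod p) F t} = ⊤ := by
  rw [eq_top_iff]
  intro ω hω
  clear hω
  haveI := Algebra.FormallyUnramified.of_isSeparable (ZMod p)⟮t⟯ F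
  have hsub : Subsingleton (Ω[F⁄(ZMod p)⟮t⟯]) := inferInstance
  obtain ⟨u, rfl⟩ := (KaehlerDifferential.exact_mapBaseChange_map (ZMod p) (ZMod p)⟮t⟯ F ω).1
    (Subsingleton.elim _ _)
  induction u with
  | zero => simp
  | add a b ha hb => rw [map_add]; exact Submodule.add_mem _ ha hb
  | tmul b m =>
    rw [KaehlerDifferential.mapBaseChange_tmul]
    refine Submodule.smul_mem _ _ ?_
    have hm : m ∈ Submodule.span (ZMod p)⟮t⟯
      (Set.range (KaehlerDifferential.D (ZMod p) (ZMod p)⟮t⟯)) := by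
      rw [KaehlerDifferential.span_range_derivation]; trivial
    induction hm using Submodule.span_induction with
    | mem x h =>
      obtain ⟨a, rfl⟩ := h
      rw [KaehlerDifferential.map_D]
      exact D_mem_of_adjoin _ (s := {t}) (by
        rintro x rfl; exact Submodule.mem_span_singleton_self _) a.2
    | zero => simp
    | add x y _ _ hx hy => rw [map_add]; exact Submodule.add_mem _ hx hy
    | smul a x _ hx =>
      rw [map_smul]
      exact Submodule.smul_of_tower_mem _ a hx

lemma D_eq_zero_of_algebraic {y : F} (hy : IsAlgebraic (ZMod p) y) :
    KaehlerDifferential.D (ZMod p) F y = 0 := by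
  have hintg := hy.isIntegral
  have hsep := PerfectField.separable_of_irreducible (minpoly.irreducible hintg)
  have h := Derivation.map_aeval (KaehlerDifferential.D (ZMod p) F) (minpoly (ZMod p) y) y
  rw [minpoly.aeval, map_zero] at h
  have hne := hsep.aeval_derivative_ne_zero (minpoly.aeval (ZMod p) y)
  exact (smul_eq_zero.1 h.symm).resolve_left hne

lemma GFF.sepAt_of_D (h : GFF p F) {y : F} (hy : KaehlerDifferential.D (ZMod p) F y ≠ 0) :
    Transcendental (ZMod p) y ∧ SepAt p F y := by
  have htr : Transcendental (ZMod p) y := fun h => hy (D_eq_zero_of_algebraic h)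
  refine ⟨htr, h.sepAt_of htr ?_⟩
  obtain ⟨t, ht, -, hsep⟩ := h.exists_sep
  have hspan := span_D_eq_top hsep
  haveI := h.ess
  haveI : Algebra.EssFiniteType (ZMod p)⟮y⟯ F := Algebra.EssFiniteType.of_comp (ZMod p) _ _
  rw [← Algebra.FormallyUnramified.iff_isSeparable]
  constructor
  constructor
  have hD : ∀ x : F, KaehlerDifferential.D (ZMod p) F x ∈
      Submodule.span F {KaehlerDifferential.D (ZMod p) F y} := by
    have hy' : KaehlerDifferential.D (ZMod p) F y ∈
      Submodule.span F {KaehlerDifferential.D (ZMod p) F t} := by rw [hspan]; trivial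
    obtain ⟨c, hc⟩ := Submodule.mem_span_singleton.1 hy'
    have hc0 : c ≠ 0 := by
      rintro rfl
      rw [zero_smul] at hc
      exact hy hc.symm
    intro x
    have hx' : KaehlerDifferential.D (ZMod p) F x ∈
      Submodule.span F {KaehlerDifferential.D (ZMod p) F t} := by rw [hspan]; trivial
    obtain ⟨d, hd⟩ := Submodule.mem_span_singleton.1 hx'
    rw [Submodule.mem_span_singleton]
    refine ⟨d * c⁻¹, ?_⟩
    rw [← hc, smul_smul, mul_assoc, inv_mul_cancel₀ hc0, mul_one, hd]
  have key : ∀ m : Ω[F⁄(ZMod p)⟮y⟯], m = 0 := by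
    intro m
    have hm : m ∈ Submodule.span F
      (Set.range (KaehlerDifferential.D (ZMod p)⟮y⟯ F)) := by
      rw [KaehlerDifferential.span_range_derivation]; trivial
    induction hm using Submodule.span_induction with
    | mem x h =>
      obtain ⟨a, rfl⟩ := h
      obtain ⟨c, hc⟩ := Submodule.mem_span_singleton.1 (hD a)
      have h1 := KaehlerDifferential.map_D (ZMod p) (ZMod p)⟮y⟯ F F a
      simp only [Algebra.algebraMap_self, RingHom.id_apply] at h1
      rw [← h1, ← hc, map_smul, KaehlerDifferential.map_D]
      have : KaehlerDifferential.D (ZMod p)⟮y⟯ F (algebraMap F F y) = 0 :=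
        (KaehlerDifferential.D (ZMod p)⟮y⟯ F).map_algebraMap (AdjoinSimple.gen (ZMod p) y)
      rw [this, smul_zero]
    | zero => rfl
    | add x y _ _ hx hy => rw [hx, hy, add_zero]
    | smul a x _ hx => rw [hx, smul_zero]
  intro a b
  rw [key a, key b]

end HW

end

section
set_option linter.all false
open Polynomial IntermediateField

namespace HW

instance finQuotPoly (p : ℕ) [Fact p.Prime] : Ring.HasFiniteQuotients (ZMod p)[X] where
  finiteQuotient {I} hI := by
    obtain ⟨g, rfl⟩ := (IsPrincipalIdealRing.principal I).principal
    have hg : g ≠ 0 := by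
      rintro rfl
      exact hI (by simp)
    have : Module.Finite (ZMod p) ((ZMod p)[X] ⧸ (Ideal.span {g})) :=
      (AdjoinRoot.powerBasis hg).finite
    exact Module.finite_of_finite (ZMod p)

/-- Dedekind: nontrivial valuation rings containing `S` are localizations at height one primes. -/
lemma exists_hos {S F : Type} [CommRing S] [IsDedekindDomain S] [Field F] [Algebra S F]
    [IsFractionRing S F] (V : ValuationSubring F) (hV : V ≠ ⊤)
    (h : ∀ s : S, algebraMap S F s ∈ V) :
    ∃ P : IsDedekindDomain.HeightOneSpectrum S,
      (FFPrime.ofValuation (P.valuation F) (P.valuation_surjective F)).V = V := by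
  let ψ : S →+* V := (algebraMap S F).codRestrict V.toSubring h
  let I : Ideal S := (IsLocalRing.maximalIdeal V).comap ψ
  have hI : I.IsPrime := Ideal.IsPrime.comap _
  have memI : ∀ s : S, s ∉ I → (algebraMap S F s)⁻¹ ∈ V := by
    intro s hs
    have : IsUnit (ψ s) := by
      by_contra hu
      exact hs hu
    obtain ⟨u, hu⟩ := this
    have h1 : ((u : V) : F) = algebraMap S F s := by rw [hu]; rfl
    have h2 : ((↑u⁻¹ : V) : F) * ((u : V) : F) = 1 := by
      rw [← MulMemClass.coe_mul]; simp
    rw [← h1, ← eq_inv_of_mul_eq_one_left h2]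
    exact (↑u⁻¹ : V).2
  have hI0 : I ≠ ⊥ := by
    intro h0
    apply hV
    rw [eq_top_iff]
    intro x _
    obtain ⟨a, b, hb, rfl⟩ := IsFractionRing.div_surjective (A := S) x
    rw [div_eq_mul_inv]
    refine V.mul_mem _ _ (h a) (memI b ?_)
    rw [h0]
    simpa using nonZeroDivisors.ne_zero hb
  refine ⟨⟨I, hI, hI0⟩, ?_⟩
  set P : IsDedekindDomain.HeightOneSpectrum S := ⟨I, hI, hI0⟩
  symm
  refine FFPrime.V_maximal _ ?_ hV
  intro x hx
  rw [FFPrime.mem_V_ofValuation] at hx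
  obtain ⟨n, d, hnd⟩ := P.exists_primeCompl_mul_eq_of_integer x hx
  have hd0 : algebraMap S F d ≠ 0 := by
    have : (d : S) ≠ 0 := by
      intro h0
      exact d.2 (by rw [h0]; exact I.zero_mem)
    simpa using this
  rw [eq_div_of_mul_eq hd0 hnd, div_eq_mul_inv]
  exact V.mul_mem _ _ (h n) (memI d d.2)

variable {p : ℕ} [Fact p.Prime] {F : Type} [Field F]

/-- Elements regular at all valuation rings containing `y`. -/
def Reg (y : F) : Subring F where
  carrier := {x | ∀ V : ValuationSubring F, y ∈ V → x ∈ V}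
  mul_mem' ha hb V hV := V.mul_mem _ _ (ha V hV) (hb V hV)
  one_mem' V _ := V.one_mem
  add_mem' ha hb V hV := V.add_mem _ _ (ha V hV) (hb V hV)
  zero_mem' V _ := V.zero_mem
  neg_mem' ha V hV := V.neg_mem _ (ha V hV)

lemma mem_Reg {x y : F} : x ∈ Reg y ↔ ∀ V : ValuationSubring F, y ∈ V → x ∈ V := Iff.rfl

lemma self_mem_Reg (y : F) : y ∈ Reg y := fun V h => h

structure Good (S : Subring F) : Prop where
  ded : IsDedekindDomain S
  frac : IsFractionRing S F
  hfq : Ring.HasFiniteQuotients S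
  cl : Finite (ClassGroup S)

/-- an element integral over something in a valuation ring is in the valuation ring -/
lemma mem_of_integral {A : Type*} [CommRing A] [Algebra A F] (V : ValuationSubring F)
    (h : ∀ a : A, algebraMap A F a ∈ V) {x : F} (hx : IsIntegral A x) : x ∈ V := by
  obtain ⟨P, hP, hPx⟩ := hx
  let ψ : A →+* V := (algebraMap A F).codRestrict V.toSubring h
  have : IsIntegral V x := by
    refine ⟨P.map ψ, hP.map ψ, ?_⟩
    rw [eval₂_map]
    exact hPx
  obtain ⟨y, rfl⟩ := IsIntegrallyClosed.isIntegral_iff.1 this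
  exact y.2

lemma zmod_mem [Algebra (ZMod p) F] (V : ValuationSubring F) (c : ZMod p) :
    algebraMap (ZMod p) F c ∈ V := by
  obtain ⟨n, rfl⟩ := ZMod.natCast_zmod_surjective c
  rw [map_natCast]
  exact natCast_mem V n

lemma aeval_mem [Algebra (ZMod p) F] {S : Type*} [SetLike S F] [SubringClass S F] (V : S) {y : F}
    (hy : y ∈ V) (g : (ZMod p)[X]) : aeval y g ∈ V := by
  induction g using Polynomial.induction_on' with
  | add a b ha hb => rw [map_add]; exact add_mem ha hb
  | monomial n a =>
    rw [aeval_monomial]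
    refine mul_mem ?_ (pow_mem hy n)
    obtain ⟨n, rfl⟩ := ZMod.natCast_zmod_surjective a
    rw [map_natCast]
    exact natCast_mem V n

lemma SepAt.pack [Algebra (ZMod p) F] {y : F} (h : SepAt p F y) :
    Good (Reg y) ∧ (∃ ω : Finset F, (∀ a ∈ ω, a ∈ Reg y) ∧ ∀ s ∈ Reg y, ∃ g : F → (ZMod p)[X],
      s = ∑ a ∈ ω, aeval y (g a) * a) ∧
    (∀ s ∈ Reg y, ∃ P : (ZMod p)[X][X], P.Monic ∧ eval₂ (aeval y : (ZMod p)[X] →ₐ[ZMod p] F).toRingHom s P = 0)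
     := by
  classical
  obtain ⟨φ, hφX, hfin, hsep⟩ := h
  letI := φ.toAlgebra
  letI a1 : Algebra (ZMod p)[X] F := (φ.comp (algebraMap (ZMod p)[X] (RatFunc (ZMod p)))).toAlgebra
  haveI : IsScalarTower (ZMod p)[X] (RatFunc (ZMod p)) F := IsScalarTower.of_algebraMap_eq' rfl
  haveI : FiniteDimensional (RatFunc (ZMod p)) F := hfin
  have hX : algebraMap (ZMod p)[X] F X = y := by
    rw [← hφX]
    change φ (algebraMap _ _ X) = _
    rw [RatFunc.algebraMap_X]
  have hal : ∀ g : (ZMod p)[X], algebraMap (ZMod p)[X] F g = aeval y g := by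
    intro g
    have : (algebraMap (ZMod p)[X] F) = (aeval y : (ZMod p)[X] →ₐ[ZMod p] F).toRingHom := by
      refine Polynomial.ringHom_ext' (RingHom.ext_zmod _ _) ?_
      rw [hX]; simp
    rw [this]; rfl
  have hmem : ∀ x : F, x ∈ Reg y ↔ IsIntegral (ZMod p)[X] x := by
    intro x
    constructor
    · intro hx
      by_contra hni
      have hnm : x ∉ (integralClosure (ZMod p)[X] F).toSubring := hni
      haveI : IsIntegrallyClosedIn (integralClosure (ZMod p)[X] F).toSubring F :=
        inferInstanceAs (IsIntegrallyClosedIn (integralClosure (ZMod p)[X] F) F)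
      obtain ⟨V, hV, hxV⟩ := Subring.exists_le_valuationSubring_of_isIntegrallyClosedIn hnm
      refine hxV (hx V (hV ?_))
      rw [← hX]
      exact (integralClosure (ZMod p)[X] F).algebraMap_mem X
    · intro hx V hV
      refine mem_of_integral V (fun g => ?_) hx
      rw [hal]
      exact aeval_mem V hV g
  let a2 : (ZMod p)[X] →+* Reg y := (algebraMap (ZMod p)[X] F).codRestrict (Reg y) (by
    intro g; rw [hmem]; exact isIntegral_algebraMap)
  letI := a2.toAlgebra
  haveI : IsScalarTower (ZMod p)[X] (Reg y) F := IsScalarTower.of_algebraMap_eq' rfl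
  haveI : IsIntegralClosure (Reg y) (ZMod p)[X] F := by
    refine ⟨Subtype.val_injective, ?_⟩
    intro x
    rw [← hmem]
    constructor
    · intro hx; exact ⟨⟨x, hx⟩, rfl⟩
    · rintro ⟨z, rfl⟩; exact z.2
  haveI hmf : Module.Finite (ZMod p)[X] (Reg y) :=
    IsIntegralClosure.finite (ZMod p)[X] (RatFunc (ZMod p)) F (Reg y)
  refine ⟨⟨IsIntegralClosure.isDedekindDomain (ZMod p)[X] (RatFunc (ZMod p)) F _,
    IsIntegralClosure.isFractionRing_of_finite_extension (ZMod p)[X] (RatFunc (ZMod p)) F _,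
    Ring.HasFiniteQuotients.of_module_finite (ZMod p)[X] _, ?_⟩, ?_, ?_⟩
  · letI := ClassGroup.fintypeOfAdmissibleOfFinite (S := Reg y) (RatFunc (ZMod p)) F
      (Polynomial.cardPowDegreeIsAdmissible :
      AbsoluteValue.IsAdmissible (Polynomial.cardPowDegree : AbsoluteValue (ZMod p)[X] ℤ))
    exact Finite.of_fintype _
  · obtain ⟨ω, hω⟩ := hmf.fg_top
    refine ⟨ω.image (Subtype.val : Reg y → F), ?_, ?_⟩
    · intro a ha
      obtain ⟨b, -, rfl⟩ := Finset.mem_image.1 ha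
      exact b.2
    · intro s hs
      have h1 : (⟨s, hs⟩ : Reg y) ∈ Submodule.span (ZMod p)[X] (ω : Set (Reg y)) := by
        rw [hω]; trivial
      obtain ⟨g, -, hg⟩ := Submodule.mem_span_finset.1 h1
      refine ⟨fun a => if h : a ∈ Reg y then g ⟨a, h⟩ else 0, ?_⟩
      rw [Finset.sum_image (fun a _ b _ h => Subtype.ext h)]
      have h2 := congrArg (Subtype.val) hg
      refine h2.symm.trans ?_
      simp only [AddSubmonoidClass.coe_finset_sum]
      refine Finset.sum_congr rfl fun a _ => ?_
      simp only [SetLike.coe_mem, dite_true, Subtype.coe_eta]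
      rw [Algebra.smul_def, ← hal]; rfl
  · intro s hs
    obtain ⟨P, hP, hP2⟩ := (hmem s).1 hs
    refine ⟨P, hP, ?_⟩
    have : (algebraMap (ZMod p)[X] F) = (aeval y : (ZMod p)[X] →ₐ[ZMod p] F).toRingHom :=
      RingHom.ext hal
    rw [← this]; exact hP2

end HW

end

section
set_option linter.all false
open Polynomial IntermediateField

namespace HW
variable {p : ℕ} [Fact p.Prime] {F : Type} [Field F]

lemma D_ne_zero [Algebra (ZMod p) F] (hF : GFF p F) {t : F} (ht : Transcendental (ZMod p) t)
    (hs : Algebra.IsSeparable (ZMod p)⟮t⟯ F) : KaehlerDifferential.D (ZMod p) F t ≠ 0 := by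
  intro h0
  have hspan := span_D_eq_top hs
  rw [h0, Submodule.span_zero_singleton] at hspan
  haveI := hF.ess
  haveI : Algebra.FormallyUnramified (ZMod p) F := by
    constructor
    constructor
    intro a b
    have h1 : a ∈ (⊤ : Submodule F (Ω[F⁄ZMod p])) := trivial
    have h2 : b ∈ (⊤ : Submodule F (Ω[F⁄ZMod p])) := trivial
    rw [← hspan, Submodule.mem_bot] at h1 h2
    rw [h1, h2]
  have := (Algebra.FormallyUnramified.iff_isSeparable (ZMod p) F).1 this
  exact ht (this.isAlgebraic.isAlgebraic t)

lemma D_inv_ne_zero [Algebra (ZMod p) F] {t : F} (h : KaehlerDifferential.D (ZMod p) F t ≠ 0) :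
    KaehlerDifferential.D (ZMod p) F t⁻¹ ≠ 0 := by
  intro h0
  apply h
  have := D_inv_mem (⊥ : Submodule F (Ω[F⁄ZMod p])) (x := t⁻¹) (by rw [h0]; exact Submodule.zero_mem _)
  rw [inv_inv] at this
  exact (Submodule.mem_bot _).1 this

lemma exists_sepAt_mem [Algebra (ZMod p) F] (hF : GFF p F) (V : ValuationSubring F) :
    ∃ y ∈ V, Transcendental (ZMod p) y ∧ SepAt p F y := by
  obtain ⟨t, ht, hst, hsep⟩ := hF.exists_sep
  rcases V.mem_or_inv_mem t with h | h
  · exact ⟨t, h, ht, hst⟩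
  · exact ⟨t⁻¹, h, hF.sepAt_of_D (D_inv_ne_zero (D_ne_zero hF ht hsep))⟩

lemma gff_exists_ffprime [Algebra (ZMod p) F] (hF : GFF p F) (V : ValuationSubring F)
    (hV : V ≠ ⊤) : ∃ w : FFPrime F, w.V = V := by
  obtain ⟨y, hy, -, hs⟩ := exists_sepAt_mem hF V
  obtain ⟨hG, -⟩ := hs.pack
  haveI := hG.ded
  haveI := hG.frac
  obtain ⟨P, hP⟩ := exists_hos (S := Reg y) V hV (fun s => s.2 V hy)
  exact ⟨_, hP⟩

instance finite_quot_of_hfq {S : Type} [CommRing S] [IsDedekindDomain S]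
    [Ring.HasFiniteQuotients S] (P : IsDedekindDomain.HeightOneSpectrum S) :
    Finite (S ⧸ P.asIdeal) := Ring.HasFiniteQuotients.finiteQuotient P.ne_bot

lemma residue_surj {S F : Type} [CommRing S] [IsDedekindDomain S] [Field F] [Algebra S F]
    [IsFractionRing S F] (P : IsDedekindDomain.HeightOneSpectrum S) (x : F)
    (hx : P.valuation F x ≤ 1) : ∃ n : S, P.valuation F (x - algebraMap S F n) < 1 := by
  obtain ⟨n, d, hnd⟩ := P.exists_primeCompl_mul_eq_of_integer x hx
  haveI : P.asIdeal.IsMaximal := P.isMaximal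
  obtain ⟨d', hd'⟩ : ∃ d' : S, (d : S) * d' - 1 ∈ P.asIdeal := by
    letI := Ideal.Quotient.field P.asIdeal
    obtain ⟨e, he⟩ := Ideal.Quotient.mk_surjective ((Ideal.Quotient.mk P.asIdeal (d : S))⁻¹)
    refine ⟨e, ?_⟩
    rw [← Ideal.Quotient.eq, map_mul, he, map_one]
    refine mul_inv_cancel₀ ?_
    rw [Ne, Ideal.Quotient.eq_zero_iff_mem]
    exact d.2
  refine ⟨n * d', ?_⟩
  have h1 : x - algebraMap S F (n * d') = x * algebraMap S F (1 - d * d') := by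
    rw [map_mul, ← hnd, map_sub, map_one, map_mul]; ring
  rw [h1, map_mul]
  refine lt_of_le_of_lt (mul_le_of_le_one_left' hx) ?_
  rw [P.valuation_lt_one_iff_mem]
  rw [← neg_sub]; exact P.asIdeal.neg_mem hd'

lemma finite_residue [Algebra (ZMod p) F] (hF : GFF p F) (w : FFPrime F) :
    Finite (IsLocalRing.ResidueField w.V) := by
  obtain ⟨y, hy, -, hs⟩ := exists_sepAt_mem hF w.V
  obtain ⟨hG, -⟩ := hs.pack
  haveI := hG.ded
  haveI := hG.frac
  haveI := hG.hfq
  obtain ⟨P, hP⟩ := exists_hos (S := Reg y) w.V w.V_ne_top (fun s => s.2 w.V hy)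
  set w' := FFPrime.ofValuation (P.valuation F) (P.valuation_surjective F)
  let ψ : Reg y →+* w.V := (algebraMap (Reg y) F).codRestrict w.V.toSubring (fun s => s.2 w.V hy)
  let ψ' := (IsLocalRing.residue w.V).comp ψ
  have key : ∀ x : w.V, P.valuation F (x : F) < 1 → x ∈ IsLocalRing.maximalIdeal w.V := by
    intro x hx
    rw [IsLocalRing.mem_maximalIdeal, mem_nonunits_iff]
    rintro ⟨u, rfl⟩
    have h1 : ((↑u⁻¹ : w.V) : F) ∈ w'.V := by rw [hP]; exact (↑u⁻¹ : w.V).2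
    rw [FFPrime.mem_V_ofValuation] at h1
    have h2 : ((u : w.V) : F) * ((↑u⁻¹ : w.V) : F) = 1 := by
      rw [← MulMemClass.coe_mul]; simp
    have h3 := congrArg (P.valuation F) h2
    rw [map_mul, map_one] at h3
    exact absurd h3 (lt_of_le_of_lt (mul_le_of_le_one_right' h1) hx).ne
  have hker : ∀ s ∈ P.asIdeal, ψ' s = 0 := by
    intro s hs
    change IsLocalRing.residue w.V (ψ s) = 0
    rw [IsLocalRing.residue_eq_zero_iff]
    apply key
    exact (P.valuation_lt_one_iff_mem s).2 hs
  have hsurj : Function.Surjective (Ideal.Quotient.lift P.asIdeal ψ' hker) := by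
    intro a
    obtain ⟨x, rfl⟩ := IsLocalRing.residue_surjective a
    have hx : (x : F) ∈ w'.V := by rw [hP]; exact x.2
    rw [FFPrime.mem_V_ofValuation] at hx
    obtain ⟨n, hn⟩ := residue_surj P (x : F) hx
    refine ⟨Ideal.Quotient.mk _ n, ?_⟩
    rw [Ideal.Quotient.lift_mk]
    change IsLocalRing.residue w.V (ψ n) = _
    rw [eq_comm, ← sub_eq_zero, ← map_sub, IsLocalRing.residue_eq_zero_iff]
    exact key _ hn
  exact Finite.of_surjective _ hsurj

lemma algebraic_of_forall_mem [Algebra (ZMod p) F] {x : F}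
    (h : ∀ V : ValuationSubring F, V ≠ ⊤ → x ∈ V) : IsIntegral (ZMod p) x := by
  by_contra hni
  have hnm : x ∉ (integralClosure (ZMod p) F).toSubring := hni
  haveI : IsIntegrallyClosedIn (integralClosure (ZMod p) F).toSubring F :=
    inferInstanceAs (IsIntegrallyClosedIn (integralClosure (ZMod p) F) F)
  obtain ⟨V, hV, hxV⟩ := Subring.exists_le_valuationSubring_of_isIntegrallyClosedIn hnm
  refine hxV (h V ?_)
  rintro rfl
  exact hxV trivial

lemma mem_of_algebraic [Algebra (ZMod p) F] {x : F} (hx : IsIntegral (ZMod p) x)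
    (V : ValuationSubring F) : x ∈ V := mem_of_integral V (zmod_mem V) hx

section ext
variable {L : Type} [Field L] [Algebra F L]

lemma comap_ne_top [Algebra.IsAlgebraic F L] {V : ValuationSubring L} (hV : V ≠ ⊤) :
    V.comap (algebraMap F L) ≠ ⊤ := by
  intro h
  apply hV
  rw [eq_top_iff]
  intro x _
  refine mem_of_integral V (A := F) (fun a => ?_) (Algebra.IsAlgebraic.isAlgebraic x).isIntegral
  have : a ∈ V.comap (algebraMap F L) := by rw [h]; trivial
  exact this

lemma exists_below [Algebra (ZMod p) F] (hF : GFF p F) [Algebra.IsAlgebraic F L] (W : FFPrime L) :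
    ∃ (w : FFPrime F) (e : ℕ), W.LiesOverWith w (algebraMap F L) e := by
  obtain ⟨w, hw⟩ := gff_exists_ffprime hF _ (comap_ne_top (F := F) W.V_ne_top)
  refine ⟨w, w.liesOverWith_of_comap W _ ?_⟩
  intro x
  rw [hw]; rfl

lemma exists_val_above (w : FFPrime F) (L : Type) [Field L] [Algebra F L] {x : L}
    (hx : ¬ ∃ P : F[X], P.Monic ∧ (∀ n, P.coeff n ∈ w.V) ∧ aeval x P = 0) :
    ∃ V : ValuationSubring L, x ∉ V ∧ ∀ a ∈ w.V, algebraMap F L a ∈ V := by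
  letI : Algebra w.V L := ((algebraMap F L).comp (algebraMap w.V F)).toAlgebra
  haveI : IsScalarTower w.V F L := IsScalarTower.of_algebraMap_eq' rfl
  have hni : ¬ IsIntegral w.V x := by
    rintro ⟨P, hP, hP2⟩
    refine hx ⟨P.map (algebraMap w.V F), hP.map _, ?_, ?_⟩
    · intro n
      rw [coeff_map]; exact (P.coeff n).2
    · rw [aeval_map_algebraMap]; exact hP2
  have hnm : x ∉ (integralClosure w.V L).toSubring := hni
  haveI : IsIntegrallyClosedIn (integralClosure w.V L).toSubring L :=
    inferInstanceAs (IsIntegrallyClosedIn (integralClosure w.V L) L)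
  obtain ⟨V, hV, hxV⟩ := Subring.exists_le_valuationSubring_of_isIntegrallyClosedIn hnm
  refine ⟨V, hxV, fun a ha => hV ?_⟩
  exact (integralClosure w.V L).algebraMap_mem ⟨a, ha⟩

lemma comap_eq_of_le (w : FFPrime F) [Algebra.IsAlgebraic F L] {V : ValuationSubring L} (hV : V ≠ ⊤)
    (h : ∀ a ∈ w.V, algebraMap F L a ∈ V) : V.comap (algebraMap F L) = w.V :=
  w.V_maximal h (comap_ne_top hV)

lemma exists_above [Algebra (ZMod p) L] (hL : GFF p L) [Algebra.IsAlgebraic F L] (w : FFPrime F) :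
    ∃ (W : FFPrime L) (e : ℕ), W.LiesOverWith w (algebraMap F L) e := by
  obtain ⟨π, hπ, hz⟩ := w.exists_z (-1)
  have hπV : π ∉ w.V := by
    rw [w.mem_V']; push Not; exact ⟨hπ, by lia⟩
  obtain ⟨V, hxV, hV⟩ := exists_val_above w L (x := algebraMap F L π) (by
    rintro ⟨P, hP, hc, h0⟩
    apply hπV
    have h0' : aeval π P = 0 := by
      rw [aeval_algebraMap_apply] at h0
      simpa using h0
    obtain ⟨Q, hQ⟩ : P ∈ Polynomial.lifts (algebraMap w.V F) := by
      rw [lifts_iff_coeff_lifts]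
      intro n
      exact ⟨⟨_, hc n⟩, rfl⟩
    obtain ⟨Q, hQ, -, hQm⟩ := lifts_and_natDegree_eq_and_monic (f := algebraMap w.V F) (p := P)
      (by rw [lifts_iff_coeff_lifts]; intro n; exact ⟨⟨_, hc n⟩, rfl⟩) hP
    refine mem_of_integral w.V (A := w.V) (fun a => a.2) ⟨Q, hQm, ?_⟩
    rw [← hQ] at h0'
    rw [aeval_map_algebraMap] at h0'
    exact h0')
  have hVt : V ≠ ⊤ := by rintro rfl; exact hxV trivial
  obtain ⟨W, hW⟩ := gff_exists_ffprime hL V hVt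
  refine ⟨W, w.liesOverWith_of_comap W _ ?_⟩
  intro x
  rw [hW, ← comap_eq_of_le w hVt hV]; rfl
end ext

end HW

end

section
set_option linter.all false
open Polynomial IntermediateField

namespace HW
variable {p : ℕ} [Fact p.Prime] {F : Type} [Field F]

lemma mem_of_monic (V : ValuationSubring F) {P : F[X]} (hP : P.Monic) (hc : ∀ n, P.coeff n ∈ V)
    {x : F} (hx : eval x P = 0) : x ∈ V := by
  obtain ⟨Q, hQ, -, hQm⟩ := lifts_and_natDegree_eq_and_monic (f := algebraMap V F) (p := P)
      (by rw [lifts_iff_coeff_lifts]; intro n; exact ⟨⟨_, hc n⟩, rfl⟩) hP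
  refine mem_of_integral V (A := V) (fun a => a.2) ⟨Q, hQm, ?_⟩
  rw [← hQ, eval_map] at hx
  exact hx

lemma aeval_div_mem [Algebra (ZMod p) F] (V : ValuationSubring F) {y : F} (hy0 : y ≠ 0)
    (hy : y⁻¹ ∈ V) {g : (ZMod p)[X]} {n : ℕ} (hg : g.natDegree ≤ n) :
    aeval y g * (y⁻¹) ^ n ∈ V := by
  rw [aeval_eq_sum_range' (Nat.lt_succ_of_le hg), Finset.sum_mul]
  refine sum_mem fun i hi => ?_
  rw [Finset.mem_range] at hi
  have h1 : (g.coeff i • y ^ i) * y⁻¹ ^ n = algebraMap (ZMod p) F (g.coeff i) * y⁻¹ ^ (n - i) := by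
    have : y⁻¹ ^ n = y⁻¹ ^ i * y⁻¹ ^ (n - i) := by rw [← pow_add]; congr 1; lia
    rw [this, Algebra.smul_def]
    have h2 : y ^ i * y⁻¹ ^ i = 1 := by rw [← mul_pow, mul_inv_cancel₀ hy0, one_pow]
    linear_combination (algebraMap (ZMod p) F (g.coeff i) * y⁻¹ ^ (n - i)) * h2
  rw [h1]
  exact mul_mem (zmod_mem V _) (pow_mem hy _)

lemma exists_bound_inf [Algebra (ZMod p) F] {y : F} {a : F} {P : (ZMod p)[X][X]} (hP : P.Monic)
    (h : eval₂ (aeval y : (ZMod p)[X] →ₐ[ZMod p] F).toRingHom a P = 0) :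
    ∃ C : ℕ, ∀ C', C ≤ C' → ∀ V : ValuationSubring F, y ∉ V → a * y⁻¹ ^ C' ∈ V := by
  refine ⟨∑ i ∈ Finset.range P.natDegree, (P.coeff i).natDegree, ?_⟩
  intro C' hC' V hy
  have hy0 : y ≠ 0 := by rintro rfl; exact hy V.zero_mem
  have hyi : y⁻¹ ∈ V := (V.mem_or_inv_mem y).resolve_left hy
  have hC : ∀ i < P.natDegree, (P.coeff i).natDegree ≤ C' := fun i hi =>
    (Finset.single_le_sum (f := fun i => (P.coeff i).natDegree) (fun _ _ => Nat.zero_le _) (Finset.mem_range.2 hi)).trans hC'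
  set Q : F[X] := P.map (aeval y : (ZMod p)[X] →ₐ[ZMod p] F).toRingHom with hQ
  have hQm : Q.Monic := hP.map _
  have hQd : Q.natDegree = P.natDegree := hP.natDegree_map _
  have hQc : ∀ i, Q.coeff i = aeval y (P.coeff i) := fun i => by rw [hQ, coeff_map]; rfl
  refine mem_of_monic V (P := Q.scaleRoots (y⁻¹ ^ C')) ((monic_scaleRoots_iff _).2 hQm) ?_ ?_
  · intro n
    rw [coeff_scaleRoots, hQd]
    rcases lt_trichotomy n P.natDegree with hn | hn | hn
    · obtain ⟨k, hk⟩ : ∃ k, P.natDegree - n = k + 1 := ⟨P.natDegree - n - 1, by lia⟩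
      rw [hk, pow_succ', ← mul_assoc, hQc]
      exact mul_mem (aeval_div_mem V hy0 hyi (hC n hn)) (pow_mem (pow_mem hyi _) _)
    · rw [hn, ← hQd, hQm.coeff_natDegree]; simpa using V.one_mem
    · rw [coeff_eq_zero_of_natDegree_lt (by rw [hQd]; exact hn), zero_mul]; exact V.zero_mem
  · have h2 := scaleRoots_eval₂_eq_zero (RingHom.id F) (p := Q) (r := a) (s := y⁻¹ ^ C')
      (by rw [eval₂_id, hQ, eval_map]; exact h)
    rw [eval₂_id] at h2
    simpa [mul_comm] using h2

lemma one_sub_inv_mem (V : ValuationSubring F) {y : F} (hy : y ∉ V) {k : ℕ} (hk : 0 < k) :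
    (1 - y⁻¹ ^ k)⁻¹ ∈ V := by
  rw [← V.valuation_le_one_iff, not_le] at hy
  have h1 : V.valuation (y⁻¹ ^ k) < 1 := by
    rw [map_pow, map_inv₀]
    exact pow_lt_one' (inv_lt_one_of_one_lt₀ hy) hk.ne'
  rw [← V.valuation_le_one_iff, map_inv₀, V.valuation.map_one_sub_of_lt h1, inv_one]

/-- Elements regular outside `R`. -/
def RegAt (R : FFPrime F) : Subring F where
  carrier := {x | ∀ V : ValuationSubring F, V ≠ R.V → x ∈ V}
  mul_mem' ha hb V hV := V.mul_mem _ _ (ha V hV) (hb V hV)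
  one_mem' V _ := V.one_mem
  add_mem' ha hb V hV := V.add_mem _ _ (ha V hV) (hb V hV)
  zero_mem' V _ := V.zero_mem
  neg_mem' ha V hV := V.neg_mem _ (ha V hV)

lemma mem_RegAt {R : FFPrime F} {x : F} :
  x ∈ RegAt R ↔ ∀ V : ValuationSubring F, V ≠ R.V → x ∈ V := Iff.rfl

lemma exists_poly [Algebra (ZMod p) F] {y : F} (hy : Transcendental (ZMod p) y)
    (hfin : Ring.HasFiniteQuotients (Reg y)) {P : Ideal (Reg y)} (hP : P ≠ ⊥) :
    ∃ i j : ℕ, i < j ∧ (⟨y, self_mem_Reg y⟩ : Reg y) ^ j - (⟨y, self_mem_Reg y⟩ : Reg y) ^ i ∈ P := by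
  haveI := hfin.finiteQuotient hP
  obtain ⟨i, j, hne, hij⟩ := Finite.exists_ne_map_eq_of_infinite
    (fun n : ℕ => Ideal.Quotient.mk P ((⟨y, self_mem_Reg y⟩ : Reg y) ^ n))
  rcases lt_or_gt_of_ne hne with h | h
  · exact ⟨i, j, h, Ideal.Quotient.eq.1 hij.symm⟩
  · exact ⟨j, i, h, Ideal.Quotient.eq.1 hij⟩

set_option maxHeartbeats 400000 in
lemma exists_pole [Algebra (ZMod p) F] (hF : GFF p F) (R : FFPrime F) :
    ∃ α ∈ RegAt R, α ∉ R.V := by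
  classical
  obtain ⟨y, hyR, hytr, hysep⟩ := exists_sepAt_mem hF R.V
  obtain ⟨hG, ⟨ω, hω, hgen⟩, hintg⟩ := hysep.pack
  haveI := hG.ded
  haveI := hG.frac
  have hfq := hG.hfq
  have hSR : ∀ s : Reg y, (s : F) ∈ R.V := fun s => s.2 R.V hyR
  obtain ⟨P, hP⟩ := exists_hos (S := Reg y) R.V R.V_ne_top hSR
  have hRP : ∀ x : F, x ∈ R.V ↔ P.valuation F x ≤ 1 := fun x => by
    rw [← hP, FFPrime.mem_V_ofValuation]
  have hy0 : y ≠ 0 := by rintro rfl; exact hytr isAlgebraic_zero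
  -- the polynomial eta
  obtain ⟨i, j, hij, hη⟩ := exists_poly hytr hfq P.ne_bot
  set Y : Reg y := ⟨y, self_mem_Reg y⟩ with hY
  set H : Reg y := Y ^ j - Y ^ i with hH
  have hHF : (H : F) = y ^ j - y ^ i := rfl
  have hη0 : (H : F) ≠ 0 := by
    intro h0
    refine hytr ⟨X ^ j - X ^ i, ?_, by simpa [hHF] using h0⟩
    intro h1
    have := congrArg (fun g => Polynomial.coeff g j) h1
    simp [coeff_X_pow, hij.ne'] at this
  have hH0 : H ≠ 0 := fun h => hη0 (by rw [h]; rfl)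
  have hspan0 : Ideal.span {H} ≠ (0 : Ideal (Reg y)) := by simpa using hH0
  -- factor off P
  obtain ⟨e, J, hPJ, hfac⟩ : ∃ (e : ℕ) (J : Ideal (Reg y)), ¬ P.asIdeal ∣ J ∧
      Ideal.span {H} = P.asIdeal ^ e * J := by
    have hfm : FiniteMultiplicity P.asIdeal (Ideal.span {H}) :=
      FiniteMultiplicity.of_prime_left P.prime hspan0
    obtain ⟨c, hc, hc2⟩ := hfm.exists_eq_pow_mul_and_not_dvd
    exact ⟨_, c, hc2, hc⟩
  -- bound at infinity
  have hb1 : ∀ a : F, ∃ C : ℕ, a ∈ ω → ∀ C', C ≤ C' → ∀ V : ValuationSubring F, y ∉ V →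
      a * y⁻¹ ^ C' ∈ V := by
    intro a
    by_cases ha : a ∈ ω
    · obtain ⟨Q, hQm, hQ⟩ := hintg a (hω a ha)
      obtain ⟨C, hC⟩ := exists_bound_inf hQm hQ
      exact ⟨C, fun _ => hC⟩
    · exact ⟨0, fun h => absurd h ha⟩
  choose Cf hCf using hb1
  set C := ∑ a ∈ ω, Cf a with hCdef
  have hC : ∀ a ∈ ω, ∀ V : ValuationSubring F, y ∉ V → a * y⁻¹ ^ C ∈ V := fun a ha =>
    hCf a ha C (Finset.single_le_sum (f := Cf) (fun _ _ => Nat.zero_le _) ha)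
  clear_value C
  -- choice of n
  set n := Fintype.card (ω → Fin C → ZMod p) + 1 + C with hn
  obtain ⟨β, hβJ, hβP⟩ : ∃ β ∈ J ^ n, β ∉ P.asIdeal := by
    by_contra hcon
    push Not at hcon
    have : P.asIdeal ∣ J ^ n := Ideal.dvd_iff_le.2 hcon
    exact hPJ (P.prime.dvd_of_dvd_pow this)
  -- polynomial for eta
  set h : (ZMod p)[X] := X ^ j - X ^ i with hh
  have hhm : h.Monic := monic_X_pow_sub (by
    rw [degree_X_pow]; exact_mod_cast hij)
  have hhd : h.natDegree = j := by
    rw [hh, natDegree_sub_eq_left_of_natDegree_lt] <;> simp [hij]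
  have hhy : aeval y h = (H : F) := by rw [hh, hHF]; simp
  clear_value h H Y
  have hred : ∀ b : Reg y, ∃ (s : Reg y) (g : F → (ZMod p)[X]), (∀ a, (g a).natDegree < n * j ∨ g a = 0) ∧
      (b : F) - (H : F) ^ n * s = ∑ a ∈ ω, aeval y (g a) * a := by
    intro b
    obtain ⟨g, hg⟩ := hgen b b.2
    have hhn : (h ^ n).Monic := hhm.pow n
    have hhnd : (h ^ n).natDegree = n * j := by rw [hhm.natDegree_pow, hhd]
    refine ⟨⟨∑ a ∈ ω, aeval y (g a /ₘ h ^ n) * a, sum_mem fun a ha => mul_mem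
      (aeval_mem (Reg y) (self_mem_Reg y) _) (hω a ha)⟩, fun a => g a %ₘ h ^ n, ?_, ?_⟩
    · intro a
      by_cases h0 : g a %ₘ h ^ n = 0
      · exact Or.inr h0
      · left
        rw [← hhnd]
        exact (natDegree_lt_natDegree_iff h0).2 (degree_modByMonic_lt _ hhn)
    · rw [hg]
      change _ - _ * (∑ a ∈ ω, aeval y (g a /ₘ h ^ n) * a) = _
      rw [Finset.mul_sum, ← Finset.sum_sub_distrib]
      refine Finset.sum_congr rfl fun a _ => ?_
      have h1 := congrArg (aeval y) (modByMonic_add_div (g a) (h ^ n))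
      rw [map_add, map_mul, map_pow, hhy] at h1
      rw [← h1]; ring
  choose s g hgd hg using hred
  -- pigeonhole
  obtain ⟨k, l, hkl, hEq⟩ := Fintype.exists_ne_map_eq_of_card_lt
    (fun (k : Fin (Fintype.card (ω → Fin C → ZMod p) + 1)) => (fun (a : ω) (m : Fin C) =>
      (g (β * H ^ (k : ℕ)) a).coeff (n * j - 1 - m))) (by simp)
  wlog hlt : (k : ℕ) < l generalizing k l
  · exact this l k hkl.symm hEq.symm (by
      have : (k : ℕ) ≠ l := fun h => hkl (Fin.ext h)
      lia)
  have hkn' : (k : ℕ) < n := by have := k.2; lia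
  have hln' : (l : ℕ) < n := by have := l.2; lia
  have hnC : C < n := by lia
  clear_value n
  obtain ⟨b₁, hb₁⟩ : ∃ b : Reg y, b = β * H ^ (k : ℕ) := ⟨_, rfl⟩
  obtain ⟨b₂, hb₂⟩ : ∃ b : Reg y, b = β * H ^ (l : ℕ) := ⟨_, rfl⟩
  rw [← hb₁, ← hb₂] at hEq
  obtain ⟨c, hc⟩ : ∃ b : Reg y, b = (b₁ - H ^ n * s b₁) - (b₂ - H ^ n * s b₂) := ⟨_, rfl⟩
  have hcF : (c : F) = ∑ a ∈ ω, aeval y (g b₁ a - g b₂ a) * a := by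
    have : (c : F) = ((b₁ : F) - (H : F) ^ n * s b₁) - ((b₂ : F) - (H : F) ^ n * s b₂) := by
      rw [hc]; push_cast; rfl
    rw [this, hg, hg, ← Finset.sum_sub_distrib]
    refine Finset.sum_congr rfl fun a _ => ?_
    rw [map_sub]; ring
  have hjpos : 0 < j := by lia
  have hnj : C < n * j := lt_of_lt_of_le hnC (Nat.le_mul_of_pos_right _ hjpos)
  have hdeg : ∀ a ∈ ω, (g b₁ a - g b₂ a).natDegree ≤ n * j - 1 - C := by
    intro a ha
    rw [natDegree_le_iff_coeff_eq_zero]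
    intro N hN
    rw [coeff_sub]
    by_cases hN2 : N < n * j
    · have := congrFun (congrFun hEq ⟨a, ha⟩) ⟨n * j - 1 - N, by lia⟩
      simp only at this
      have hNe : n * j - 1 - (n * j - 1 - N) = N := by lia
      rw [hNe] at this
      rw [sub_eq_zero]; exact this
    · have hz : ∀ b, (g b a).coeff N = 0 := by
        intro b
        rcases hgd b a with h1 | h1
        · exact coeff_eq_zero_of_natDegree_lt (by lia)
        · rw [h1]; simp
      rw [hz, hz, sub_zero]
  have hHJ : H ^ n ∈ J ^ n := by
    apply Ideal.pow_mem_pow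
    have : H ∈ P.asIdeal ^ e * J := by rw [← hfac]; exact Ideal.mem_span_singleton_self H
    have h2 : P.asIdeal ^ e * J ≤ J := Ideal.mul_le_right
    exact h2 this
  have hcJ : c ∈ J ^ n := by
    rw [hc, hb₁, hb₂]
    refine Ideal.sub_mem _ (Ideal.sub_mem _ ?_ ?_) (Ideal.sub_mem _ ?_ ?_)
    · exact Ideal.mul_mem_right _ _ hβJ
    · exact Ideal.mul_mem_right _ _ hHJ
    · exact Ideal.mul_mem_right _ _ hβJ
    · exact Ideal.mul_mem_right _ _ hHJ
  refine ⟨(c : F) / (H : F) ^ n, ?_, ?_⟩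
  · intro V hV
    by_cases hVt : V = ⊤
    · rw [hVt]; trivial
    by_cases hyV : y ∈ V
    · obtain ⟨P', hP'⟩ := exists_hos (S := Reg y) V hVt (fun s => s.2 V hyV)
      have hVP : ∀ x : F, x ∈ V ↔ P'.valuation F x ≤ 1 := fun x => by
        rw [← hP', FFPrime.mem_V_ofValuation]
      have hPP' : P ≠ P' := by
        rintro rfl
        exact hV (hP'.symm.trans hP)
      obtain ⟨u, huP, huP'⟩ : ∃ u ∈ P.asIdeal ^ (e * n), u ∉ P'.asIdeal := by
        by_contra hcon
        push Not at hcon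
        have h1 : P'.asIdeal ∣ P.asIdeal ^ (e * n) := Ideal.dvd_iff_le.2 hcon
        have h2 := P'.prime.dvd_of_dvd_pow h1
        have h3 : P.asIdeal ≤ P'.asIdeal := Ideal.dvd_iff_le.1 h2
        exact hPP' (IsDedekindDomain.HeightOneSpectrum.ext
          (P.isMaximal.eq_of_le P'.isPrime.ne_top h3))
      have h1 : u * c ∈ Ideal.span {H ^ n} := by
        rw [← Ideal.span_singleton_pow, hfac, mul_pow, ← pow_mul]
        exact Ideal.mul_mem_mul huP hcJ
      obtain ⟨m, hm⟩ := Ideal.mem_span_singleton'.1 h1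
      have hmF : (m : F) * (H : F) ^ n = u * c := congrArg Subtype.val hm
      have hu0 : (u : F) ≠ 0 := by
        intro h0
        apply huP'
        have : u = 0 := Subtype.ext h0
        rw [this]; exact P'.asIdeal.zero_mem
      have h2 : (c : F) / (H : F) ^ n = m * (u : F)⁻¹ := by
        field_simp
        linear_combination -hmF
      rw [h2]
      refine mul_mem (m.2 V hyV) ?_
      rw [hVP, map_inv₀]
      have h3 : P'.valuation F (u : F) = 1 := by
        refine le_antisymm (P'.valuation_le_one u) ?_
        rw [← not_lt]
        intro h4
        exact huP' ((P'.valuation_lt_one_iff_mem u).1 h4)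
      rw [h3, inv_one]
    · have hyi : y⁻¹ ∈ V := (V.mem_or_inv_mem y).resolve_left hyV
      have h1 : (H : F) = y ^ j * (1 - y⁻¹ ^ (j - i)) := by
        rw [hHF, mul_sub, mul_one, inv_pow]
        congr 1
        rw [← div_eq_mul_inv, eq_div_iff (pow_ne_zero _ hy0), ← pow_add]; congr 1; lia
      rw [hcF, Finset.sum_div]
      refine sum_mem fun a ha => ?_
      have h2 : aeval y (g b₁ a - g b₂ a) * a / (H : F) ^ n =
        (aeval y (g b₁ a - g b₂ a) * y⁻¹ ^ (n * j - C)) * (a * y⁻¹ ^ C) *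
          ((1 - y⁻¹ ^ (j - i))⁻¹) ^ n := by
        have h4 : y⁻¹ ^ (n * j - C) * y⁻¹ ^ C = ((y ^ j)⁻¹) ^ n := by
          rw [← pow_add, Nat.sub_add_cancel hnj.le, mul_comm n j, pow_mul, inv_pow]
        rw [h1, mul_pow, div_eq_mul_inv, mul_inv, ← inv_pow (y ^ j), ← inv_pow (1 - _), ← h4]; ring
      rw [h2]
      refine mul_mem (mul_mem (aeval_div_mem V hy0 hyi ?_) (hC a ha V hyV))
        (pow_mem (one_sub_inv_mem V hyV (by lia)) n)
      exact (hdeg a ha).trans (by lia)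
  · -- pole at R
    rw [hRP, map_div₀, map_pow]
    have hvH : P.valuation F (H : F) < 1 := (P.valuation_lt_one_iff_mem H).2 hη
    have hvH0 : P.valuation F (H : F) ≠ 0 := by simpa using hη0
    have hvβ : P.valuation F (β : F) = 1 := by
      refine le_antisymm (P.valuation_le_one β) ?_
      rw [← not_lt]
      intro h4
      exact hβP ((P.valuation_lt_one_iff_mem β).1 h4)
    have hcfac : (c : F) = (H : F) ^ (k : ℕ) * (β - (H : F) * (β * (H : F) ^ ((l : ℕ) - k - 1) +
        (H : F) ^ (n - k - 1) * (s b₁ - s b₂))) := by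
      have e1 : (c : F) = ((β : F) * (H : F) ^ (k : ℕ) - (H : F) ^ n * s b₁) - ((β : F) * (H : F) ^ (l : ℕ) - (H : F) ^ n * s b₂) := by
        rw [hc]; push_cast; rw [hb₁, hb₂]; push_cast; rfl
      have e2 : (H : F) ^ (l : ℕ) = (H : F) ^ (k : ℕ) * ((H : F) * (H : F) ^ ((l : ℕ) - k - 1)) := by
        rw [← pow_succ', ← pow_add]; congr 1; lia
      have e3 : (H : F) ^ n = (H : F) ^ (k : ℕ) * ((H : F) * (H : F) ^ (n - k - 1)) := by
        rw [← pow_succ', ← pow_add]; congr 1; lia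
      rw [e1, e2, e3]; ring
    have hv2 : P.valuation F (β - (H : F) * (β * (H : F) ^ ((l : ℕ) - k - 1) +
        (H : F) ^ (n - k - 1) * (s b₁ - s b₂))) = 1 := by
      rw [Valuation.map_sub_eq_of_lt_left, hvβ]
      rw [hvβ, map_mul]
      refine lt_of_le_of_lt (mul_le_of_le_one_right' ?_) hvH
      exact P.valuation_le_one (β * H ^ ((l : ℕ) - k - 1) + H ^ (n - k - 1) * (s b₁ - s b₂))
    rw [hcfac, map_mul, hv2, mul_one, map_pow, not_le]
    have hkn : n = (k : ℕ) + ((n - k - 1) + 1) := by lia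
    conv_rhs => rw [hkn, pow_add, div_mul_eq_div_div, div_self (pow_ne_zero _ hvH0)]
    rw [one_div, one_lt_inv₀ (zero_lt_iff.2 (pow_ne_zero _ hvH0))]
    exact pow_lt_one' hvH (by lia)

end HW

end

section
set_option linter.all false
open Polynomial IntermediateField
open scoped IntermediateField.algebraAdjoinAdjoin

namespace HW
variable {p : ℕ} [Fact p.Prime] {F : Type} [Field F]

lemma regAt_eq {R : FFPrime F} {τ : F} (h : τ ∈ RegAt R) (h2 : τ ∉ R.V) : RegAt R = Reg τ := by
  ext x
  constructor
  · intro hx V hV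
    exact hx V (by rintro rfl; exact h2 hV)
  · intro hx V hV
    exact hx V (h V hV)

lemma exists_mul_mem_Reg [Algebra (ZMod p) F] (hF : GFF p F) {y : F}
    (hy : Transcendental (ZMod p) y) (x : F) : ∃ b ∈ Reg y, b ≠ 0 ∧ b * x ∈ Reg y := by
  haveI := hF.algebraic hy
  have hx : IsAlgebraic (Algebra.adjoin (ZMod p) {y}) x := by
    have h1 : IsAlgebraic (ZMod p)⟮y⟯ x := Algebra.IsAlgebraic.isAlgebraic x
    exact (IsFractionRing.isAlgebraic_iff (Algebra.adjoin (ZMod p) {y}) (ZMod p)⟮y⟯ F).2 h1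
  obtain ⟨g, hg0, hg⟩ := hx.exists_integral_multiple
  have hmem : ∀ V : ValuationSubring F, y ∈ V → ∀ a : Algebra.adjoin (ZMod p) {y},
      algebraMap (Algebra.adjoin (ZMod p) {y}) F a ∈ V := by
    rintro V hV ⟨a, ha⟩
    rw [Algebra.adjoin_singleton_eq_range_aeval] at ha
    obtain ⟨g, rfl⟩ := ha
    exact aeval_mem V hV g
  refine ⟨g, fun V hV => hmem V hV g, ?_, ?_⟩
  · intro h0; exact hg0 (Subtype.ext h0)
  · intro V hV
    have := mem_of_integral V (hmem V hV) hg
    rwa [Algebra.smul_def] at this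

lemma exists_sep_pole [Algebra (ZMod p) F] (hF : GFF p F) (R : FFPrime F) :
    ∃ τ ∈ RegAt R, τ ∉ R.V ∧ Transcendental (ZMod p) τ ∧ SepAt p F τ := by
  obtain ⟨α, hα, hαR⟩ := exists_pole hF R
  have hαt : Transcendental (ZMod p) α := fun h => hαR (mem_of_algebraic h.isIntegral _)
  have hreg := regAt_eq hα hαR
  obtain ⟨t, ht, -, hsep⟩ := hF.exists_sep
  have hDt := D_ne_zero hF ht hsep
  by_contra hcon
  push Not at hcon
  have hD0 : ∀ τ ∈ RegAt R, KaehlerDifferential.D (ZMod p) F τ = 0 := by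
    intro τ hτ
    by_contra hD
    obtain ⟨h1, h2⟩ := hF.sepAt_of_D hD
    refine hcon τ hτ ?_ h1 h2
    intro hR
    apply h1
    refine (algebraic_of_forall_mem fun V _ => ?_).isAlgebraic
    by_cases hV : V = R.V
    · rw [hV]; exact hR
    · exact hτ V hV
  obtain ⟨b, hb, hb0, hbt⟩ := exists_mul_mem_Reg hF hαt t
  rw [← hreg] at hb hbt
  have h1 := hD0 _ hbt
  rw [Derivation.leibniz, hD0 _ hb, smul_zero, add_zero] at h1
  exact hDt ((smul_eq_zero.1 h1).resolve_left hb0)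

end HW

end

section
set_option linter.all false

namespace HW
section lfun
open PowerSeries
open scoped ComplexOrder

lemma X_mul_deriv (f : ℂ⟦X⟧) (n : ℕ) :
    coeff n (PowerSeries.X * derivative ℂ f) = n * coeff n f := by
  cases n with
  | zero => simp
  | succ n => 
    rw [coeff_succ_X_mul, coeff_derivative]; push_cast; ring

def LD (f g : ℂ⟦X⟧) : Prop := PowerSeries.X * derivative ℂ f = f * g

lemma LD_iff {f g : ℂ⟦X⟧} : LD f g ↔ ∀ n : ℕ, (n : ℂ) * coeff n f = coeff n (f * g) := by
  unfold LD
  rw [PowerSeries.ext_iff]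
  simp only [X_mul_deriv]

lemma LD.mul {f g f' g' : ℂ⟦X⟧} (h : LD f g) (h' : LD f' g') : LD (f * f') (g + g') := by
  unfold LD at *
  rw [Derivation.leibniz]
  simp only [smul_eq_mul]
  linear_combination f' * h + f * h'

lemma LD.rescale {f g : ℂ⟦X⟧} (h : LD f g) (a : ℂ) :
    LD (PowerSeries.rescale a f) (PowerSeries.rescale a g) := by
  rw [LD_iff] at *
  intro n
  rw [← map_mul, coeff_rescale, coeff_rescale, ← h]; ring

lemma LD.prod {ι : Type*} (s : Finset ι) (f g : ι → ℂ⟦X⟧) (h : ∀ i, LD (f i) (g i)) :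
    LD (∏ i ∈ s, f i) (∑ i ∈ s, g i) := by
  classical
  induction s using Finset.induction_on with
  | empty => simp [LD]
  | insert a s ha ih => rw [Finset.prod_insert ha, Finset.sum_insert ha]; exact (h a).mul ih

def FinSupp (f : ℂ⟦X⟧) : Prop := ∃ N, ∀ n, N ≤ n → coeff n f = 0

lemma FinSupp.mul {f g : ℂ⟦X⟧} (hf : FinSupp f) (hg : FinSupp g) : FinSupp (f * g) := by
  obtain ⟨N, hN⟩ := hf
  obtain ⟨M, hM⟩ := hg
  refine ⟨N + M, fun n hn => ?_⟩
  rw [coeff_mul]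
  refine Finset.sum_eq_zero fun ij hij => ?_
  rw [Finset.HasAntidiagonal.mem_antidiagonal] at hij
  by_cases h : N ≤ ij.1
  · rw [hN _ h, zero_mul]
  · rw [hM _ (by lia), mul_zero]

lemma FinSupp.prod {ι : Type*} (s : Finset ι) (f : ι → ℂ⟦X⟧) (h : ∀ i, FinSupp (f i)) :
    FinSupp (∏ i ∈ s, f i) := by
  classical
  induction s using Finset.induction_on with
  | empty => exact ⟨1, fun n hn => by simp [coeff_one, show n ≠ 0 by lia]⟩
  | insert a s ha ih => rw [Finset.prod_insert ha]; exact (h a).mul ih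

theorem lfun_false (a Λ : ℕ → ℂ) (d : ℕ) (hd : 0 < d)
    (h : ∀ n : ℕ, (n : ℂ) * a n = ∑ ij ∈ Finset.HasAntidiagonal.antidiagonal n, a ij.1 * Λ ij.2) (a0 : a 0 = 1)
    (hfin : ∃ N, ∀ n, N ≤ n → a n = 0) (hΛ : ∀ m, d ∣ m → 0 ≤ Λ m)
    (hinf : ∀ N, ∃ m, N ≤ m ∧ d ∣ m ∧ Λ m ≠ 0) : False := by
  set L : ℂ⟦X⟧ := PowerSeries.mk a with hL
  set G : ℂ⟦X⟧ := PowerSeries.mk Λ with hG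
  have h1 : LD L G := by
    rw [LD_iff]; intro n; rw [coeff_mul]; simp only [hL, hG, coeff_mk]; exact h n
  obtain ⟨ω, hω⟩ : ∃ ω : ℂ, IsPrimitiveRoot ω d := ⟨_, Complex.isPrimitiveRoot_exp d hd.ne'⟩
  set R := ∏ j ∈ Finset.range d, PowerSeries.rescale (ω ^ j) L with hR
  set S := ∑ j ∈ Finset.range d, PowerSeries.rescale (ω ^ j) G with hS
  have h2 : LD R S := LD.prod _ _ _ fun j => h1.rescale _
  have h3 : FinSupp R := FinSupp.prod _ _ fun j => by
    obtain ⟨N, hN⟩ := hfin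
    exact ⟨N, fun n hn => by rw [coeff_rescale, hL, coeff_mk, hN n hn, mul_zero]⟩
  have hSc : ∀ m, coeff m S = if d ∣ m then d * Λ m else 0 := by
    intro m
    rw [hS, map_sum]
    simp only [coeff_rescale, hG, coeff_mk]
    rw [← Finset.sum_mul]
    have e1 : ∑ j ∈ Finset.range d, (ω ^ j) ^ m = ∑ j ∈ Finset.range d, (ω ^ m) ^ j :=
      Finset.sum_congr rfl fun j _ => by rw [← pow_mul, ← pow_mul, mul_comm]
    rw [e1]
    split_ifs with hdm
    · rw [(hω.pow_eq_one_iff_dvd m).2 hdm]; simp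
    · have hne : ω ^ m ≠ 1 := fun h => hdm ((hω.pow_eq_one_iff_dvd m).1 h)
      have := mul_neg_geom_sum (ω ^ m) d
      rw [← pow_mul, mul_comm m d, pow_mul, hω.pow_eq_one, one_pow, sub_self] at this
      rcases mul_eq_zero.1 this with h5 | h5
      · exact absurd (sub_eq_zero.1 h5).symm hne
      · rw [h5, zero_mul]
  have hS0 : ∀ m, 0 ≤ coeff m S := by
    intro m; rw [hSc]
    split_ifs with hdm
    · exact mul_nonneg (by positivity) (hΛ m hdm)
    · exact le_rfl
  have hR0 : coeff 0 R = 1 := by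
    rw [hR, coeff_zero_eq_constantCoeff_apply, map_prod]
    refine Finset.prod_eq_one fun j _ => ?_
    rw [← coeff_zero_eq_constantCoeff_apply, coeff_rescale, hL, coeff_mk, a0]; simp
  rw [LD_iff] at h2
  have hRn : ∀ n, 0 ≤ coeff n R := by
    intro n
    induction n using Nat.strong_induction_on with
    | _ n ih =>
      rcases Nat.eq_zero_or_pos n with rfl | hn
      · rw [hR0]; exact zero_le_one
      · have h5 := h2 n
        have hn0 : (n : ℂ) ≠ 0 := by exact_mod_cast hn.ne'
        have h6 : coeff n R = (n : ℂ)⁻¹ * coeff n (R * S) := by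
          rw [← h5, inv_mul_cancel_left₀ hn0]
        rw [h6]
        have hni : (0 : ℂ) ≤ (n : ℂ)⁻¹ := by
          have : ((n : ℂ)⁻¹) = (((n : ℝ)⁻¹ : ℝ) : ℂ) := by push_cast; rfl
          rw [this]; exact_mod_cast (by positivity : (0 : ℝ) ≤ (n : ℝ)⁻¹)
        refine mul_nonneg hni ?_
        rw [coeff_mul]
        refine Finset.sum_nonneg fun ij hij => ?_
        rw [Finset.HasAntidiagonal.mem_antidiagonal] at hij
        rcases Nat.eq_zero_or_pos ij.2 with h0 | h0
        · have hz : a 0 * Λ 0 = 0 := by have := h 0; simpa using this.symm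
          have hz2 : Λ 0 = 0 := by rw [a0, one_mul] at hz; exact hz
          rw [h0, hSc, hz2]; simp
        · exact mul_nonneg (ih _ (by lia)) (hS0 _)
  obtain ⟨N, hN⟩ := h3
  obtain ⟨m, hNm, hdm, hm⟩ := hinf N
  have h5 := h2 m
  rw [hN m hNm, mul_zero, coeff_mul] at h5
  have h6 : coeff (0, m).1 R * coeff (0, m).2 S ≤ ∑ ij ∈ Finset.HasAntidiagonal.antidiagonal m, coeff ij.1 R * coeff ij.2 S :=
    Finset.single_le_sum (f := fun ij : ℕ × ℕ => coeff ij.1 R * coeff ij.2 S)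
      (fun ij _ => mul_nonneg (hRn _) (hS0 _)) (by simp)
  rw [← h5, hR0, one_mul] at h6
  have h7 := le_antisymm h6 (hS0 m)
  rw [hSc, if_pos hdm] at h7
  rcases mul_eq_zero.1 h7 with h8 | h8
  · exact hd.ne' (by exact_mod_cast h8)
  · exact hm h8

end lfun
end HW

end

section
set_option linter.all false
open UniqueFactorizationMonoid

namespace HW
structure DegData (S : Type) [CommRing S] [IsDedekindDomain S] where
  deg : Ideal S → ℕ
  mul : ∀ I J, I ≠ 0 → J ≠ 0 → deg (I * J) = deg I + deg J
  pos : ∀ P, Prime P → 0 < deg P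
  fin : ∀ n, {I : Ideal S | I ≠ 0 ∧ deg I = n}.Finite

namespace DegData
variable {S : Type} [CommRing S] [IsDedekindDomain S] (D : DegData S)

def A (n : ℕ) : Finset (Ideal S) := (D.fin n).toFinset

lemma mem_A {n : ℕ} {I : Ideal S} : I ∈ D.A n ↔ I ≠ 0 ∧ D.deg I = n := by simp [A]

open Classical in
def Pr (n : ℕ) : Finset (Ideal S) := ((Finset.range (n + 1)).biUnion D.A).filter Prime

lemma mem_Pr {n : ℕ} {I : Ideal S} : I ∈ D.Pr n ↔ Prime I ∧ D.deg I ≤ n := by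
  simp only [Pr, Finset.mem_filter, Finset.mem_biUnion, Finset.mem_range, mem_A]
  constructor
  · rintro ⟨⟨m, hm, h0, rfl⟩, h⟩; exact ⟨h, by lia⟩
  · rintro ⟨h, h2⟩; exact ⟨⟨_, by lia, h.ne_zero, rfl⟩, h⟩

lemma deg_one : D.deg 1 = 0 := by
  have := D.mul 1 1 one_ne_zero one_ne_zero
  rw [mul_one] at this; lia

lemma deg_pow {I : Ideal S} (hI : I ≠ 0) (k : ℕ) : D.deg (I ^ k) = k * D.deg I := by
  induction k with
  | zero => rw [pow_zero, zero_mul, deg_one]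
  | succ k ih => rw [pow_succ, D.mul _ _ (pow_ne_zero _ hI) hI, ih]; ring

lemma deg_prod (s : Multiset (Ideal S)) (h : ∀ P ∈ s, P ≠ 0) :
    D.deg s.prod = (s.map D.deg).sum := by
  induction s using Multiset.induction_on with
  | empty => rw [Multiset.prod_zero, deg_one, Multiset.map_zero, Multiset.sum_zero]
  | cons a s ih =>
    rw [Multiset.prod_cons, Multiset.map_cons, Multiset.sum_cons, D.mul, ih]
    · exact fun P hP => h P (Multiset.mem_cons_of_mem hP)
    · exact h a (Multiset.mem_cons_self _ _)
    · exact Multiset.prod_ne_zero (fun h0 => h 0 (Multiset.mem_cons_of_mem h0) rfl)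

lemma deg_le_of_dvd {I J : Ideal S} (hJ : J ≠ 0) (h : I ∣ J) : D.deg I ≤ D.deg J := by
  obtain ⟨K, rfl⟩ := h
  rw [D.mul _ _ (left_ne_zero_of_mul hJ) (right_ne_zero_of_mul hJ)]; lia

open Classical in
lemma pow_dvd_iff {P I : Ideal S} (hP : Prime P) (hI : I ≠ 0) (k : ℕ) :
    P ^ k ∣ I ↔ k ≤ (normalizedFactors I).count P := by
  rw [dvd_iff_normalizedFactors_le_normalizedFactors (pow_ne_zero _ hP.ne_zero) hI,
    normalizedFactors_pow, normalizedFactors_irreducible hP.irreducible, normalize_eq,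
    Multiset.nsmul_singleton, Multiset.le_count_iff_replicate_le]

open Classical in
lemma deg_eq_sum {I : Ideal S} (hI : I ≠ 0) {n : ℕ} (hn : D.deg I ≤ n) :
    D.deg I = ∑ P ∈ D.Pr n, ∑ k ∈ Finset.Icc 1 n, if P ^ k ∣ I then D.deg P else 0 := by
  have h1 : ∀ P ∈ D.Pr n, (∑ k ∈ Finset.Icc 1 n, if P ^ k ∣ I then D.deg P else 0) =
      (normalizedFactors I).count P * D.deg P := by
    intro P hP
    rw [mem_Pr] at hP
    rw [← Finset.sum_filter, Finset.sum_const, smul_eq_mul]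
    congr 1
    have hc : (normalizedFactors I).count P ≤ n := by
      have h2 : P ^ (normalizedFactors I).count P ∣ I := (pow_dvd_iff hP.1 hI _).2 le_rfl
      have h3 := D.deg_le_of_dvd hI h2
      rw [D.deg_pow hP.1.ne_zero] at h3
      have h4 := D.pos P hP.1
      nlinarith
    have h5 : (Finset.Icc 1 n).filter (fun k => P ^ k ∣ I) =
        Finset.Icc 1 ((normalizedFactors I).count P) := by
      ext k
      simp only [Finset.mem_filter, Finset.mem_Icc, pow_dvd_iff hP.1 hI]
      constructor
      · rintro ⟨⟨a, b⟩, c⟩; exact ⟨a, c⟩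
      · rintro ⟨a, b⟩; exact ⟨⟨a, b.trans hc⟩, b⟩
    rw [h5]; simp
  rw [Finset.sum_congr rfl h1]
  conv_lhs => rw [← Ideal.prod_normalizedFactors_eq_self hI]
  rw [deg_prod _ _ (fun P hP => (prime_of_normalized_factor P hP).ne_zero),
    Finset.sum_multiset_map_count]
  refine Finset.sum_subset ?_ ?_
  · intro P hP
    rw [Multiset.mem_toFinset] at hP
    rw [mem_Pr]
    exact ⟨prime_of_normalized_factor P hP,
      (D.deg_le_of_dvd hI (dvd_of_mem_normalizedFactors hP)).trans hn⟩
  · intro P _ hP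
    rw [Multiset.mem_toFinset] at hP
    rw [Multiset.count_eq_zero_of_notMem hP, zero_smul]

variable (χ : Ideal S → ℂ) (hχ : ∀ I J, I ≠ 0 → J ≠ 0 → χ (I * J) = χ I * χ J) (hχ1 : χ 1 = 1)

def a (n : ℕ) : ℂ := ∑ I ∈ D.A n, χ I

def lam (n : ℕ) : ℂ := ∑ P ∈ D.Pr n, ∑ k ∈ Finset.Icc 1 n,
  if k * D.deg P = n then (D.deg P : ℂ) * χ P ^ k else 0

include hχ hχ1 in
lemma chi_pow {I : Ideal S} (hI : I ≠ 0) (k : ℕ) : χ (I ^ k) = χ I ^ k := by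
  induction k with
  | zero => rw [pow_zero, pow_zero, hχ1]
  | succ k ih => rw [pow_succ, hχ _ _ (pow_ne_zero _ hI) hI, ih, pow_succ]

include hχ hχ1 in
open Classical in
lemma sum_dvd {P : Ideal S} (hP : Prime P) (k n : ℕ) :
    ∑ I ∈ (D.A n).filter (fun I => P ^ k ∣ I), χ I =
      if k * D.deg P ≤ n then χ P ^ k * D.a χ (n - k * D.deg P) else 0 := by
  have hPk : P ^ k ≠ 0 := pow_ne_zero _ hP.ne_zero
  split_ifs with h
  · rw [a, Finset.mul_sum]
    symm
    refine Finset.sum_bij (fun J _ => P ^ k * J) ?_ ?_ ?_ ?_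
    · intro J hJ
      rw [mem_A] at hJ
      rw [Finset.mem_filter, mem_A, D.mul _ _ hPk hJ.1, D.deg_pow hP.ne_zero, hJ.2]
      exact ⟨⟨mul_ne_zero hPk hJ.1, by lia⟩, dvd_mul_right _ _⟩
    · intro J _ J' _ h; exact mul_left_cancel₀ hPk h
    · intro I hI
      rw [Finset.mem_filter, mem_A] at hI
      obtain ⟨⟨h0, hd⟩, J, rfl⟩ := hI
      have hJ0 := right_ne_zero_of_mul h0
      rw [D.mul _ _ hPk hJ0, D.deg_pow hP.ne_zero] at hd
      exact ⟨J, (D.mem_A).2 ⟨hJ0, by lia⟩, rfl⟩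
    · intro J hJ
      rw [mem_A] at hJ
      rw [hχ _ _ hPk hJ.1, chi_pow χ hχ hχ1 hP.ne_zero]
  · refine Finset.sum_eq_zero fun I hI => ?_
    exfalso
    rw [Finset.mem_filter, mem_A] at hI
    have := D.deg_le_of_dvd hI.1.1 hI.2
    rw [D.deg_pow hP.ne_zero, hI.1.2] at this
    exact h this

include hχ hχ1 in
lemma main_identity (n : ℕ) : (n : ℂ) * D.a χ n =
    ∑ ij ∈ Finset.HasAntidiagonal.antidiagonal n, D.a χ ij.1 * D.lam χ ij.2 := by
  classical
  have h1 : (n : ℂ) * D.a χ n = ∑ P ∈ D.Pr n, ∑ k ∈ Finset.Icc 1 n, (D.deg P : ℂ) *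
      ∑ I ∈ (D.A n).filter (fun I => P ^ k ∣ I), χ I := by
    calc (n : ℂ) * D.a χ n = ∑ I ∈ D.A n, (∑ P ∈ D.Pr n, ∑ k ∈ Finset.Icc 1 n,
          if P ^ k ∣ I then (D.deg P : ℂ) * χ I else 0) := by
          rw [a, Finset.mul_sum]
          refine Finset.sum_congr rfl fun I hI => ?_
          rw [mem_A] at hI
          have h2 := D.deg_eq_sum hI.1 (n := n) hI.2.le
          rw [hI.2] at h2
          conv_lhs => rw [h2]
          push_cast
          rw [Finset.sum_mul]
          refine Finset.sum_congr rfl fun P _ => ?_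
          rw [Finset.sum_mul]
          refine Finset.sum_congr rfl fun k _ => ?_
          split_ifs <;> simp
      _ = _ := by
          rw [Finset.sum_comm]
          refine Finset.sum_congr rfl fun P _ => ?_
          rw [Finset.sum_comm]
          refine Finset.sum_congr rfl fun k _ => ?_
          rw [Finset.sum_filter, Finset.mul_sum]
          refine Finset.sum_congr rfl fun I _ => ?_
          split_ifs <;> simp
  have h2 : ∀ ij ∈ Finset.HasAntidiagonal.antidiagonal n, D.a χ ij.1 * D.lam χ ij.2 =
      ∑ P ∈ D.Pr n, ∑ k ∈ Finset.Icc 1 n,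
        if k * D.deg P = ij.2 then (D.deg P : ℂ) * χ P ^ k * D.a χ ij.1 else 0 := by
    intro ij hij
    rw [Finset.HasAntidiagonal.mem_antidiagonal] at hij
    rw [lam, Finset.mul_sum]
    refine Finset.sum_subset_zero_on_sdiff ?_ ?_ ?_
    · intro P hP; rw [mem_Pr] at *; exact ⟨hP.1, by lia⟩
    · intro P hP
      rw [Finset.mem_sdiff, mem_Pr, mem_Pr] at hP
      refine Finset.sum_eq_zero fun k hk => ?_
      rw [if_neg]
      rw [Finset.mem_Icc] at hk
      intro h
      apply hP.2
      refine ⟨hP.1.1, ?_⟩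
      rw [← h]
      exact Nat.le_mul_of_pos_left _ (by lia)
    · intro P hP
      rw [mem_Pr] at hP
      rw [Finset.mul_sum]
      refine Finset.sum_subset_zero_on_sdiff ?_ ?_ ?_
      · exact Finset.Icc_subset_Icc_right (by lia)
      · intro k hk
        rw [Finset.mem_sdiff, Finset.mem_Icc, Finset.mem_Icc] at hk
        rw [if_neg]
        intro h
        apply hk.2
        refine ⟨hk.1.1, ?_⟩
        rw [← h]
        exact Nat.le_mul_of_pos_right _ (D.pos P hP.1)
      · intro k _
        split_ifs
        · ring
        · simp
  refine h1.trans (Eq.trans ?_ (Finset.sum_congr rfl h2).symm)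
  refine Eq.trans ?_ Finset.sum_comm
  refine Finset.sum_congr rfl fun P hP => ?_
  rw [mem_Pr] at hP
  refine Eq.trans ?_ Finset.sum_comm
  refine Finset.sum_congr rfl fun k _ => ?_
  rw [sum_dvd D χ hχ hχ1 hP.1]
  split_ifs with h
  · rw [Finset.sum_eq_single (n - k * D.deg P, k * D.deg P)]
    · simp; ring
    · intro ij hij hne
      rw [Finset.HasAntidiagonal.mem_antidiagonal] at hij
      rw [if_neg]
      intro h3
      apply hne
      ext
      · simp; lia
      · simp; lia
    · intro h3
      exfalso; apply h3
      rw [Finset.HasAntidiagonal.mem_antidiagonal]; simp; lia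
  · rw [mul_zero]
    symm
    refine Finset.sum_eq_zero fun ij hij => ?_
    rw [Finset.HasAntidiagonal.mem_antidiagonal] at hij
    rw [if_neg]; lia

lemma a_zero (hχ1 : χ 1 = 1) : D.a χ 0 = 1 := by
  have : D.A 0 = {1} := by
    ext I
    rw [mem_A, Finset.mem_singleton]
    constructor
    · rintro ⟨h0, h1⟩
      by_contra hI
      obtain ⟨P, hP⟩ := exists_mem_factors h0 (by rwa [Ideal.isUnit_iff, ← Ideal.one_eq_top])
      have hp := prime_of_factor P hP
      have := D.deg_le_of_dvd h0 (dvd_of_mem_factors hP)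
      have := D.pos P hp
      lia
    · rintro rfl; exact ⟨one_ne_zero, D.deg_one⟩
  rw [a, this, Finset.sum_singleton, hχ1]

end DegData
end HW

end

section
set_option linter.all false
open UniqueFactorizationMonoid ComplexOrder

namespace HW
section cls
variable {S : Type} [CommRing S] [IsDedekindDomain S]

open Classical in
def cls (I : Ideal S) : ClassGroup S :=
  if h : I = 0 then 1 else ClassGroup.mk0 ⟨I, mem_nonZeroDivisors_of_ne_zero h⟩

lemma cls_of_ne {I : Ideal S} (h : I ≠ 0) :
    cls I = ClassGroup.mk0 ⟨I, mem_nonZeroDivisors_of_ne_zero h⟩ := by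
  rw [cls, dif_neg h]

lemma cls_one : cls (1 : Ideal S) = 1 := by
  rw [cls_of_ne one_ne_zero]
  exact map_one ClassGroup.mk0

lemma cls_mul {I J : Ideal S} (hI : I ≠ 0) (hJ : J ≠ 0) : cls (I * J) = cls I * cls J := by
  rw [cls_of_ne hI, cls_of_ne hJ, cls_of_ne (mul_ne_zero hI hJ), ← map_mul]; rfl

lemma cls_pow {I : Ideal S} (hI : I ≠ 0) (k : ℕ) : cls (I ^ k) = cls I ^ k := by
  induction k with
  | zero => rw [pow_zero, pow_zero, cls_one]
  | succ k ih => rw [pow_succ, cls_mul (pow_ne_zero _ hI) hI, ih, pow_succ]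

lemma cls_eq_iff {I J : Ideal S} (hI : I ≠ 0) (hJ : J ≠ 0) : cls I = cls J ↔
    ∃ x y : S, x ≠ 0 ∧ y ≠ 0 ∧ Ideal.span {x} * I = Ideal.span {y} * J := by
  rw [cls_of_ne hI, cls_of_ne hJ, ClassGroup.mk0_eq_mk0_iff]
  simp only [exists_prop]

lemma cls_surj (C : ClassGroup S) : ∃ I : Ideal S, I ≠ 0 ∧ cls I = C := by
  obtain ⟨⟨I, hI⟩, h⟩ := ClassGroup.mk0_surjective C
  exact ⟨I, nonZeroDivisors.ne_zero hI, by rw [cls_of_ne (nonZeroDivisors.ne_zero hI)]; exact h⟩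

lemma cls_prod {ι : Type*} (s : Finset ι) (f : ι → Ideal S) (h : ∀ i ∈ s, f i ≠ 0) :
    cls (∏ i ∈ s, f i) = ∏ i ∈ s, cls (f i) := by
  classical
  induction s using Finset.induction_on with
  | empty => rw [Finset.prod_empty, Finset.prod_empty, cls_one]
  | insert a s ha ih =>
    rw [Finset.prod_insert ha, Finset.prod_insert ha, cls_mul, ih]
    · exact fun i hi => h i (Finset.mem_insert_of_mem hi)
    · exact h a (Finset.mem_insert_self _ _)
    · exact Finset.prod_ne_zero_iff.2 fun i hi => h i (Finset.mem_insert_of_mem hi)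

/-- induction: multiplicative functions determined on primes -/
lemma map_cls_eq_one {G : Type*} [CommGroup G] (f : ClassGroup S →* G)
    (h : ∀ P : Ideal S, Prime P → f (cls P) = 1) (C : ClassGroup S) : f C = 1 := by
  obtain ⟨I, hI, rfl⟩ := cls_surj C
  induction I using UniqueFactorizationMonoid.induction_on_prime with
  | h₁ => exact absurd rfl hI
  | h₂ x hx => rw [Ideal.isUnit_iff] at hx; rw [hx, ← Ideal.one_eq_top, cls_one, map_one]
  | h₃ a p ha hp ih => rw [cls_mul hp.ne_zero ha, map_mul, h p hp, ih ha, one_mul]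

end cls

namespace DegData
variable {S : Type} [CommRing S] [IsDedekindDomain S] (D : DegData S)

theorem ltheorem [Finite (ClassGroup S)] (H : Subgroup (ClassGroup S)) (d r : ℕ) (hd : 0 < d)
    (hdr : Nat.Coprime r d)
    (hH : ∀ P : Ideal S, Prime P → ∀ j, d ∣ j * D.deg P → cls P ^ j ∈ H)
    (hN : ∃ n₀, ∀ n, n₀ ≤ n → ∀ I J : Ideal S, I ≠ 0 → J ≠ 0 → D.deg I ≡ D.deg J [MOD r] →
      Set.ncard {L : Ideal S | L ≠ 0 ∧ D.deg L = n ∧ cls L = cls I} =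
      Set.ncard {L : Ideal S | L ≠ 0 ∧ D.deg L = n ∧ cls L = cls J}) : H = ⊤ := by
  classical
  by_contra hne
  obtain ⟨g, hg⟩ : ∃ g, g ∉ H := by
    by_contra! h; exact hne ((Subgroup.eq_top_iff' H).2 h)
  obtain ⟨φ, hφ⟩ : ∃ φ : ClassGroup S ⧸ H →* ℂˣ, φ (QuotientGroup.mk g) ≠ 1 := by
    have := Monoid.neZero_exponent_of_finite (G := ClassGroup S ⧸ H)
    refine CommGroup.exists_apply_ne_one_of_hasEnoughRootsOfUnity _ ℂ ?_
    rwa [ne_eq, QuotientGroup.eq_one_iff]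
  set ψ : ClassGroup S →* ℂˣ := φ.comp (QuotientGroup.mk' H) with hψ
  have hψH : ∀ c ∈ H, ψ c = 1 := by
    intro c hc
    have : (QuotientGroup.mk' H) c = 1 := by
      rw [QuotientGroup.mk'_apply, QuotientGroup.eq_one_iff]; exact hc
    rw [hψ, MonoidHom.comp_apply, this, map_one]
  have hψg : ψ g ≠ 1 := hφ
  clear_value ψ
  obtain ⟨P₀, hP₀, hψP₀⟩ : ∃ P : Ideal S, Prime P ∧ ψ (cls P) ≠ 1 := by
    by_contra! h; exact hψg (map_cls_eq_one ψ h g)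
  set χ : Ideal S → ℂ := fun I => (ψ (cls I) : ℂ) with hχd
  have hχ : ∀ I J, I ≠ 0 → J ≠ 0 → χ (I * J) = χ I * χ J := by
    intro I J hI hJ; simp only [hχd]; rw [cls_mul hI hJ, map_mul, Units.val_mul]
  have hχ1 : χ 1 = 1 := by simp only [hχd]; rw [cls_one, map_one, Units.val_one]
  have hlam : ∀ m, d ∣ m → D.lam χ m = ((∑ P ∈ D.Pr m, ∑ k ∈ Finset.Icc 1 m,
      if k * D.deg P = m then D.deg P else 0 : ℕ) : ℂ) := by
    intro m hm
    rw [lam]; push_cast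
    refine Finset.sum_congr rfl fun P hP => Finset.sum_congr rfl fun k _ => ?_
    rw [mem_Pr] at hP
    split_ifs with h
    · have h1 := hψH _ (hH P hP.1 k (h ▸ hm))
      have h2 : χ P ^ k = 1 := by
        simp only [hχd]; rw [← Units.val_pow_eq_pow_val, ← map_pow, h1, Units.val_one]
      rw [h2, mul_one]
    · rfl
  refine lfun_false (D.a χ) (D.lam χ) d hd (D.main_identity χ hχ hχ1) (D.a_zero χ hχ1) ?_ ?_ ?_
  · obtain ⟨n₀, hn₀⟩ := hN
    obtain ⟨C₀, hC₀, hψC₀⟩ : ∃ I : Ideal S, (I ≠ 0 ∧ D.deg I ≡ 0 [MOD r]) ∧ ψ (cls I) ≠ 1 := by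
      by_contra! h
      apply hψP₀
      have h1 : ψ (cls P₀) ^ r = 1 := by
        rw [← map_pow, ← cls_pow hP₀.ne_zero]
        refine h _ ⟨pow_ne_zero _ hP₀.ne_zero, ?_⟩
        rw [D.deg_pow hP₀.ne_zero]
        exact (Nat.modEq_zero_iff_dvd).2 (dvd_mul_right _ _)
      have h2 : ψ (cls P₀) ^ d = 1 := by
        rw [← map_pow]; exact hψH _ (hH _ hP₀ _ (dvd_mul_right _ _))
      have h3 := pow_gcd_eq_one.2 ⟨h1, h2⟩
      rwa [hdr.gcd_eq_one, pow_one] at h3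
    refine ⟨n₀, fun n hn => ?_⟩
    have := Fintype.ofFinite (ClassGroup S)
    have key : D.a χ n = ∑ C : ClassGroup S,
        (Set.ncard {L : Ideal S | L ≠ 0 ∧ D.deg L = n ∧ cls L = C} : ℂ) * ψ C := by
      rw [a, ← Finset.sum_fiberwise (D.A n) cls χ]
      refine Finset.sum_congr rfl fun C _ => ?_
      rw [Finset.sum_congr rfl (g := fun _ => (ψ C : ℂ))]
      · rw [Finset.sum_const, nsmul_eq_mul]
        congr 2
        rw [← Set.ncard_coe_finset]
        congr 1
        ext L
        simp [mem_A, and_assoc]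
      · intro L hL
        simp only [Finset.mem_filter] at hL
        simp only [hχd, hL.2]
    have key2 : D.a χ n = (ψ (cls C₀) : ℂ) * D.a χ n := by
      conv_lhs => rw [key]
      rw [key, Finset.mul_sum]
      rw [← Equiv.sum_comp (Equiv.mulLeft (cls C₀))]
      refine Finset.sum_congr rfl fun C _ => ?_
      obtain ⟨I, hI, rfl⟩ := cls_surj C
      simp only [Equiv.coe_mulLeft]
      rw [← cls_mul hC₀.1 hI]
      rw [hn₀ n hn _ I (mul_ne_zero hC₀.1 hI) hI]
      · rw [cls_mul hC₀.1 hI, map_mul, Units.val_mul]; ring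
      · rw [D.mul _ _ hC₀.1 hI]
        simpa using hC₀.2.add_right (D.deg I)
    have h3 : ((ψ (cls C₀) : ℂ) - 1) * D.a χ n = 0 := by rw [sub_mul, ← key2]; ring
    rcases mul_eq_zero.1 h3 with h | h
    · exfalso; apply hψC₀; ext; rw [Units.val_one]; exact sub_eq_zero.1 h
    · exact h
  · intro m hm
    rw [hlam m hm]
    exact Nat.cast_nonneg _
  · intro N
    have hpos := D.pos _ hP₀
    refine ⟨d * (N + 1) * D.deg P₀, ?_, ?_, ?_⟩
    · have : 1 ≤ d * D.deg P₀ := Nat.mul_pos hd hpos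
      nlinarith
    · rw [mul_assoc]; exact dvd_mul_right _ _
    · rw [hlam _ (by rw [mul_assoc]; exact dvd_mul_right _ _)]
      rw [Nat.cast_ne_zero]
      intro h0
      rw [Finset.sum_eq_zero_iff] at h0
      have hk : 0 < d * (N + 1) := Nat.mul_pos hd (by lia)
      have h1 := h0 P₀ (by
        rw [mem_Pr]; exact ⟨hP₀, Nat.le_mul_of_pos_left _ hk⟩)
      rw [Finset.sum_eq_zero_iff] at h1
      have h2 := h1 (d * (N + 1)) (by
        rw [Finset.mem_Icc]; exact ⟨hk, Nat.le_mul_of_pos_right _ hpos⟩)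
      rw [if_pos rfl] at h2
      lia

end DegData
end HW

end

section
set_option linter.all false

namespace HW
variable {F : Type} [Field F]

structure Pt (S : Subring F) (R : FFPrime F) : Prop where
  good : Good S
  neg : ∀ a ∈ S, a ≠ 0 → R.z a ≤ 0
  pole : ∃ τ ∈ S, τ ≠ 0 ∧ R.z τ < 0
  fres : Finite (IsLocalRing.ResidueField R.V)

lemma card_ker_mul {G H : Type*} [AddGroup G] [AddGroup H] (f : G →+ H) :
    Nat.card G = Nat.card f.ker * Nat.card f.range := by
  rw [AddSubgroup.card_eq_card_quotient_mul_card_addSubgroup f.ker,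
    Nat.card_congr (QuotientAddGroup.quotientKerEquivRange f).toEquiv, mul_comm]

variable (R : FFPrime F) {S : Subring F}

def fil (J : Ideal S) (m : ℤ) : AddSubgroup S where
  carrier := {a | a ∈ J ∧ ((-m : ℤ) : WithTop ℤ) ≤ R.ord (a : F)}
  zero_mem' := ⟨J.zero_mem, by simp [R.ord_zero]⟩
  add_mem' ha hb := ⟨J.add_mem ha.1 hb.1, (le_min ha.2 hb.2).trans (R.ord_add _ _)⟩
  neg_mem' ha := ⟨J.neg_mem ha.1, by
    have := ha.2
    simp only [Subring.coe_neg, R.ord_neg]; exact this⟩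

lemma mem_fil {J : Ideal S} {m : ℤ} {a : S} :
    a ∈ fil R J m ↔ a ∈ J ∧ ((a : F) = 0 ∨ -m ≤ R.z a) := by
  rw [← R.le_ord_iff]; rfl

lemma ord_le_zero_mul {π : F} (hπ0 : π ≠ 0) (hπ : R.z π = 1) {m : ℤ} {a : F} :
    0 ≤ R.ord (a * π ^ m) ↔ ((-m : ℤ) : WithTop ℤ) ≤ R.ord a := by
  rw [R.nonneg_iff, R.le_ord_iff, mul_eq_zero]
  by_cases h : a = 0
  · simp [h]
  · have := zpow_ne_zero m hπ0
    rw [R.z_mul h this, R.z_zpow hπ0, hπ]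
    simp only [h, this, false_or]
    constructor <;> intro <;> lia

lemma ord_lt_zero_mul {π : F} (hπ0 : π ≠ 0) (hπ : R.z π = 1) {m : ℤ} {a : F} :
    0 < R.ord (a * π ^ m) ↔ ((-(m - 1) : ℤ) : WithTop ℤ) ≤ R.ord a := by
  rw [R.pos_iff, R.le_ord_iff, mul_eq_zero]
  by_cases h : a = 0
  · simp [h]
  · have := zpow_ne_zero m hπ0
    rw [R.z_mul h this, R.z_zpow hπ0, hπ]
    simp only [h, this, false_or]
    constructor <;> intro <;> lia

lemma residue_eq_zero {x : F} (hx : x ∈ R.V) :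
    IsLocalRing.residue R.V ⟨x, hx⟩ = 0 ↔ 0 < R.ord x := by
  rw [IsLocalRing.residue_eq_zero_iff, IsLocalRing.mem_maximalIdeal, mem_nonunits_iff, R.pos_iff]
  by_cases h : x = 0
  · subst h; simp only [true_or, iff_true]
    intro hu; exact hu.ne_zero rfl
  · simp only [h, false_or]
    have h0 := R.z_nonneg_of_mem hx
    constructor
    · intro hu
      by_contra hz
      apply hu
      have hz : R.z x = 0 := by lia
      have := (R.z_eq_zero_iff h).1 hz
      exact IsUnit.of_mul_eq_one ⟨x⁻¹, this.2⟩ (Subtype.ext (mul_inv_cancel₀ h))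
    · intro hz hu
      obtain ⟨⟨y, hy⟩, hxy⟩ := hu.exists_right_inv
      have hxy : x * y = 1 := congrArg Subtype.val hxy
      have hy0 : y ≠ 0 := by rintro rfl; simp at hxy
      have h1 := R.z_mul h hy0
      rw [hxy, R.z_one] at h1
      have := R.z_nonneg_of_mem hy
      lia

def lead {π : F} (hπ0 : π ≠ 0) (hπ : R.z π = 1) (J : Ideal S) (m : ℤ) :
    fil R J m →+ IsLocalRing.ResidueField R.V :=
  AddMonoidHom.mk' (fun a => IsLocalRing.residue R.V
    ⟨(a : S) * π ^ m, (ord_le_zero_mul R hπ0 hπ).2 a.2.2⟩) (by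
      intro a b
      rw [← map_add]
      congr 1
      apply Subtype.ext
      simp [add_mul])

lemma lead_ker {π : F} (hπ0 : π ≠ 0) (hπ : R.z π = 1) (J : Ideal S) (m : ℤ) (a : fil R J m) :
    a ∈ (lead R hπ0 hπ J m).ker ↔ (a : S) ∈ fil R J (m - 1) := by
  rw [AddMonoidHom.mem_ker]
  have h1 : (a : S) * π ^ m ∈ R.V := (ord_le_zero_mul R hπ0 hπ).2 a.2.2
  change IsLocalRing.residue R.V ⟨(a : S) * π ^ m, h1⟩ = 0 ↔ _
  rw [residue_eq_zero, ord_lt_zero_mul R hπ0 hπ]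
  exact ⟨fun h => ⟨a.2.1, h⟩, fun h => h.2⟩

lemma fil_mono (J : Ideal S) {m n : ℤ} (h : m ≤ n) : fil R J m ≤ fil R J n := by
  intro a ha
  rw [mem_fil] at *
  refine ⟨ha.1, ha.2.imp id (fun h' => ?_)⟩
  lia

def leadKerEquiv {π : F} (hπ0 : π ≠ 0) (hπ : R.z π = 1) (J : Ideal S) (m : ℤ) :
    (lead R hπ0 hπ J m).ker ≃ fil R J (m - 1) where
  toFun a := ⟨a.1.1, (lead_ker R hπ0 hπ J m a.1).1 a.2⟩
  invFun a := ⟨⟨a.1, fil_mono R J (by lia) a.2⟩, (lead_ker R hπ0 hπ J m _).2 a.2⟩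
  left_inv a := rfl
  right_inv a := rfl

variable {R}
namespace Pt
variable (h : Pt S R)
include h

lemma finite_fil (J : Ideal S) (m : ℤ) : Finite (fil R J m) := by
  haveI := h.fres
  obtain ⟨π, hπ0, hπ⟩ := R.exists_z 1
  by_cases hm : m < 0
  · have : ∀ a : fil R J m, a = 0 := by
      rintro ⟨a, ha⟩
      rw [mem_fil] at ha
      apply Subtype.ext
      apply Subtype.ext
      by_contra h0
      have := h.neg a a.2 h0
      have := ha.2.resolve_left h0
      lia
    haveI : Subsingleton _ := ⟨fun a b => by rw [this a, this b]⟩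
    exact Finite.of_subsingleton
  · push Not at hm
    obtain ⟨n, rfl⟩ := Int.eq_ofNat_of_zero_le hm
    clear hm
    have key : ∀ n : ℕ, Finite (fil R J ((n : ℤ) - 1)) := by
      intro n
      induction n with
      | zero =>
        have : ∀ a : fil R J (((0 : ℕ) : ℤ) - 1), a = 0 := by
          rintro ⟨a, ha⟩
          rw [mem_fil] at ha
          apply Subtype.ext
          apply Subtype.ext
          by_contra h0
          have := h.neg a a.2 h0
          have := ha.2.resolve_left h0
          push_cast at this
          lia
        haveI : Subsingleton _ := ⟨fun a b => by rw [this a, this b]⟩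
        exact Finite.of_subsingleton
      | succ n ih =>
        rw [show ((n + 1 : ℕ) : ℤ) - 1 = n by push_cast; ring]
        rw [AddMonoidHom.finite_iff_finite_ker_range (lead R hπ0 hπ J n)]
        exact ⟨Finite.of_equiv _ (leadKerEquiv R hπ0 hπ J n).symm, inferInstance⟩
    have := key (n + 1)
    rwa [show ((n + 1 : ℕ) : ℤ) - 1 = n by push_cast; ring] at this

lemma lead_surj {π : F} (hπ0 : π ≠ 0) (hπ : R.z π = 1) : ∃ m₀ : ℤ, ∀ m, m₀ ≤ m →
    Function.Surjective (lead R hπ0 hπ (⊤ : Ideal S) m) := by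
  classical
  haveI := h.fres
  haveI := h.good.frac
  haveI := h.good.ded
  obtain ⟨τ, hτS, hτ0, hτ⟩ := h.pole
  set s : ℤ := - R.z τ with hs
  -- lifts
  have hlift : ∀ c : IsLocalRing.ResidueField R.V, ∃ x : R.V, IsLocalRing.residue R.V x = c :=
    IsLocalRing.residue_surjective
  choose l hl using hlift
  haveI := Fintype.ofFinite (IsLocalRing.ResidueField R.V)
  obtain ⟨⟨b, hbm⟩, hb⟩ := IsLocalization.exist_integer_multiples (nonZeroDivisors S)
    ((Finset.univ : Finset (IsLocalRing.ResidueField R.V)) ×ˢ Finset.range s.toNat)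
    (fun cj => (l cj.1 : F) * π ^ (-(cj.2 : ℤ)))
  have hb0 : b ≠ 0 := nonZeroDivisors.ne_zero hbm
  have hbF : (b : F) ≠ 0 := fun h => hb0 (Subtype.ext h)
  refine ⟨- R.z b, fun m hm c => ?_⟩
  -- m = -z b + j + s * t
  have hs0 : 0 < s := by lia
  obtain ⟨j, t, hj, hmt⟩ : ∃ j t : ℕ, (j : ℤ) < s ∧ m = - R.z b + j + s * t := by
    refine ⟨((m + R.z b) % s).toNat, ((m + R.z b) / s).toNat, ?_, ?_⟩
    · rw [Int.toNat_of_nonneg (Int.emod_nonneg _ hs0.ne')]; exact Int.emod_lt_of_pos _ hs0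
    · rw [Int.toNat_of_nonneg (Int.emod_nonneg _ hs0.ne'),
        Int.toNat_of_nonneg (Int.ediv_nonneg (by lia) hs0.le)]
      have := Int.emod_add_mul_ediv (m + R.z b) s
      lia
  -- unit u = b τ^t π^(m - j)
  set u : F := b * τ ^ t * π ^ (m - j) with hu
  have hu0 : u ≠ 0 := mul_ne_zero (mul_ne_zero hbF (pow_ne_zero _ hτ0)) (zpow_ne_zero _ hπ0)
  have huz : R.z u = 0 := by
    rw [hu, R.z_mul (mul_ne_zero hbF (pow_ne_zero _ hτ0)) (zpow_ne_zero _ hπ0),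
      R.z_mul hbF (pow_ne_zero _ hτ0), R.z_pow hτ0, R.z_zpow hπ0, hπ, hmt, hs]
    ring
  obtain ⟨huV, huV'⟩ := (R.z_eq_zero_iff hu0).1 huz
  set ū := IsLocalRing.residue R.V ⟨u, huV⟩ with hub
  have hub0 : ū ≠ 0 := by
    rw [hub, ne_eq, residue_eq_zero, R.pos_iff]; simp [hu0, huz]
  obtain ⟨y, hy⟩ := hb (ū⁻¹ * c, j) (by
    simp only [Finset.mem_product, Finset.mem_univ, true_and, Finset.mem_range]; lia)
  have hy' : (y : F) = (b : F) * ((l (ū⁻¹ * c) : F) * π ^ (-(j : ℤ))) := by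
    have : algebraMap S F y = _ := hy
    rw [show algebraMap S F y = (y : F) from rfl] at this
    rw [this]; rfl
  have hval : ((y * ⟨τ, hτS⟩ ^ t : S) : F) * π ^ m = u * (l (ū⁻¹ * c) : F) := by
    rw [hu, Subring.coe_mul, hy', zpow_sub₀ hπ0, zpow_neg]
    simp only [zpow_natCast, Subring.coe_pow]
    field_simp
  have hmem : y * ⟨τ, hτS⟩ ^ t ∈ fil R (⊤ : Ideal S) m := by
    refine ⟨trivial, ?_⟩
    rw [← ord_le_zero_mul R hπ0 hπ, hval]
    exact R.V.mul_mem _ _ huV (l _).2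
  refine ⟨⟨_, hmem⟩, ?_⟩
  change IsLocalRing.residue R.V ⟨_, _⟩ = c
  have : (⟨((y * ⟨τ, hτS⟩ ^ t : S) : F) * π ^ m, (ord_le_zero_mul R hπ0 hπ).2 hmem.2⟩ : R.V)
      = ⟨u, huV⟩ * l (ū⁻¹ * c) := Subtype.ext hval
  rw [this, map_mul, hl, ← hub, mul_inv_cancel_left₀ hub0]

/-- growth -/
lemma growth : ∃ m₀ : ℤ, ∀ m, m₀ ≤ m → Nat.card (fil R (⊤ : Ideal S) (m + 1)) =
    Nat.card (fil R (⊤ : Ideal S) m) * Nat.card (IsLocalRing.ResidueField R.V) := by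
  obtain ⟨π, hπ0, hπ⟩ := R.exists_z 1
  obtain ⟨m₀, hm₀⟩ := h.lead_surj hπ0 hπ
  refine ⟨m₀, fun m hm => ?_⟩
  have hsurj := hm₀ (m + 1) (by lia)
  rw [card_ker_mul (lead R hπ0 hπ ⊤ (m + 1)), Nat.card_congr (leadKerEquiv R hπ0 hπ ⊤ (m + 1)),
    AddMonoidHom.range_eq_top.2 hsurj, add_sub_cancel_right]
  congr 1
  exact Nat.card_congr AddSubgroup.topEquiv.toEquiv

lemma growth' : ∃ m₀ : ℤ, ∀ (m : ℤ) (j : ℕ), m₀ ≤ m → Nat.card (fil R (⊤ : Ideal S) (m + j)) =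
    Nat.card (fil R (⊤ : Ideal S) m) * Nat.card (IsLocalRing.ResidueField R.V) ^ j := by
  obtain ⟨m₀, hm₀⟩ := h.growth
  refine ⟨m₀, fun m j hm => ?_⟩
  induction j with
  | zero => simp
  | succ j ih =>
    push_cast
    rw [← add_assoc, hm₀ _ (by lia), ih, pow_succ, mul_assoc]

lemma index (J : Ideal S) (hJ : J ≠ 0) : ∃ m₁ : ℤ, ∀ m, m₁ ≤ m →
    Nat.card (fil R (⊤ : Ideal S) m) = Nat.card (fil R J m) * Nat.card (S ⧸ J) := by
  haveI := h.good.hfq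
  haveI : Finite (S ⧸ J) := Ring.HasFiniteQuotients.finiteQuotient hJ
  haveI := Fintype.ofFinite (S ⧸ J)
  choose l hl using (Ideal.Quotient.mk_surjective (I := J))
  refine ⟨∑ c : S ⧸ J, |R.z (l c)|, fun m hm => ?_⟩
  set f : fil R (⊤ : Ideal S) m →+ S ⧸ J :=
    (Ideal.Quotient.mk J).toAddMonoidHom.comp (AddSubgroup.subtype _) with hf
  have hsurj : Function.Surjective f := by
    intro c
    refine ⟨⟨l c, ?_⟩, hl c⟩
    rw [mem_fil]
    refine ⟨trivial, Or.inr ?_⟩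
    have h1 : |R.z (l c)| ≤ ∑ c : S ⧸ J, |R.z (l c)| :=
      Finset.single_le_sum (f := fun c => |R.z (l c)|) (fun _ _ => abs_nonneg _) (Finset.mem_univ c)
    have := neg_abs_le (R.z (l c))
    lia
  rw [card_ker_mul f, AddMonoidHom.range_eq_top.2 hsurj, Nat.card_congr AddSubgroup.topEquiv.toEquiv]
  congr 1
  have hk : ∀ a : fil R (⊤ : Ideal S) m, a ∈ f.ker ↔ (a : S) ∈ fil R J m := by
    intro a
    rw [AddMonoidHom.mem_ker]
    change Ideal.Quotient.mk J a = 0 ↔ _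
    rw [Ideal.Quotient.eq_zero_iff_mem]
    exact ⟨fun h => ⟨h, a.2.2⟩, fun h => h.1⟩
  exact Nat.card_congr
    { toFun := fun a => ⟨a.1.1, (hk a.1).1 a.2⟩
      invFun := fun a => ⟨⟨a.1, ⟨trivial, a.2.2⟩⟩, (hk _).2 a.2⟩
      left_inv := fun a => rfl
      right_inv := fun a => rfl }

lemma card_span (α : S) (hα : α ≠ 0) : Nat.card (S ⧸ Ideal.span {α}) =
    Nat.card (IsLocalRing.ResidueField R.V) ^ (- R.z α).toNat := by
  have hαF : (α : F) ≠ 0 := fun h => hα (Subtype.ext h)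
  obtain ⟨m₀, hm₀⟩ := h.growth'
  obtain ⟨m₁, hm₁⟩ := h.index (Ideal.span {α}) (by
    rwa [ne_eq, Ideal.zero_eq_bot, Ideal.span_singleton_eq_bot])
  have hneg := h.neg α α.2 hαF
  set m := max m₀ m₁
  set j := (- R.z α).toNat with hj
  have hjz : (j : ℤ) = - R.z α := by lia
  have e1 := hm₀ m j (le_max_left _ _)
  have e2 := hm₁ (m + j) (by have := le_max_right m₀ m₁; lia)
  have e3 : Nat.card (fil R (Ideal.span {α}) (m + j)) = Nat.card (fil R (⊤ : Ideal S) m) := by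
    symm
    refine Nat.card_eq_of_bijective (fun a : fil R (⊤ : Ideal S) m =>
      (⟨α * a.1, ?_⟩ : fil R (Ideal.span {α}) (m + j))) ⟨?_, ?_⟩
    · have ha := (mem_fil R).1 a.2
      rw [mem_fil]
      refine ⟨Ideal.mul_mem_right _ _ (Ideal.mem_span_singleton_self α), ?_⟩
      by_cases h0 : (a.1 : F) = 0
      · left; simp [h0]
      · right
        rw [Subring.coe_mul, R.z_mul hαF h0]
        have := ha.2.resolve_left h0
        lia
    · intro a b hab
      have : α * a.1 = α * b.1 := congrArg Subtype.val hab
      exact Subtype.ext (mul_left_cancel₀ hα this)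
    · rintro ⟨b, hb⟩
      rw [mem_fil] at hb
      obtain ⟨a, rfl⟩ := Ideal.mem_span_singleton'.1 hb.1
      refine ⟨⟨a, ?_⟩, Subtype.ext (mul_comm _ _)⟩
      rw [mem_fil]
      refine ⟨trivial, ?_⟩
      by_cases h0 : (a : F) = 0
      · exact Or.inl h0
      · right
        have := hb.2.resolve_left (by rw [Subring.coe_mul]; exact mul_ne_zero h0 hαF)
        rw [Subring.coe_mul, R.z_mul h0 hαF] at this
        lia
  haveI := h.finite_fil (⊤ : Ideal S) m
  have hpos : 0 < Nat.card (fil R (⊤ : Ideal S) m) := Nat.card_pos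
  rw [e3, e1] at e2
  exact (Nat.eq_of_mul_eq_mul_left hpos e2).symm

lemma cardQuot_mul (I J : Ideal S) :
    Nat.card (S ⧸ (I * J)) = Nat.card (S ⧸ I) * Nat.card (S ⧸ J) := by
  haveI := h.good.ded
  haveI : Infinite S := by
    obtain ⟨τ, hτS, hτ0, hτ⟩ := h.pole
    refine Infinite.of_injective (fun n : ℕ => (⟨τ, hτS⟩ : S) ^ n) ?_
    intro a b hab
    have : τ ^ a = τ ^ b := congrArg Subtype.val hab
    have h2 := congrArg R.z this
    rw [R.z_pow hτ0, R.z_pow hτ0] at h2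
    have := mul_right_cancel₀ hτ.ne h2
    exact_mod_cast this
  rw [← Submodule.cardQuot_apply, ← Submodule.cardQuot_apply, ← Submodule.cardQuot_apply]
  exact UniqueFactorizationMonoid.multiplicative_of_coprime Submodule.cardQuot I J (Submodule.cardQuot_bot _ _)
      (fun {I J} hI => by simp [Ideal.isUnit_iff.mp hI, Ideal.mul_top])
      (fun {I} i hI =>
        have : Ideal.IsPrime I := Ideal.isPrime_of_prime hI
        cardQuot_pow_of_prime hI.ne_zero)
      fun {I J} hIJ => cardQuot_mul_of_coprime <| Ideal.isCoprime_iff_sup_eq.mpr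
        (Ideal.isUnit_iff.mp
          (hIJ (Ideal.dvd_iff_le.mpr le_sup_left) (Ideal.dvd_iff_le.mpr le_sup_right)))

end Pt
end HW

end

section
set_option linter.all false

namespace HW
variable {F : Type} [Field F] (R : FFPrime F) (S : Subring F)

def kS : Subring S := R.V.toSubring.comap S.subtype

variable {R S}
lemma mem_kS {a : S} : a ∈ kS R S ↔ (a : F) ∈ R.V := Iff.rfl

namespace Pt
variable (h : Pt S R)
include h

lemma kS_iff {a : S} (ha : a ≠ 0) : a ∈ kS R S ↔ R.z a = 0 := by
  have hF : (a : F) ≠ 0 := fun h => ha (Subtype.ext h)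
  rw [mem_kS, R.mem_V']
  have := h.neg a a.2 hF
  simp only [hF, false_or]
  constructor <;> intro <;> lia

lemma finite_kS : Finite (kS R S) := by
  haveI := h.finite_fil ⊤ 0
  refine Finite.of_injective (fun a : kS R S => (⟨a.1, ?_⟩ : fil R (⊤ : Ideal S) 0)) ?_
  · rw [mem_fil]
    refine ⟨trivial, ?_⟩
    have := a.2
    rw [mem_kS, R.mem_V'] at this
    simpa using this
  · intro a b hab
    have : a.1 = b.1 := congrArg (fun x : fil R (⊤ : Ideal S) 0 => x.1) hab
    exact Subtype.ext this

lemma isField_kS : IsField (kS R S) := by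
  haveI := h.finite_kS
  exact Finite.isField_of_domain _

lemma isUnit_iff {a : S} : IsUnit a ↔ a ≠ 0 ∧ a ∈ kS R S := by
  constructor
  · intro hu
    refine ⟨hu.ne_zero, (h.kS_iff hu.ne_zero).2 ?_⟩
    obtain ⟨b, hb⟩ := hu.exists_right_inv
    have hb0 : b ≠ 0 := by rintro rfl; simp at hb
    have haF : (a : F) ≠ 0 := fun h => hu.ne_zero (Subtype.ext h)
    have hbF : (b : F) ≠ 0 := fun h => hb0 (Subtype.ext h)
    have hab : (a : F) * b = 1 := congrArg Subtype.val hb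
    have h1 := R.z_mul haF hbF
    rw [hab, R.z_one] at h1
    have := h.neg a a.2 haF
    have := h.neg b b.2 hbF
    lia
  · rintro ⟨h0, hk⟩
    obtain ⟨b, hb⟩ := h.isField_kS.mul_inv_cancel (a := ⟨a, hk⟩)
      (fun h' => h0 (congrArg Subtype.val h'))
    exact IsUnit.of_mul_eq_one b.1 (congrArg Subtype.val hb)

lemma one_lt_Q : 1 < Nat.card (kS R S) := by
  haveI := h.finite_kS
  exact Finite.one_lt_card

lemma card_quot (I : Ideal S) (hI : I ≠ 0) :
    Nat.card (S ⧸ I) = Nat.card (kS R S) ^ Module.finrank (kS R S) (S ⧸ I) := by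
  haveI := h.good.hfq
  haveI : Finite (S ⧸ I) := Ring.HasFiniteQuotients.finiteQuotient hI
  letI : Field (kS R S) := h.isField_kS.toField
  haveI : Module.Finite (kS R S) (S ⧸ I) := Module.Finite.of_finite
  exact Module.natCard_eq_pow_finrank

def degData [IsDedekindDomain S] : DegData S where
  deg I := Module.finrank (kS R S) (S ⧸ I)
  mul I J hI hJ := by
    have h1 := h.cardQuot_mul I J
    rw [h.card_quot _ hI, h.card_quot _ hJ, h.card_quot _ (mul_ne_zero hI hJ), ← pow_add] at h1
    exact Nat.pow_right_injective h.one_lt_Q h1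
  pos P hP := by
    by_contra h0
    have h0 : Module.finrank (kS R S) (S ⧸ P) = 0 := by lia
    have h1 := h.card_quot P hP.ne_zero
    rw [h0, pow_zero] at h1
    haveI := h.good.hfq
    haveI : Finite (S ⧸ P) := Ring.HasFiniteQuotients.finiteQuotient hP.ne_zero
    have h2 := Finite.card_le_one_iff_subsingleton.1 h1.le
    rw [Ideal.Quotient.subsingleton_iff] at h2
    exact hP.not_unit (Ideal.isUnit_iff.2 h2)
  fin n := by
    haveI := h.good.hfq
    refine (Ring.HasFiniteQuotients.finite_cardQuot_le (R := S) (Nat.card (kS R S) ^ n)).subset ?_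
    rintro I ⟨hI, hd⟩
    change Submodule.cardQuot I ≤ _
    rw [Submodule.cardQuot_apply, h.card_quot I hI, hd]

lemma degData_card [IsDedekindDomain S] {I : Ideal S} (hI : I ≠ 0) :
    Nat.card (S ⧸ I) = Nat.card (kS R S) ^ h.degData.deg I := h.card_quot I hI

lemma deg_span [IsDedekindDomain S] {r : ℕ}
    (hr : Nat.card (IsLocalRing.ResidueField R.V) = Nat.card (kS R S) ^ r)
    {α : S} (hα : α ≠ 0) : (h.degData.deg (Ideal.span {α}) : ℤ) = r * (- R.z α) := by
  have h1 := h.card_span α hα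
  rw [h.degData_card (by rwa [ne_eq, Ideal.zero_eq_bot, Ideal.span_singleton_eq_bot]), hr,
    ← pow_mul] at h1
  have h2 := Nat.pow_right_injective h.one_lt_Q h1
  have := h.neg α α.2 (fun h => hα (Subtype.ext h))
  rw [h2]; push_cast
  rw [Int.toNat_of_nonneg (by lia)]

lemma count [IsDedekindDomain S] {r : ℕ}
    (hr : Nat.card (IsLocalRing.ResidueField R.V) = Nat.card (kS R S) ^ r)
    (I J : Ideal S) (hI : I ≠ 0) (hJ : J ≠ 0) (hIJ : cls I * cls J = 1) (n : ℕ) :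
    Set.ncard {α : S | α ∈ J ∧ α ≠ 0 ∧ (r : ℤ) * (- R.z α) = n + h.degData.deg J} =
    (Nat.card (kS R S) - 1) *
      Set.ncard {L : Ideal S | L ≠ 0 ∧ h.degData.deg L = n ∧ cls L = cls I} := by
  classical
  set A := {L : Ideal S | L ≠ 0 ∧ h.degData.deg L = n ∧ cls L = cls I} with hA
  have hgen : ∀ L : A, ∃ γ : S, γ ≠ 0 ∧ L.1 * J = Ideal.span {γ} := by
    rintro ⟨L, hL0, hLd, hLc⟩
    have h1 : cls (L * J) = cls (1 : Ideal S) := by rw [cls_mul hL0 hJ, hLc, hIJ, cls_one]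
    rw [cls_of_ne (mul_ne_zero hL0 hJ), cls_one, ClassGroup.mk0_eq_one_iff] at h1
    obtain ⟨γ, hγ⟩ := h1
    refine ⟨γ, ?_, hγ⟩
    rintro rfl
    apply mul_ne_zero hL0 hJ
    rw [hγ]; simp
  choose γ hγ0 hγ using hgen
  haveI := h.finite_kS
  have hcard : Nat.card {u : kS R S // u ≠ 0} = Nat.card (kS R S) - 1 := by
    letI := Fintype.ofFinite (kS R S)
    rw [Nat.card_eq_fintype_card, Nat.card_eq_fintype_card, Fintype.card_subtype_compl,
      Fintype.card_subtype_eq]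
  rw [← hcard, ← Nat.card_coe_set_eq, ← Nat.card_coe_set_eq, ← Nat.card_prod]
  symm
  have hspan : ∀ (u : {u : kS R S // u ≠ 0}) (a : S), Ideal.span {(u.1.1 : S) * a} = Ideal.span {a} := by
    intro u a
    rw [mul_comm]
    refine Ideal.span_singleton_mul_right_unit (h.isUnit_iff.2 ⟨?_, u.1.2⟩) a
    intro h0; exact u.2 (Subtype.ext h0)
  refine Nat.card_eq_of_bijective (fun uL : {u : kS R S // u ≠ 0} × A =>
    (⟨uL.1.1.1 * γ uL.2, ?_⟩ : {α : S | α ∈ J ∧ α ≠ 0 ∧ (r : ℤ) * (- R.z α) = n + h.degData.deg J}))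
    ⟨?_, ?_⟩
  · obtain ⟨u, L⟩ := uL
    have hu : u.1.1 * γ L ≠ 0 := mul_ne_zero (fun h0 => u.2 (Subtype.ext h0)) (hγ0 L)
    refine ⟨?_, hu, ?_⟩
    · have : u.1.1 * γ L ∈ L.1 * J := by
        rw [hγ]; exact Ideal.mul_mem_left _ _ (Ideal.mem_span_singleton_self _)
      exact Ideal.mul_le_left (I := J) (J := L.1) (by rw [mul_comm]; exact this)
    · rw [← h.deg_span hr hu, hspan, ← hγ, h.degData.mul _ _ L.2.1 hJ, L.2.2.1]; push_cast; ring
  · rintro ⟨u, L⟩ ⟨u', L'⟩ huu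
    have h1 : u.1.1 * γ L = u'.1.1 * γ L' := congrArg Subtype.val huu
    have h2 : L.1 * J = L'.1 * J := by
      rw [hγ, hγ, ← hspan u, h1, hspan]
    have h3 : L = L' := Subtype.ext (mul_right_cancel₀ hJ h2)
    subst h3
    have h4 := mul_right_cancel₀ (hγ0 L) h1
    rw [Subtype.ext (Subtype.ext h4) (a1 := u) (a2 := u')]
  · rintro ⟨α, hαJ, hα0, hαz⟩
    have hdvd : J ∣ Ideal.span {α} := by
      rw [Ideal.dvd_iff_le, Ideal.span_singleton_le_iff_mem]; exact hαJ
    obtain ⟨L, hL⟩ := hdvd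
    rw [mul_comm] at hL
    have hs0 : Ideal.span {α} ≠ 0 := by
      rwa [ne_eq, Ideal.zero_eq_bot, Ideal.span_singleton_eq_bot]
    have hL0 : L ≠ 0 := by rintro rfl; rw [zero_mul] at hL; exact hs0 hL
    have hLA : L ∈ A := by
      refine ⟨hL0, ?_, ?_⟩
      · have h1 := h.deg_span hr hα0
        rw [hL, h.degData.mul _ _ hL0 hJ, hαz] at h1
        push_cast at h1; lia
      · have h1 : cls (L * J) = 1 := by
          rw [← hL, cls_of_ne hs0, ClassGroup.mk0_eq_one_iff]; exact ⟨α, rfl⟩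
        rw [cls_mul hL0 hJ, ← hIJ] at h1
        exact mul_right_cancel h1
    have h2 : Ideal.span {γ ⟨L, hLA⟩} = Ideal.span {α} := by rw [← hγ, hL]
    rw [Ideal.span_singleton_eq_span_singleton] at h2
    obtain ⟨u, hu⟩ := h2
    have hu' := h.isUnit_iff.1 u.isUnit
    refine ⟨⟨⟨⟨u, hu'.2⟩, fun h0 => hu'.1 (congrArg Subtype.val h0)⟩, ⟨L, hLA⟩⟩, Subtype.ext ?_⟩
    change (u : S) * _ = α
    rw [mul_comm]; exact hu

lemma count2 [IsDedekindDomain S] {r : ℕ} (hr0 : 0 < r) (J : Ideal S) (m N : ℤ) (hm : (r : ℤ) * m = N) :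
    Set.ncard {α : S | α ∈ J ∧ α ≠ 0 ∧ (r : ℤ) * (- R.z α) = N} + Nat.card (fil R J (m - 1)) =
    Nat.card (fil R J m) := by
  haveI := h.finite_fil J m
  haveI := h.finite_fil J (m - 1)
  have e1 : Nat.card (fil R J m) = Set.ncard (fil R J m : Set S) := Nat.card_coe_set_eq _
  have e2 : Nat.card (fil R J (m - 1)) = Set.ncard (fil R J (m - 1) : Set S) := Nat.card_coe_set_eq _
  have hiff : ∀ α : S, α ≠ 0 → ((r : ℤ) * (- R.z α) = N ↔ R.z α = - m) := by
    intro α _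
    rw [← hm]
    constructor
    · intro h1
      have := mul_left_cancel₀ (by exact_mod_cast hr0.ne') h1
      lia
    · intro h1; rw [h1]; ring
  have hX : {α : S | α ∈ J ∧ α ≠ 0 ∧ (r : ℤ) * (- R.z α) = N} ⊆ (fil R J m : Set S) := by
    rintro α ⟨a, b, c⟩
    rw [SetLike.mem_coe, mem_fil]
    rw [hiff α b] at c
    exact ⟨a, Or.inr c.ge⟩
  rw [e1, e2, ← Set.ncard_union_eq _ (Set.toFinite _ |>.subset hX) (Set.toFinite (fil R J (m - 1) : Set S))]
  · congr 1
    ext α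
    simp only [Set.mem_union, SetLike.mem_coe, mem_fil]
    constructor
    · rintro (hh | hh)
      · exact (mem_fil R).1 (hX hh)
      · exact ⟨hh.1, hh.2.imp id (fun _ => by lia)⟩
    · rintro ⟨a, b⟩
      by_cases h0 : α = 0
      · right; exact ⟨a, Or.inl (by simp [h0])⟩
      · have hF : (α : F) ≠ 0 := fun h => h0 (Subtype.ext h)
        have b := b.resolve_left hF
        by_cases h1 : R.z α = -m
        · left; exact ⟨a, h0, (hiff α h0).2 h1⟩
        · right; exact ⟨a, Or.inr (by lia)⟩
  · rw [Set.disjoint_left]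
    rintro α ⟨a, b, c⟩ hh
    rw [SetLike.mem_coe, mem_fil] at hh
    rw [hiff α b] at c
    have := hh.2.resolve_left (fun h => b (Subtype.ext h))
    lia

theorem H_top [IsDedekindDomain S] {r : ℕ} (hr0 : 0 < r)
    (hr : Nat.card (IsLocalRing.ResidueField R.V) = Nat.card (kS R S) ^ r)
    (H : Subgroup (ClassGroup S)) (d : ℕ) (hd : 0 < d) (hdr : Nat.Coprime r d)
    (hH : ∀ P : Ideal S, Prime P → ∀ j, d ∣ j * h.degData.deg P → cls P ^ j ∈ H) : H = ⊤ := by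
  haveI := h.good.cl
  refine h.degData.ltheorem H d r hd hdr hH ?_
  obtain ⟨m₂, hm₂⟩ : ∃ m₂ : ℕ, ∀ (j : ℕ), Nat.card (fil R (⊤ : Ideal S) (m₂ + j)) =
    Nat.card (fil R (⊤ : Ideal S) m₂) * Nat.card (IsLocalRing.ResidueField R.V) ^ j := by
    obtain ⟨m₂, hm₂⟩ := h.growth'
    exact ⟨m₂.toNat, fun j => hm₂ _ j (by lia)⟩
  obtain ⟨Q, hQ⟩ : ∃ Q, Q = Nat.card (kS R S) := ⟨_, rfl⟩
  have hQ1 : 1 < Q := hQ ▸ h.one_lt_Q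
  obtain ⟨s, hs⟩ : ∃ s, s = Nat.card (fil R (⊤ : Ideal S) m₂) := ⟨_, rfl⟩
  -- representatives of inverse classes
  choose J hJ0 hJc using fun C : ClassGroup S => cls_surj (C⁻¹)
  choose m₁ hm₁ using fun C : ClassGroup S => h.index (J C) (hJ0 C)
  haveI := Fintype.ofFinite (ClassGroup S)
  obtain ⟨M, hM⟩ : ∃ M : ℕ, ∀ C, m₁ C + 1 ≤ M ∧ m₂ + 1 ≤ M := by
    refine ⟨m₂ + 1 + ∑ C : ClassGroup S, ((m₁ C).natAbs + 1), fun C => ?_⟩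
    have h1 : (m₁ C).natAbs + 1 ≤ ∑ C : ClassGroup S, ((m₁ C).natAbs + 1) :=
      Finset.single_le_sum (f := fun C => (m₁ C).natAbs + 1) (fun _ _ => by positivity)
        (Finset.mem_univ C)
    constructor <;> lia
  -- main formula
  have key : ∀ (n : ℕ) (I : Ideal S), I ≠ 0 → ∀ m : ℕ, M ≤ m →
      r * m = n + h.degData.deg (J (cls I)) →
      ((Q : ℤ) - 1) * Set.ncard {L : Ideal S | L ≠ 0 ∧ h.degData.deg L = n ∧ cls L = cls I} *
        (Q : ℤ) ^ (r * (m₂ + 1)) = s * (Q : ℤ) ^ n * ((Q : ℤ) ^ r - 1) := by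
    intro n I hI m hm hrm
    have c1 := h.count hr I (J (cls I)) hI (hJ0 _) (by rw [hJc, mul_inv_cancel]) n
    have c2 := h.count2 hr0 (J (cls I)) m (n + h.degData.deg (J (cls I))) (by exact_mod_cast hrm)
    rw [c1] at c2
    have c3 := hm₁ (cls I) m (by have := hM (cls I); lia)
    have c4 := hm₁ (cls I) ((m : ℤ) - 1) (by have := hM (cls I); lia)
    rw [h.degData_card (hJ0 _)] at c3 c4
    have c5 := hm₂ (m - m₂)
    have c6 := hm₂ (m - 1 - m₂)
    have hMm := hM (cls I)
    rw [show (m₂ : ℤ) + ((m - m₂ : ℕ) : ℤ) = m by lia] at c5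
    rw [show (m₂ : ℤ) + ((m - 1 - m₂ : ℕ) : ℤ) = m - 1 by lia] at c6
    rw [c5, hr, ← hs, ← hQ] at c3
    rw [c6, hr, ← hs, ← hQ] at c4
    rw [← hQ] at c2
    generalize Nat.card (fil R (J (cls I)) m) = A at *
    generalize Nat.card (fil R (J (cls I)) ((m : ℤ) - 1)) = B at *
    generalize Set.ncard {L : Ideal S | L ≠ 0 ∧ h.degData.deg L = n ∧ cls L = cls I} = X at *
    generalize h.degData.deg (J (cls I)) = D at *
    have d2 : ((Q : ℤ) - 1) * X + B = A := by
      rw [← c2]; push_cast [Nat.cast_sub hQ1.le]; ring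
    have d3 : (s : ℤ) * (Q ^ r) ^ (m - m₂) = A * Q ^ D := by exact_mod_cast c3
    have d4 : (s : ℤ) * (Q ^ r) ^ (m - 1 - m₂) = B * Q ^ D := by exact_mod_cast c4
    have hQ0 : (Q : ℤ) ≠ 0 := by lia
    have hQD : (Q : ℤ) ^ D ≠ 0 := pow_ne_zero _ hQ0
    apply mul_right_cancel₀ hQD
    have e1 : (Q : ℤ) ^ n * Q ^ D = Q ^ (r * m) := by rw [hrm, pow_add]
    have e2 : ((Q : ℤ) ^ r) ^ (m - m₂) * Q ^ (r * (m₂ + 1)) = Q ^ (r * m) * Q ^ r := by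
      rw [← pow_mul, ← pow_add, ← pow_add]
      congr 1
      obtain ⟨t, rfl⟩ : ∃ t, m = m₂ + t := ⟨m - m₂, by lia⟩
      rw [Nat.add_sub_cancel_left]; ring
    have e3 : ((Q : ℤ) ^ r) ^ (m - 1 - m₂) * Q ^ (r * (m₂ + 1)) = Q ^ (r * m) := by
      rw [← pow_mul, ← pow_add]
      congr 1
      obtain ⟨t, rfl⟩ : ∃ t, m = m₂ + 1 + t := ⟨m - m₂ - 1, by lia⟩
      rw [show m₂ + 1 + t - 1 - m₂ = t by lia]; ring
    calc ((Q : ℤ) - 1) * X * Q ^ (r * (m₂ + 1)) * Q ^ D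
        = (A - B) * Q ^ D * Q ^ (r * (m₂ + 1)) := by rw [← d2]; ring
      _ = (s * (Q ^ r) ^ (m - m₂)) * Q ^ (r * (m₂ + 1)) -
          (s * (Q ^ r) ^ (m - 1 - m₂)) * Q ^ (r * (m₂ + 1)) := by rw [d3, d4]; ring
      _ = s * (((Q : ℤ) ^ r) ^ (m - m₂) * Q ^ (r * (m₂ + 1))) -
          s * (((Q : ℤ) ^ r) ^ (m - 1 - m₂) * Q ^ (r * (m₂ + 1))) := by ring
      _ = s * (Q ^ (r * m)) * (Q ^ r - 1) := by rw [e2, e3]; ring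
      _ = _ := by rw [← e1]; ring
  have hzero : ∀ (n : ℕ) (I : Ideal S), I ≠ 0 → ¬ r ∣ n + h.degData.deg (J (cls I)) →
      Set.ncard {L : Ideal S | L ≠ 0 ∧ h.degData.deg L = n ∧ cls L = cls I} = 0 := by
    intro n I hI hnd
    have c1 := h.count hr I (J (cls I)) hI (hJ0 _) (by rw [hJc, mul_inv_cancel]) n
    rw [show {α : S | α ∈ J (cls I) ∧ α ≠ 0 ∧ (r : ℤ) * (- R.z α) =
      n + h.degData.deg (J (cls I))} = ∅ by
        ext α
        simp only [Set.mem_setOf_eq, Set.mem_empty_iff_false, iff_false]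
        rintro ⟨-, -, h3⟩
        apply hnd
        have : (r : ℤ) ∣ ((n + h.degData.deg (J (cls I)) : ℕ) : ℤ) := ⟨_, by push_cast; exact h3.symm⟩
        exact_mod_cast this, Set.ncard_empty] at c1
    have := mul_eq_zero.1 c1.symm
    rw [← hQ] at this
    lia
  have hmod : ∀ I : Ideal S, I ≠ 0 → r ∣ h.degData.deg I + h.degData.deg (J (cls I)) := by
    intro I hI
    rw [← h.degData.mul _ _ hI (hJ0 _)]
    have hIJ := mul_ne_zero hI (hJ0 (cls I))
    have h1 : cls (I * J (cls I)) = 1 := by rw [cls_mul hI (hJ0 _), hJc, mul_inv_cancel]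
    rw [cls_of_ne hIJ, ClassGroup.mk0_eq_one_iff] at h1
    obtain ⟨γ, hγ⟩ := h1
    have hγ0 : γ ≠ 0 := by rintro rfl; apply hIJ; rw [hγ]; simp
    have h2 := h.deg_span hr hγ0
    have h3 : I * J (cls I) = Ideal.span {γ} := hγ
    rw [h3]
    have : (r : ℤ) ∣ (h.degData.deg (Ideal.span {γ}) : ℤ) := ⟨_, h2⟩
    exact_mod_cast this
  refine ⟨r * M, fun n hn I I' hI hI' hdeg => ?_⟩
  have hJJ : r ∣ n + h.degData.deg (J (cls I)) ↔ r ∣ n + h.degData.deg (J (cls I')) := by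
    have a1 := (Nat.modEq_zero_iff_dvd).2 (hmod I hI)
    have a2 := (Nat.modEq_zero_iff_dvd).2 (hmod I' hI')
    have a3 : h.degData.deg (J (cls I)) ≡ h.degData.deg (J (cls I')) [MOD r] :=
      Nat.ModEq.add_left_cancel hdeg (a1.trans a2.symm)
    rw [← Nat.modEq_zero_iff_dvd, ← Nat.modEq_zero_iff_dvd]
    have a4 := Nat.ModEq.add_left n a3
    exact ⟨fun h => a4.symm.trans h, fun h => a4.trans h⟩
  by_cases hdv : r ∣ n + h.degData.deg (J (cls I))
  · obtain ⟨m, hm⟩ := hdv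
    obtain ⟨m', hm'⟩ := hJJ.1 ⟨m, hm⟩
    have k1 := key n I hI m (Nat.le_of_mul_le_mul_left (by lia : r * M ≤ r * m) hr0) hm.symm
    have k2 := key n I' hI' m' (Nat.le_of_mul_le_mul_left (by lia : r * M ≤ r * m') hr0) hm'.symm
    have k3 := k1.trans k2.symm
    have hQ0 : (Q : ℤ) ^ (r * (m₂ + 1)) ≠ 0 := pow_ne_zero _ (by lia)
    have k4 := mul_right_cancel₀ hQ0 k3
    have k5 := mul_left_cancel₀ (show (Q : ℤ) - 1 ≠ 0 by lia) k4
    exact_mod_cast k5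
  · rw [hzero n I hI hdv, hzero n I' hI' (fun h => hdv (hJJ.2 h))]

end Pt
end HW

end

section
set_option linter.all false
open scoped Pointwise

namespace HW

section clsMap
variable {A B : Type} [CommRing A] [IsDedekindDomain A] [CommRing B] [IsDedekindDomain B]

structure IsIdMap (g : Ideal A → Ideal B) : Prop where
  mul : ∀ I J, g (I * J) = g I * g J
  ne : ∀ I, I ≠ 0 → g I ≠ 0
  pr : ∀ x : A, x ≠ 0 → ∃ y : B, y ≠ 0 ∧ g (Ideal.span {x}) = Ideal.span {y}

lemma span_ne_zero {x : A} (hx : x ≠ 0) : Ideal.span {x} ≠ 0 := by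
  rwa [ne_eq, Ideal.zero_eq_bot, Ideal.span_singleton_eq_bot]

lemma IsIdMap.cls_congr {g : Ideal A → Ideal B} (hg : IsIdMap g) {I J : Ideal A} (hI : I ≠ 0) (hJ : J ≠ 0)
    (h : cls I = cls J) : cls (g I) = cls (g J) := by
  rw [cls_eq_iff hI hJ] at h
  obtain ⟨x, y, hx, hy, hxy⟩ := h
  obtain ⟨x', hx', hx2⟩ := hg.pr x hx
  obtain ⟨y', hy', hy2⟩ := hg.pr y hy
  rw [cls_eq_iff (hg.ne _ hI) (hg.ne _ hJ)]
  exact ⟨x', y', hx', hy', by rw [← hx2, ← hy2, ← hg.mul, ← hg.mul, hxy]⟩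

def IsIdMap.clsMap {g : Ideal A → Ideal B} (hg : IsIdMap g) : ClassGroup A →* ClassGroup B :=
  MonoidHom.mk' (fun C => cls (g (cls_surj C).choose)) (by
    intro C C'
    have h1 := (cls_surj C).choose_spec
    have h2 := (cls_surj C').choose_spec
    have h3 := (cls_surj (C * C')).choose_spec
    rw [← cls_mul (hg.ne _ h1.1) (hg.ne _ h2.1), ← hg.mul]
    exact hg.cls_congr h3.1 (mul_ne_zero h1.1 h2.1) (by rw [h3.2, cls_mul h1.1 h2.1, h1.2, h2.2]))

lemma IsIdMap.clsMap_cls {g : Ideal A → Ideal B} (hg : IsIdMap g) {I : Ideal A} (hI : I ≠ 0) :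
    hg.clsMap (cls I) = cls (g I) :=
  hg.cls_congr (cls_surj (cls I)).choose_spec.1 hI (cls_surj (cls I)).choose_spec.2

end clsMap

lemma group_lemma {A : Type} [CommGroup A] [Finite A] (s N : A →* A) (hNs : ∀ a, N (s a) = N a)
    (hfix : ∀ a, s a = a → a ∈ N.range) (a : A) (ha : N a = 1) : ∃ b, a * b = s b := by
  set D : A →* A := s / MonoidHom.id A with hD
  have hDa : ∀ a, D a = s a / a := fun a => rfl
  have h1 : D.range ≤ N.ker := by
    rintro _ ⟨b, rfl⟩
    rw [MonoidHom.mem_ker, hDa, map_div, hNs, div_self']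
  have h2 : D.ker ≤ N.range := by
    intro b hb
    rw [MonoidHom.mem_ker, hDa, div_eq_one] at hb
    exact hfix b hb
  have c1 : Nat.card A = Nat.card D.ker * Nat.card D.range := by
    rw [Subgroup.card_eq_card_quotient_mul_card_subgroup D.ker,
      Nat.card_congr (QuotientGroup.quotientKerEquivRange D).toEquiv, mul_comm]
  have c2 : Nat.card A = Nat.card N.ker * Nat.card N.range := by
    rw [Subgroup.card_eq_card_quotient_mul_card_subgroup N.ker,
      Nat.card_congr (QuotientGroup.quotientKerEquivRange N).toEquiv, mul_comm]
  have c3 : Nat.card D.ker ≤ Nat.card N.range := Subgroup.card_le_of_le h2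
  have c4 : Nat.card N.ker ≤ Nat.card D.range := by
    have hp : 0 < Nat.card D.ker := Nat.card_pos
    refine Nat.le_of_mul_le_mul_right (c := Nat.card D.ker) ?_ hp
    calc _ ≤ Nat.card N.ker * Nat.card N.range := Nat.mul_le_mul_left _ c3
      _ = _ := by rw [← c2, c1, mul_comm]
  have h3 := Subgroup.eq_of_le_of_card_ge h1 c4
  have h4 : a ∈ D.range := by rw [h3]; exact ha
  obtain ⟨b, hb⟩ := h4
  refine ⟨b, ?_⟩
  rw [← hb, hDa, div_mul_cancel]

variable {S B : Type} [CommRing S] [IsDedekindDomain S] [CommRing B] [IsDedekindDomain B] [Algebra S B]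

def nrm (σ : B ≃ₐ[S] B) (d : ℕ) (x : B) : B := ∏ i ∈ Finset.range d, (σ ^ i) • x

def nrmI (σ : B ≃ₐ[S] B) (d : ℕ) (I : Ideal B) : Ideal B := ∏ i ∈ Finset.range d, (σ ^ i) • I

structure Cyc (σ : B ≃ₐ[S] B) (θ : B) (d : ℕ) : Prop where
  inj : Function.Injective (algebraMap S B)
  gen : ∀ y : B, ∃ b : Fin d → S, y = ∑ i, algebraMap S B (b i) * θ ^ (i : ℕ)
  unit : IsUnit (Matrix.vandermonde (fun j : Fin d => (σ ^ (j : ℕ)) • θ)).det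
  per : σ ^ d = 1
  dpos : 0 < d
  un : ∀ u : S, IsUnit u → ∃ v : B, IsUnit v ∧ nrm σ d v = algebraMap S B u

lemma smul_span (σ : B ≃ₐ[S] B) (x : B) : σ • (Ideal.span {x} : Ideal B) = Ideal.span {σ • x} := by
  rw [Ideal.pointwise_smul_def, Ideal.map_span, Set.image_singleton]; rfl

lemma smul_ideal_ne_zero (σ : B ≃ₐ[S] B) {I : Ideal B} (h : I ≠ 0) : σ • I ≠ 0 := by
  rwa [ne_eq, smul_eq_zero_iff_eq]

lemma smul_ne_zero' (σ : B ≃ₐ[S] B) {x : B} (h : x ≠ 0) : σ • x ≠ 0 := by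
  rwa [ne_eq, smul_eq_zero_iff_eq]

lemma isIdMap_smul (σ : B ≃ₐ[S] B) : IsIdMap (fun I : Ideal B => σ • I) where
  mul I J := smul_mul' σ I J
  ne I h := smul_ideal_ne_zero σ h
  pr x hx := ⟨σ • x, smul_ne_zero' σ hx, smul_span σ x⟩

lemma nrm_ne_zero (σ : B ≃ₐ[S] B) (d : ℕ) {x : B} (h : x ≠ 0) : nrm σ d x ≠ 0 :=
  Finset.prod_ne_zero_iff.2 fun i _ => smul_ne_zero' _ h

lemma nrm_mul (σ : B ≃ₐ[S] B) (d : ℕ) (x y : B) : nrm σ d (x * y) = nrm σ d x * nrm σ d y := by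
  simp only [nrm, smul_mul', Finset.prod_mul_distrib]

lemma nrmI_span (σ : B ≃ₐ[S] B) (d : ℕ) (x : B) :
    nrmI σ d (Ideal.span {x}) = Ideal.span {nrm σ d x} := by
  simp only [nrmI, nrm, smul_span, Ideal.prod_span_singleton]

lemma isIdMap_nrmI (σ : B ≃ₐ[S] B) (d : ℕ) : IsIdMap (nrmI σ d) where
  mul I J := by simp only [nrmI, smul_mul', Finset.prod_mul_distrib]
  ne I h := Finset.prod_ne_zero_iff.2 fun i _ => smul_ideal_ne_zero _ h
  pr x hx := ⟨nrm σ d x, nrm_ne_zero σ d hx, nrmI_span σ d x⟩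

lemma isIdMap_map (hinj : Function.Injective (algebraMap S B)) :
    IsIdMap (fun I : Ideal S => I.map (algebraMap S B)) where
  mul I J := Ideal.map_mul _ _ _
  ne I h := by rwa [ne_eq, Ideal.zero_eq_bot, Ideal.map_eq_bot_iff_of_injective hinj]
  pr x hx := ⟨algebraMap S B x, by rwa [ne_eq, map_eq_zero_iff _ hinj], by
    simp only [Ideal.map_span, Set.image_singleton]⟩

lemma smul_map (σ : B ≃ₐ[S] B) (I : Ideal S) :
    σ • (I.map (algebraMap S B)) = I.map (algebraMap S B) := by
  rw [Ideal.pointwise_smul_def, Ideal.map_map]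
  congr 1
  ext x
  simp [AlgEquiv.smul_def]

lemma nrmI_map (σ : B ≃ₐ[S] B) (d : ℕ) (I : Ideal S) :
    nrmI σ d (I.map (algebraMap S B)) = (I.map (algebraMap S B)) ^ d := by
  simp only [nrmI, smul_map, Finset.prod_const, Finset.card_range]

namespace Cyc
variable {σ : B ≃ₐ[S] B} {θ : B} {d : ℕ} (h : Cyc σ θ d)
include h

lemma smul_nrm (x : B) : σ • nrm σ d x = nrm σ d x := by
  rw [nrm, Finset.smul_prod']
  simp only [← mul_smul, ← pow_succ']
  have := Finset.prod_range_succ (fun i => σ ^ i • x) d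
  rw [Finset.prod_range_succ', h.per, pow_zero] at this
  by_cases hx : x = 0
  · subst hx; simp
  · rw [one_smul] at this
    exact mul_right_cancel₀ hx this

lemma nrm_smul (x : B) : nrm σ d (σ • x) = nrm σ d x := by
  rw [← h.smul_nrm x, nrm, nrm, Finset.smul_prod']
  simp only [← mul_smul, ← pow_succ', ← pow_succ]

lemma nrmI_smul (I : Ideal B) : nrmI σ d (σ • I) = nrmI σ d I := by
  rw [nrmI, nrmI]
  simp only [← mul_smul, ← pow_succ]
  have := Finset.prod_range_succ (fun i => σ ^ i • I) d
  rw [Finset.prod_range_succ', h.per, pow_zero] at this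
  by_cases hx : I = 0
  · subst hx; simp
  · rw [one_smul] at this
    exact mul_right_cancel₀ hx this

/-- coefficients are B-combinations of conjugates -/
lemma coeff : ∃ W : Matrix (Fin d) (Fin d) B, ∀ (b : Fin d → S) (i : Fin d),
    algebraMap S B (b i) = ∑ j : Fin d, W i j * (σ ^ (j : ℕ)) •
      (∑ i : Fin d, algebraMap S B (b i) * θ ^ (i : ℕ)) := by
  set V := Matrix.vandermonde (fun j : Fin d => (σ ^ (j : ℕ)) • θ) with hV
  refine ⟨V⁻¹, fun b i => ?_⟩
  have h1 : (fun j : Fin d => (σ ^ (j : ℕ)) • (∑ i : Fin d, algebraMap S B (b i) * θ ^ (i : ℕ))) =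
      V.mulVec (fun i => algebraMap S B (b i)) := by
    ext j
    rw [Matrix.mulVec, dotProduct, Finset.smul_sum]
    refine Finset.sum_congr rfl fun i _ => ?_
    rw [hV, Matrix.vandermonde_apply, smul_mul', smul_pow', mul_comm]
    congr 1
    rw [AlgEquiv.smul_def, AlgEquiv.commutes]
  have h2 : (V⁻¹).mulVec (V.mulVec (fun i => algebraMap S B (b i))) = fun i => algebraMap S B (b i) := by
    rw [Matrix.mulVec_mulVec, Matrix.nonsing_inv_mul _ h.unit, Matrix.one_mulVec]
  rw [← h1] at h2
  have := congrFun h2 i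
  rw [← this]
  rfl

lemma exists_of_fixed {y : B} (hy : σ • y = y) : ∃ b : S, algebraMap S B b = y := by
  obtain ⟨W, hW⟩ := h.coeff
  obtain ⟨b, hb⟩ := h.gen y
  have hpow : ∀ j : ℕ, (σ ^ j) • y = y := by
    intro j
    induction j with
    | zero => simp
    | succ j ih => rw [pow_succ, mul_smul, hy, ih]
  set z : Fin d := ⟨0, h.dpos⟩
  have h1 := fun i => hW (fun i => if i = z then 1 else 0) i
  have h2 : (∑ i : Fin d, algebraMap S B (if i = z then 1 else 0) * θ ^ (i : ℕ)) = 1 := by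
    rw [Finset.sum_eq_single z]
    · simp [z]
    · intro i _ hi; simp [hi]
    · simp
  refine ⟨b z, ?_⟩
  have h3 := hW b z
  rw [← hb] at h3
  simp only [hpow] at h3
  have h4 := h1 z
  rw [h2] at h4
  simp only [smul_one, mul_one, if_true, map_one] at h4
  rw [h3, ← Finset.sum_mul, ← h4, one_mul]

lemma extended {I : Ideal B} (hI : σ • I = I) :
    (I.comap (algebraMap S B)).map (algebraMap S B) = I := by
  apply le_antisymm Ideal.map_comap_le
  intro y hy
  have hpow : ∀ j : ℕ, (σ ^ j) • I = I := by
    intro j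
    induction j with
    | zero => simp
    | succ j ih => rw [pow_succ, mul_smul, hI, ih]
  obtain ⟨W, hW⟩ := h.coeff
  obtain ⟨b, hb⟩ := h.gen y
  rw [hb]
  refine Ideal.sum_mem _ fun i _ => Ideal.mul_mem_right _ _ (Ideal.mem_map_of_mem _ ?_)
  rw [Ideal.mem_comap, hW b i, ← hb]
  refine Ideal.sum_mem _ fun j _ => Ideal.mul_mem_left _ _ ?_
  rw [← hpow j]
  exact Ideal.smul_mem_pointwise_smul _ _ _ hy

/-- Hilbert 90 -/
lemma h90 {x y : B} (hx : x ≠ 0) (hy : y ≠ 0) (hxy : nrm σ d x = nrm σ d y) :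
    ∃ c : B, c ≠ 0 ∧ (σ • c) * y = c * x := by
  obtain ⟨d', rfl⟩ : ∃ d', d = d' + 1 := ⟨d - 1, by have := h.dpos; lia⟩
  set a : ℕ → B := fun i => (∏ l ∈ Finset.range i, (σ ^ l) • y) *
    (∏ l ∈ Finset.Ico i (d' + 1), (σ ^ l) • x) with ha
  set c : B → B := fun z => ∑ i ∈ Finset.range (d' + 1), a i * (σ ^ i) • z with hc
  have hstep : ∀ i < d' + 1, (σ • a i) * y = a (i + 1) * x := by
    intro i hi
    simp only [ha, smul_mul', Finset.smul_prod', ← mul_smul, ← pow_succ']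
    have e1 : (∏ l ∈ Finset.range i, (σ ^ (l + 1)) • y) * y = ∏ l ∈ Finset.range (i + 1), (σ ^ l) • y := by
      rw [Finset.prod_range_succ']; simp
    have e2 : ∏ l ∈ Finset.Ico i (d' + 1), (σ ^ (l + 1)) • x =
        (∏ l ∈ Finset.Ico (i + 1) (d' + 1), (σ ^ l) • x) * x := by
      rw [Finset.prod_Ico_add' (fun l => (σ ^ l) • x) i (d' + 1) 1,
        Finset.prod_Ico_succ_top (by lia), h.per, one_smul]
    rw [e2, ← e1]; ring
  have hend : a (d' + 1) = a 0 := by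
    simp only [ha]
    rw [Finset.Ico_self, Finset.prod_empty, Finset.prod_range_zero, mul_one, one_mul,
      ← Finset.range_eq_Ico]
    exact hxy.symm
  have hcz : ∀ z, (σ • c z) * y = c z * x := by
    intro z
    simp only [hc]
    rw [Finset.smul_sum, Finset.sum_mul, Finset.sum_mul]
    have : ∀ i ∈ Finset.range (d' + 1), (σ • (a i * (σ ^ i) • z)) * y = a (i + 1) * x * (σ ^ (i + 1)) • z := by
      intro i hi
      rw [Finset.mem_range] at hi
      rw [smul_mul', ← hstep i hi, pow_succ', mul_smul]; ring
    rw [Finset.sum_congr rfl this]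
    rw [Finset.sum_range_succ, Finset.sum_range_succ' (fun i => a i * (σ ^ i) • z * x), hend, h.per]
    simp only [pow_zero, one_smul]
    congr 1
    · exact Finset.sum_congr rfl fun i _ => by ring
    · ring
  by_contra! hno
  have hc0 : ∀ z, c z = 0 := by
    intro z; by_contra h0; exact hno _ h0 (hcz z)
  have hvec : Matrix.vecMul (fun i : Fin (d' + 1) => a i)
      (Matrix.vandermonde (fun j : Fin (d' + 1) => (σ ^ (j : ℕ)) • θ)) = 0 := by
    ext l
    have := hc0 (θ ^ (l : ℕ))
    simp only [hc] at this
    rw [Matrix.vecMul, dotProduct, Pi.zero_apply]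
    rw [Finset.sum_range] at this
    simpa [Matrix.vandermonde_apply, smul_pow'] using this
  have hz := Matrix.eq_zero_of_vecMul_eq_zero h.unit.ne_zero hvec
  have h0 := congrFun hz 0
  simp only [ha, Pi.zero_apply, Fin.val_zero, Finset.prod_range_zero, one_mul] at h0
  rw [Finset.prod_eq_zero_iff] at h0
  obtain ⟨l, _, hl⟩ := h0
  exact smul_ne_zero' (σ ^ l) hx hl

/-- fixed classes are extended -/
lemma fixed_cls {I : Ideal B} (hI : I ≠ 0) (hc : cls (σ • I) = cls I) :
    ∃ J : Ideal S, J ≠ 0 ∧ cls I = cls (J.map (algebraMap S B)) := by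
  rw [cls_eq_iff (smul_ideal_ne_zero σ hI) hI] at hc
  obtain ⟨x, y, hx, hy, hxy⟩ := hc
  have h1 := congrArg (nrmI σ d) hxy
  rw [(isIdMap_nrmI σ d).mul, (isIdMap_nrmI σ d).mul, h.nrmI_smul, nrmI_span, nrmI_span] at h1
  have h2 := mul_right_cancel₀ ((isIdMap_nrmI σ d).ne I hI) h1
  rw [Ideal.span_singleton_eq_span_singleton] at h2
  obtain ⟨u, hu⟩ := h2
  have hufix : σ • (u : B) = u := by
    have h3 := congrArg (fun t => σ • t) hu
    simp only [smul_mul', h.smul_nrm] at h3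
    rw [← hu] at h3
    exact mul_left_cancel₀ (nrm_ne_zero σ d hx) h3
  obtain ⟨u0, hu0⟩ := h.exists_of_fixed hufix
  have hu0u : IsUnit u0 := by
    have h4 : σ • ((u⁻¹ : Bˣ) : B) = (u⁻¹ : Bˣ) := by
      have := congrArg (fun t => σ • t) (u.mul_inv)
      simp only [smul_mul', hufix, smul_one] at this
      rw [← u.mul_inv] at this
      exact mul_left_cancel₀ u.ne_zero this
    obtain ⟨u1, hu1⟩ := h.exists_of_fixed h4
    refine IsUnit.of_mul_eq_one u1 (h.inj ?_)
    rw [map_mul, hu0, hu1, map_one, u.mul_inv]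
  obtain ⟨v, hv, hvn⟩ := h.un u0 hu0u
  -- x' = x v
  have hn : nrm σ d (x * v) = nrm σ d y := by rw [nrm_mul, hvn, hu0, hu]
  have hxv : x * v ≠ 0 := mul_ne_zero hx hv.ne_zero
  obtain ⟨c, hc0, hc⟩ := h.h90 hxv hy hn
  have hxs : Ideal.span {x * v} = Ideal.span {x} := Ideal.span_singleton_mul_right_unit hv x
  have hinv : σ • (Ideal.span {c} * I) = Ideal.span {c} * I := by
    rw [smul_mul', smul_span]
    apply mul_left_cancel₀ (span_ne_zero hx)
    calc Ideal.span {x} * (Ideal.span {σ • c} * σ • I) = Ideal.span {σ • c} * (Ideal.span {x} * σ • I) := by ring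
      _ = Ideal.span {σ • c} * Ideal.span {y} * I := by rw [hxy]; ring
      _ = Ideal.span {c} * Ideal.span {x * v} * I := by
          rw [Ideal.span_singleton_mul_span_singleton, hc, Ideal.span_singleton_mul_span_singleton]
      _ = _ := by rw [hxs]; ring
  have hext := h.extended hinv
  have hne : Ideal.span {c} * I ≠ 0 := mul_ne_zero (span_ne_zero hc0) hI
  refine ⟨(Ideal.span {c} * I).comap (algebraMap S B), ?_, ?_⟩
  · intro h0
    rw [h0] at hext
    apply hne
    rw [← hext, Ideal.zero_eq_bot, Ideal.map_bot]; rfl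
  · rw [hext, cls_eq_iff hI hne]
    exact ⟨c, 1, hc0, one_ne_zero, by rw [Ideal.span_singleton_one, ← Ideal.one_eq_top, one_mul]⟩

/-- the main algebraic conclusion -/
theorem norm_of_pow [Finite (ClassGroup B)]
    (hH : ∀ J : Ideal S, J ≠ 0 → cls (J.map (algebraMap S B)) ∈ (isIdMap_nrmI σ d).clsMap.range)
    {f : S} (hf : f ≠ 0) {I : Ideal S} (hI : I ^ d = Ideal.span {f}) :
    ∃ x y : B, x ≠ 0 ∧ y ≠ 0 ∧ algebraMap S B f * nrm σ d x = nrm σ d y := by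
  have hI0 : I ≠ 0 := by
    rintro rfl
    rw [zero_pow h.dpos.ne'] at hI
    exact span_ne_zero hf hI.symm
  have hIB := (isIdMap_map h.inj).ne I hI0
  have hN1 : (isIdMap_nrmI σ d).clsMap (cls (I.map (algebraMap S B))) = 1 := by
    rw [(isIdMap_nrmI σ d).clsMap_cls hIB, nrmI_map, ← Ideal.map_pow, hI, Ideal.map_span,
      Set.image_singleton, cls_of_ne (span_ne_zero (by rwa [ne_eq, map_eq_zero_iff _ h.inj])),
      ClassGroup.mk0_eq_one_iff]
    exact ⟨_, rfl⟩
  obtain ⟨C, hC⟩ := group_lemma (isIdMap_smul σ).clsMap (isIdMap_nrmI σ d).clsMap (by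
    intro a
    obtain ⟨J, hJ, rfl⟩ := cls_surj a
    rw [(isIdMap_smul σ).clsMap_cls hJ, (isIdMap_nrmI σ d).clsMap_cls (smul_ideal_ne_zero σ hJ),
      (isIdMap_nrmI σ d).clsMap_cls hJ, h.nrmI_smul]) (by
    intro a ha
    obtain ⟨J, hJ, rfl⟩ := cls_surj a
    rw [(isIdMap_smul σ).clsMap_cls hJ] at ha
    obtain ⟨J', hJ', hJJ⟩ := h.fixed_cls hJ ha
    rw [hJJ]; exact hH J' hJ') _ hN1
  obtain ⟨J, hJ, rfl⟩ := cls_surj C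
  rw [(isIdMap_smul σ).clsMap_cls hJ, ← cls_mul hIB hJ,
    cls_eq_iff (mul_ne_zero hIB hJ) (smul_ideal_ne_zero σ hJ)] at hC
  obtain ⟨x, y, hx, hy, hxy⟩ := hC
  have h1 := congrArg (nrmI σ d) hxy
  rw [(isIdMap_nrmI σ d).mul, (isIdMap_nrmI σ d).mul, (isIdMap_nrmI σ d).mul, h.nrmI_smul, nrmI_span,
    nrmI_span, nrmI_map, ← Ideal.map_pow, hI, Ideal.map_span, Set.image_singleton, ← mul_assoc] at h1
  have h2 := mul_right_cancel₀ ((isIdMap_nrmI σ d).ne J hJ) h1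
  rw [Ideal.span_singleton_mul_span_singleton, Ideal.span_singleton_eq_span_singleton] at h2
  obtain ⟨u, hu⟩ := h2
  have hff : algebraMap S B f ≠ 0 := by rwa [ne_eq, map_eq_zero_iff _ h.inj]
  have hxf := mul_ne_zero (nrm_ne_zero σ d hx) hff
  have hufix : σ • (u : B) = u := by
    have h3 := congrArg (fun t => σ • t) hu
    simp only [smul_mul', h.smul_nrm] at h3
    rw [← hu, AlgEquiv.smul_def σ (algebraMap S B f), AlgEquiv.commutes] at h3
    exact mul_left_cancel₀ hxf h3
  obtain ⟨u0, hu0⟩ := h.exists_of_fixed hufix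
  have hu0u : IsUnit u0 := by
    have h4 : σ • ((u⁻¹ : Bˣ) : B) = (u⁻¹ : Bˣ) := by
      have := congrArg (fun t => σ • t) (u.mul_inv)
      simp only [smul_mul', hufix, smul_one] at this
      rw [← u.mul_inv] at this
      exact mul_left_cancel₀ u.ne_zero this
    obtain ⟨u1, hu1⟩ := h.exists_of_fixed h4
    refine IsUnit.of_mul_eq_one u1 (h.inj ?_)
    rw [map_mul, hu0, hu1, map_one, u.mul_inv]
  obtain ⟨v, hv, hvn⟩ := h.un u0 hu0u
  refine ⟨x * v, y, mul_ne_zero hx hv.ne_zero, hy, ?_⟩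
  rw [nrm_mul, hvn, hu0, ← hu]; ring

end Cyc
end HW

end

section
set_option linter.all false
open scoped Pointwise

namespace HW
variable {S B : Type} [CommRing S] [IsDedekindDomain S] [CommRing B] [IsDedekindDomain B] [Algebra S B]
namespace Cyc
variable {σ : B ≃ₐ[S] B} {θ : B} {d : ℕ} (h : Cyc σ θ d)
include h

lemma module_finite : Module.Finite S B := by
  classical
  refine ⟨⟨Finset.univ.image (fun i : Fin d => θ ^ (i : ℕ)), ?_⟩⟩
  rw [eq_top_iff]
  intro y _
  obtain ⟨b, rfl⟩ := h.gen y
  refine Submodule.sum_mem _ fun i _ => ?_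
  rw [← Algebra.smul_def]
  refine Submodule.smul_mem _ _ (Submodule.subset_span ?_)
  simp

lemma pow_mod (i : ℕ) : σ ^ i = σ ^ (i % d) := by
  conv_lhs => rw [← Nat.div_add_mod i d, pow_add, pow_mul, h.per, one_pow, one_mul]

lemma smul_pow_theta {Q : ℕ} (hθ : σ • θ = θ ^ Q) (i : ℕ) : (σ ^ i) • θ = θ ^ (Q ^ i) := by
  induction i with
  | zero => simp
  | succ i ih => rw [pow_succ, mul_smul, hθ, smul_pow', ih, ← pow_mul, pow_succ]

lemma mod_eq {L : Type} [Field L] (φ : B →+* L) {i j : ℕ}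
    (hij : φ ((σ ^ i) • θ) = φ ((σ ^ j) • θ)) : i ≡ j [MOD d] := by
  rw [h.pow_mod i, h.pow_mod j] at hij
  have h1 : (Matrix.vandermonde (fun j : Fin d => φ ((σ ^ (j : ℕ)) • θ))).det ≠ 0 := by
    have := (h.unit.map φ).ne_zero
    rw [RingHom.map_det] at this
    convert this using 2
    ext a b
    simp [Matrix.vandermonde_apply, -AlgEquiv.smul_def]
  rw [Matrix.det_vandermonde_ne_zero_iff] at h1
  have := @h1 ⟨i % d, Nat.mod_lt _ h.dpos⟩ ⟨j % d, Nat.mod_lt _ h.dpos⟩ hij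
  exact Fin.mk.inj this

lemma gcd_dvd {Q : ℕ} (hθ : σ • θ = θ ^ Q) (P : Ideal S) [P.IsMaximal] (M : Ideal B) [M.IsMaximal]
    [M.LiesOver P] [Finite (B ⧸ M)] {n : ℕ} (hn : Nat.card (S ⧸ P) = Q ^ n) {g : ℕ}
    (hg : (σ ^ g) • M = M) : Nat.gcd d n ∣ g := by
  letI := Ideal.Quotient.field P
  letI := Ideal.Quotient.field M
  haveI : Finite (S ⧸ P) := Finite.of_injective (algebraMap (S ⧸ P) (B ⧸ M)) (algebraMap (S ⧸ P) (B ⧸ M)).injective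
  letI := Fintype.ofFinite (S ⧸ P)
  letI := Fintype.ofFinite (B ⧸ M)
  set s := Ideal.Quotient.stabilizerHom M P (B ≃ₐ[S] B) ⟨σ ^ g, hg⟩ with hs
  obtain ⟨t, ht⟩ := (FiniteField.bijective_frobeniusAlgEquivOfAlgebraic_pow (S ⧸ P) (B ⧸ M)).2 s
  have h1 : s (Ideal.Quotient.mk M θ) = Ideal.Quotient.mk M ((σ ^ g) • θ) := rfl
  have h2 : s (Ideal.Quotient.mk M θ) = Ideal.Quotient.mk M ((σ ^ (n * t)) • θ) := by
    rw [← ht, h.smul_pow_theta hθ]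
    simp only [AlgEquiv.coe_pow, FiniteField.coe_frobeniusAlgEquivOfAlgebraic, pow_iterate, map_pow]
    rw [← Nat.card_eq_fintype_card, hn, ← pow_mul]
  rw [h1] at h2
  have h3 := h.mod_eq _ h2
  have h4 : g ≡ n * t [MOD Nat.gcd d n] := h3.of_dvd (Nat.gcd_dvd_left _ _)
  exact (Nat.modEq_zero_iff_dvd.1 (h4.trans (Nat.modEq_zero_iff_dvd.2 ((Nat.gcd_dvd_right d n).mul_right _))))

lemma nrmI_eq_pow (M : Ideal B) (g e : ℕ) (hg : (σ ^ g) • M = M) :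
    nrmI σ (g * e) M = (nrmI σ g M) ^ e := by
  have hge : ∀ e, (σ ^ (g * e)) • M = M := by
    intro e
    induction e with
    | zero => simp
    | succ e ih => rw [Nat.mul_succ, pow_add, mul_smul, hg, ih]
  induction e with
  | zero => simp [nrmI]
  | succ e ih =>
    rw [Nat.mul_succ, pow_succ, ← ih, nrmI, nrmI, nrmI, Finset.prod_range_add]
    congr 1
    refine Finset.prod_congr rfl fun i _ => ?_
    rw [add_comm, pow_add, mul_smul, hge]

theorem prime_cond {Q : ℕ} (hθ : σ • θ = θ ^ Q) (hfin : ∀ M : Ideal B, M.IsMaximal → Finite (B ⧸ M))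
    (hnf : ∀ M : Ideal B, M.IsMaximal → M ≠ 0)
    (P : Ideal S) (hP : Prime P) {n j : ℕ} (hn : Nat.card (S ⧸ P) = Q ^ n)
    (hj : d ∣ j * n) : cls ((P.map (algebraMap S B)) ^ j) ∈ (isIdMap_nrmI σ d).clsMap.range := by
  haveI : P.IsPrime := Ideal.isPrime_of_prime hP
  haveI : P.IsMaximal := ‹P.IsPrime›.isMaximal hP.ne_zero
  haveI := h.module_finite
  haveI : FaithfulSMul S B := (faithfulSMul_iff_algebraMap_injective S B).2 h.inj
  obtain ⟨M, hM, hMP⟩ := Ideal.exists_maximal_ideal_liesOver_of_isIntegral P (S := B)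
  haveI := hfin M hM
  set g := Function.minimalPeriod (fun I : Ideal B => σ • I) M with hgdef
  have hiter : ∀ i (I : Ideal B), (fun I : Ideal B => σ • I)^[i] I = (σ ^ i) • I := by
    intro i I
    rw [smul_iterate]
  have hper : Function.IsPeriodicPt (fun I : Ideal B => σ • I) d M := by
    rw [Function.IsPeriodicPt, Function.IsFixedPt, hiter, h.per, one_smul]
  have hgd : g ∣ d := hper.minimalPeriod_dvd
  have hgM : (σ ^ g) • M = M := by
    rw [← hiter]; exact Function.isPeriodicPt_minimalPeriod _ M
  have hg0 : 0 < g := Nat.pos_of_dvd_of_pos hgd h.dpos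
  have hdvd := h.gcd_dvd hθ P M hn hgM
  obtain ⟨e, he⟩ := hgd
  have hej : e ∣ j := by
    have h1 : d / Nat.gcd d n ∣ j := by
      rw [mul_comm] at hj
      rw [Nat.div_dvd_iff_dvd_mul (Nat.gcd_dvd_left _ _) (Nat.gcd_pos_of_pos_left _ h.dpos)]
      rw [← Nat.gcd_mul_right]
      exact Nat.dvd_gcd (dvd_mul_right _ _) hj
    refine dvd_trans ?_ h1
    obtain ⟨k, hk⟩ := hdvd
    refine ⟨k, ?_⟩
    apply Nat.div_eq_of_eq_mul_right (Nat.gcd_pos_of_pos_left _ h.dpos)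
    calc d = g * e := he
      _ = Nat.gcd d n * k * e := by rw [← hk]
      _ = _ := by ring
  have hM0 : M ≠ 0 := hnf M hM
  -- the product over the orbit is extended
  have hinv : σ • nrmI σ g M = nrmI σ g M := by
    have := Finset.prod_range_succ (fun i => σ ^ i • M) g
    rw [Finset.prod_range_succ', hgM, pow_zero, one_smul] at this
    have := mul_right_cancel₀ hM0 this
    rw [nrmI, Finset.smul_prod']
    simp only [← mul_smul, ← pow_succ']
    exact this
  have hext := h.extended hinv
  have hA : nrmI σ g M = P.map (algebraMap S B) := by
    apply le_antisymm
    · rw [← hext]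
      refine Ideal.map_mono ?_
      have hle : nrmI σ g M ≤ M := by
        apply Ideal.le_of_dvd
        have := Finset.dvd_prod_of_mem (fun i => σ ^ i • M) (Finset.mem_range.2 hg0)
        rw [pow_zero, one_smul] at this; exact this
      rw [hMP.over]
      exact Ideal.comap_mono hle
    · apply Ideal.le_of_dvd
      have hinj : Set.InjOn (fun i => σ ^ i • M) (Finset.range g) := by
        intro i hi j hj hij
        simp only [Finset.coe_range, Set.mem_Iio] at hi hj
        simp only [← hiter] at hij
        exact (Function.iterate_eq_iterate_iff_of_lt_minimalPeriod hi hj).1 hij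
      classical
      rw [nrmI, ← Finset.prod_image (f := fun I => I) hinj]
      apply Finset.prod_primes_dvd
      · intro I hI
        rw [Finset.mem_image] at hI
        obtain ⟨i, _, rfl⟩ := hI
        rw [Ideal.prime_iff_isPrime (smul_ideal_ne_zero _ hM0)]
        exact Ideal.map_isPrime_of_equiv (MulSemiringAction.toRingEquiv _ B (σ ^ i))
      · intro I hI
        rw [Finset.mem_image] at hI
        obtain ⟨i, _, rfl⟩ := hI
        rw [Ideal.dvd_iff_le, ← smul_map (σ ^ i)]
        rw [Ideal.pointwise_smul_le_pointwise_smul_iff]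
        rw [Ideal.map_le_iff_le_comap]
        rw [hMP.over]
  obtain ⟨k, rfl⟩ := hej
  refine ⟨cls (M ^ k), ?_⟩
  rw [(isIdMap_nrmI σ d).clsMap_cls (pow_ne_zero _ hM0)]
  congr 1
  have hpk : ∀ k, nrmI σ d (M ^ k) = nrmI σ d M ^ k := by
    intro k
    induction k with
    | zero => simp [nrmI, Ideal.one_eq_top, -Ideal.one_eq_top]
    | succ k ih => rw [pow_succ, (isIdMap_nrmI σ d).mul, ih, pow_succ]
  rw [hpk, he, h.nrmI_eq_pow M g e hgM, hA, pow_mul]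

end Cyc
end HW

end

section
set_option linter.all false
open Polynomial

namespace HW
variable {p : ℕ} [Fact p.Prime] {F : Type} [Field F]

lemma V_ne_self_iff (R : FFPrime F) : R.V ≠ ⊤ := R.V_ne_top

lemma pt_RegAt [Algebra (ZMod p) F] (hF : GFF p F) (R : FFPrime F) : Pt (RegAt R) R := by
  obtain ⟨τ, hτ, hτR, htr, hs⟩ := exists_sep_pole hF R
  refine ⟨?_, ?_, ?_, finite_residue hF R⟩
  · rw [regAt_eq hτ hτR]; exact hs.pack.1
  · intro a ha ha0
    by_contra hneg
    push Not at hneg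
    have h1 : IsIntegral (ZMod p) a := by
      apply algebraic_of_forall_mem
      intro V _
      by_cases hV : V = R.V
      · subst hV; rw [R.mem_V']; right; lia
      · exact ha V hV
    have h2 : IsIntegral (ZMod p) a⁻¹ := h1.isAlgebraic.inv.isIntegral
    have h3 := mem_of_algebraic h2 R.V
    rw [R.mem_V', R.z_inv ha0] at h3
    rcases h3 with h3 | h3
    · exact inv_ne_zero ha0 h3
    · lia
  · refine ⟨τ, hτ, ?_, ?_⟩
    · rintro rfl; exact hτR R.V.zero_mem
    · rw [R.mem_V'] at hτR; push Not at hτR; exact hτR.2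

lemma integral_of_RegAt [Algebra (ZMod p) F] {R : FFPrime F} {a : F} (h : a ∈ RegAt R) (h2 : a ∈ R.V) :
    IsIntegral (ZMod p) a := by
  apply algebraic_of_forall_mem
  intro V _
  by_cases hV : V = R.V
  · subst hV; exact h2
  · exact h V hV

lemma card_kS [Algebra (ZMod p) F] (R : FFPrime F) :
    Nat.card (kS R (RegAt R)) = Nat.card (integralClosure (ZMod p) F) := by
  refine Nat.card_congr ⟨fun a => ⟨a.1.1, integral_of_RegAt a.1.2 a.2⟩,
    fun a => ⟨⟨a.1, fun V _ => mem_of_algebraic a.2 V⟩, mem_of_algebraic a.2 R.V⟩, ?_, ?_⟩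
  · intro a; rfl
  · intro a; rfl

lemma exists_root_ideal {S : Type} [CommRing S] [IsDedekindDomain S] {I : Ideal S} (hI : I ≠ 0) {d : ℕ}
    (hd : ∀ v : IsDedekindDomain.HeightOneSpectrum S,
      d ∣ (Associates.mk v.asIdeal).count (Associates.mk I).factors) :
    ∃ J : Ideal S, J ^ d = I := by
  refine ⟨∏ᶠ v : IsDedekindDomain.HeightOneSpectrum S,
    v.asIdeal ^ ((Associates.mk v.asIdeal).count (Associates.mk I).factors / d), ?_⟩
  rw [finprod_pow]
  · conv_rhs => rw [← Ideal.finprod_heightOneSpectrum_factorization hI]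
    refine finprod_congr fun v => ?_
    rw [← pow_mul, Nat.div_mul_cancel (hd v)]; rfl
  · refine Set.Finite.subset (Ideal.finite_factors hI) ?_
    intro v hv
    rw [Function.mem_mulSupport] at hv
    change v.asIdeal ∣ I
    rw [← Associates.count_ne_zero_iff_dvd hI v.irreducible]
    intro h0
    apply hv
    rw [h0, Nat.zero_div, pow_zero]

lemma exists_root_span {S : Subring F} (hS : Good S) [IsDedekindDomain S] {f : S} (hf : f ≠ 0) {d : ℕ}
    (hd : ∀ w : FFPrime F, (d : ℤ) ∣ w.z (f : F)) : ∃ J : Ideal S, J ^ d = Ideal.span {f} := by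
  haveI := hS.frac
  apply exists_root_ideal (span_ne_zero hf)
  intro v
  have h1 := hd (FFPrime.ofValuation (v.valuation F) (v.valuation_surjective F))
  have hf' : (f : F) ≠ 0 := fun h => hf (Subtype.ext h)
  have h2 : (FFPrime.ofValuation (v.valuation F) (v.valuation_surjective F)).z (f : F) =
      (Associates.mk v.asIdeal).count (Associates.mk (Ideal.span {f})).factors := by
    have : (v.valuation F) (f : F) = v.intValuation f := v.valuation_of_algebraMap f
    simp only [FFPrime.z, FFPrime.ofValuation, hf', if_false]
    rw [this, v.intValuation_if_neg hf, WithZero.log_exp, neg_neg]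
    rfl
  rw [h2] at h1
  exact_mod_cast h1

end HW

end

section
set_option linter.all false
open Polynomial

namespace HW
variable {p : ℕ} [Fact p.Prime] {F : Type} [Field F] [Algebra (ZMod p) F]

lemma finite_consts (hF : GFF p F) (R : FFPrime F) : Finite (integralClosure (ZMod p) F) := by
  haveI := (pt_RegAt hF R).finite_kS
  have := (pt_RegAt hF R).one_lt_Q
  rw [card_kS (p := p)] at this
  exact Nat.finite_of_card_ne_zero (by lia)

lemma const_card (hF : GFF p F) (R : FFPrime F) :
    ∃ m, 0 < m ∧ Nat.card (integralClosure (ZMod p) F) = p ^ m := by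
  haveI := finite_consts hF R
  refine ⟨Module.finrank (ZMod p) (integralClosure (ZMod p) F), Module.finrank_pos, ?_⟩
  rw [Module.natCard_eq_pow_finrank (K := ZMod p)]; simp

lemma const_pow_card (hF : GFF p F) (R : FFPrime F) {c : F} (hc : IsIntegral (ZMod p) c) :
    c ^ (Nat.card (integralClosure (ZMod p) F)) = c := by
  haveI := finite_consts hF R
  letI : Field (integralClosure (ZMod p) F) :=
    (Finite.isField_of_domain (integralClosure (ZMod p) F)).toField
  letI := Fintype.ofFinite (integralClosure (ZMod p) F)
  have := FiniteField.pow_card (⟨c, hc⟩ : integralClosure (ZMod p) F)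
  rw [Nat.card_eq_fintype_card]
  exact congrArg Subtype.val this

variable {E : Type} [Field E] [Algebra (ZMod p) E] [Algebra F E]

structure CycF (p : ℕ) [Fact p.Prime] [Algebra (ZMod p) F] [Algebra (ZMod p) E] (σ : E ≃ₐ[F] E) (θ : E) (d : ℕ) (Q : ℕ) : Prop where
  gen : ∀ y : E, ∃ c : Fin d → F, y = ∑ i, algebraMap F E (c i) * θ ^ (i : ℕ)
  sig : σ θ = θ ^ Q
  per : θ ^ (Q ^ d) = θ
  dist : ∀ i < d, ∀ j < d, θ ^ (Q ^ i) = θ ^ (Q ^ j) → i = j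
  dpos : 0 < d
  int : IsIntegral (ZMod p) θ
  card : Q = Nat.card (integralClosure (ZMod p) F)

namespace CycF
variable {σ : E ≃ₐ[F] E} {θ : E} {d Q : ℕ} (h : CycF p σ θ d Q)
include h

lemma spow (i : ℕ) : (σ ^ i) θ = θ ^ (Q ^ i) := by
  induction i with
  | zero => simp
  | succ i ih => rw [pow_succ, AlgEquiv.mul_apply, h.sig, map_pow, ih, ← pow_mul, pow_succ]

lemma sper : σ ^ d = 1 := by
  ext y
  obtain ⟨c, rfl⟩ := h.gen y
  simp only [map_sum, map_mul, map_pow, AlgEquiv.commutes, h.spow, h.per]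
  rfl

lemma vdm_inj : Function.Injective (fun j : Fin d => θ ^ (Q ^ (j : ℕ))) := by
  intro i j hij
  exact Fin.ext (h.dist i i.2 j j.2 hij)

lemma det_ne : (Matrix.vandermonde (fun j : Fin d => θ ^ (Q ^ (j : ℕ)))).det ≠ 0 := by
  rw [Matrix.det_vandermonde_ne_zero_iff]
  exact h.vdm_inj

lemma indep {c c' : Fin d → F} (hc : ∑ i, algebraMap F E (c i) * θ ^ (i : ℕ) =
    ∑ i, algebraMap F E (c' i) * θ ^ (i : ℕ)) : c = c' := by
  have h1 : ∀ c : Fin d → F, (Matrix.vandermonde (fun j : Fin d => θ ^ (Q ^ (j : ℕ)))).mulVec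
      (fun i => algebraMap F E (c i)) = fun j : Fin d => (σ ^ (j : ℕ)) (∑ i, algebraMap F E (c i) * θ ^ (i : ℕ)) := by
    intro c
    ext j
    simp only [map_sum, map_mul, map_pow, AlgEquiv.commutes, h.spow, Matrix.mulVec, dotProduct,
      Matrix.vandermonde_apply]
    exact Finset.sum_congr rfl fun i _ => mul_comm _ _
  have h2 := h1 c
  rw [hc, ← h1 c'] at h2
  have h3 := Matrix.mulVec_injective_of_isUnit ((Matrix.isUnit_iff_isUnit_det _).2 h.det_ne.isUnit) h2
  funext i
  exact (algebraMap F E).injective (congrFun h3 i)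

/-- the roots of `X^(Q^d) - X` in `E` are exactly the `k`-combinations -/
lemma consts (hF : GFF p F) (R : FFPrime F) :
    (X ^ (Q ^ d) - X : E[X]).Splits ∧ ∀ v : E, v ^ (Q ^ d) = v →
      ∃ c : Fin d → F, (∀ i, IsIntegral (ZMod p) (c i)) ∧ v = ∑ i, algebraMap F E (c i) * θ ^ (i : ℕ) := by
  classical
  haveI := finite_consts hF R
  letI := Fintype.ofFinite (integralClosure (ZMod p) F)
  haveI : CharP F p := hF.charP
  haveI : CharP E p := (RingHom.charP_iff (algebraMap F E) (algebraMap F E).injective p).1 inferInstance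
  obtain ⟨m, hm, hQm⟩ := const_card hF R
  rw [← h.card] at hQm
  have hQ1 : 1 < Q := by rw [hQm]; exact Nat.one_lt_pow hm.ne' (Fact.out : p.Prime).one_lt
  have hQd : 1 < Q ^ d := Nat.one_lt_pow h.dpos.ne' hQ1
  have hne : (X ^ (Q ^ d) - X : E[X]) ≠ 0 := FiniteField.X_pow_card_sub_X_ne_zero E hQd
  have hdeg : (X ^ (Q ^ d) - X : E[X]).natDegree = Q ^ d := FiniteField.X_pow_card_sub_X_natDegree_eq E hQd
  have hcQ : ∀ (c : F), IsIntegral (ZMod p) c → ∀ j, c ^ (Q ^ j) = c := by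
    intro c hc j
    induction j with
    | zero => simp
    | succ j ih => rw [pow_succ, pow_mul, ih, h.card, const_pow_card hF R hc]
  set g : (Fin d → integralClosure (ZMod p) F) → E :=
    fun c => ∑ i, algebraMap F E (c i).1 * θ ^ (i : ℕ) with hg
  have hginj : Function.Injective g := by
    intro c c' hcc
    have := h.indep hcc
    funext i
    exact Subtype.ext (congrFun this i)
  have hgroot : ∀ c, g c ^ (Q ^ d) = g c := by
    intro c
    simp only [hg]
    have hQp : Q ^ d = p ^ (m * d) := by rw [hQm, ← pow_mul]
    rw [hQp, sum_pow_char_pow, ← hQp]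
    refine Finset.sum_congr rfl fun i _ => ?_
    rw [mul_pow, ← map_pow, hcQ _ (c i).2, ← pow_mul, mul_comm (i : ℕ), pow_mul, h.per]
  have hcard : (Finset.univ.image g).card = Q ^ d := by
    rw [Finset.card_image_of_injective _ hginj, Finset.card_univ, Fintype.card_fun, Fintype.card_fin,
      ← Nat.card_eq_fintype_card, ← h.card]
  have hsub : Finset.univ.image g ⊆ (X ^ (Q ^ d) - X : E[X]).roots.toFinset := by
    intro v hv
    rw [Finset.mem_image] at hv
    obtain ⟨c, _, rfl⟩ := hv
    rw [Multiset.mem_toFinset, mem_roots hne]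
    simp [hgroot c]
  have hle : (X ^ (Q ^ d) - X : E[X]).roots.toFinset.card ≤ Q ^ d := by
    refine (Multiset.toFinset_card_le _).trans ((card_roots' _).trans hdeg.le)
  have heq := Finset.eq_of_subset_of_card_le hsub (by rw [hcard]; exact hle)
  constructor
  · rw [splits_iff_card_roots]
    apply le_antisymm (card_roots' _)
    rw [hdeg]
    refine le_trans ?_ (Multiset.toFinset_card_le (X ^ (Q ^ d) - X : E[X]).roots)
    exact hcard.symm.le.trans (Finset.card_le_card hsub)
  · intro v hv
    have : v ∈ (X ^ (Q ^ d) - X : E[X]).roots.toFinset := by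
      rw [Multiset.mem_toFinset, mem_roots hne]
      simp [hv]
    rw [← heq, Finset.mem_image] at this
    obtain ⟨c, _, hc⟩ := this
    exact ⟨fun i => (c i).1, fun i => (c i).2, hc.symm⟩

lemma norm_surj (hF : GFF p F) (R : FFPrime F) {u : F} (hu : IsIntegral (ZMod p) u) (hu0 : u ≠ 0) :
    ∃ v : E, IsIntegral (ZMod p) v ∧ v ≠ 0 ∧ ∏ i ∈ Finset.range d, (σ ^ i) v = algebraMap F E u := by
  haveI : CharP F p := hF.charP
  haveI : CharP E p := (RingHom.charP_iff (algebraMap F E) (algebraMap F E).injective p).1 inferInstance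
  obtain ⟨hsp, hcomb⟩ := h.consts hF R
  obtain ⟨m, hm, hQm⟩ := const_card hF R
  rw [← h.card] at hQm
  have hQ1 : 1 < Q := by rw [hQm]; exact Nat.one_lt_pow hm.ne' (Fact.out : p.Prime).one_lt
  have hQd : 1 < Q ^ d := Nat.one_lt_pow h.dpos.ne' hQ1
  set N := ∑ i ∈ Finset.range d, Q ^ i with hN
  have hNQ : N * (Q - 1) = Q ^ d - 1 := by
    have := Nat.geomSum_eq hQ1 d
    rw [hN, this, Nat.div_mul_cancel]
    simpa using Nat.sub_dvd_pow_sub_pow Q 1 d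
  have hN0 : N ≠ 0 := by
    intro h0; rw [h0, zero_mul] at hNQ; lia
  have huQ : u ^ (Q - 1) = 1 := by
    have := const_pow_card hF R hu
    rw [← h.card] at this
    apply mul_right_cancel₀ hu0
    rw [← pow_succ, Nat.sub_add_cancel hQ1.le, this, one_mul]
  set a := algebraMap F E u with ha
  have haQ : a ^ (Q - 1) = 1 := by rw [ha, ← map_pow, huQ, map_one]
  have hdvd : (X ^ N - C a : E[X]) ∣ X ^ (Q ^ d) - X := by
    have h1 : (X ^ (Q ^ d) - X : E[X]) = X * ((X ^ N) ^ (Q - 1) - (C a) ^ (Q - 1)) := by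
      rw [← pow_mul, hNQ, ← C_pow, haQ, C_1, mul_sub, ← pow_succ', Nat.sub_add_cancel hQd.le, mul_one]
    rw [h1]
    exact (sub_dvd_pow_sub_pow _ _ _).mul_left _
  have hs2 : (X ^ N - C a : E[X]).Splits := hsp.of_dvd (FiniteField.X_pow_card_sub_X_ne_zero E hQd) hdvd
  obtain ⟨v, hv⟩ := hs2.exists_eval_eq_zero (by
    rw [degree_X_pow_sub_C (Nat.pos_of_ne_zero hN0)]
    exact_mod_cast hN0)
  have hva : v ^ N = a := by simpa [sub_eq_zero] using hv
  have hvroot : v ^ (Q ^ d) = v := by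
    obtain ⟨c, hc⟩ := hdvd
    have := congrArg (eval v) hc
    rw [eval_mul, hv, zero_mul] at this
    simpa [sub_eq_zero] using this
  obtain ⟨c, hcint, hcv⟩ := hcomb v hvroot
  haveI : IsScalarTower (ZMod p) F E := zmod_tower
  have hvQ : σ v = v ^ Q := by
    rw [hcv]
    have hQp : Q = p ^ m := hQm
    rw [hQp, sum_pow_char_pow, ← hQp, map_sum]
    refine Finset.sum_congr rfl fun i _ => ?_
    rw [mul_pow, ← map_pow (algebraMap F E), map_mul, AlgEquiv.commutes, map_pow σ, h.sig]
    have := const_pow_card hF R (hcint i)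
    rw [← h.card] at this
    rw [this]; ring
  have hvpow : ∀ i, (σ ^ i) v = v ^ (Q ^ i) := by
    intro i
    induction i with
    | zero => simp
    | succ i ih => rw [pow_succ, AlgEquiv.mul_apply, hvQ, map_pow, ih, ← pow_mul, pow_succ]
  refine ⟨v, ?_, ?_, ?_⟩
  · rw [hcv]
    refine IsIntegral.sum _ fun i _ => IsIntegral.mul ((hcint i).algebraMap) (h.int.pow _)
  · rintro rfl
    rw [zero_pow hN0] at hva
    exact hu0 ((map_eq_zero _).1 hva.symm)
  · simp only [hvpow, Finset.prod_pow_eq_pow_sum]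
    exact hva

end CycF
end HW

end

section
set_option linter.all false
open Polynomial

namespace HW
variable {p : ℕ} [Fact p.Prime] {F : Type} [Field F] [Algebra (ZMod p) F]
variable {E : Type} [Field E] [Algebra (ZMod p) E] [Algebra F E]

abbrev algSB (S : Subring F) (B : Subring E) (hSB : ∀ a ∈ S, algebraMap F E a ∈ B) : Algebra S B :=
  RingHom.toAlgebra (((algebraMap F E).comp S.subtype).codRestrict B (fun a => hSB a.1 a.2))

def sigB (σ : E ≃ₐ[F] E) (S : Subring F) (B : Subring E) (hSB : ∀ a ∈ S, algebraMap F E a ∈ B)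
    (h1 : ∀ x ∈ B, σ x ∈ B) (h2 : ∀ x ∈ B, σ.symm x ∈ B) :
    letI := algSB S B hSB
    B ≃ₐ[S] B :=
  letI := algSB S B hSB
  { toFun := fun x => ⟨σ x, h1 x x.2⟩
    invFun := fun x => ⟨σ.symm x, h2 x x.2⟩
    left_inv := fun x => Subtype.ext (by simp)
    right_inv := fun x => Subtype.ext (by simp)
    map_mul' := fun x y => Subtype.ext (by simp)
    map_add' := fun x y => Subtype.ext (by simp)
    commutes' := fun r => Subtype.ext (σ.commutes r.1) }

lemma sigB_pow (σ : E ≃ₐ[F] E) (S : Subring F) (B : Subring E) (hSB : ∀ a ∈ S, algebraMap F E a ∈ B)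
    (h1 : ∀ x ∈ B, σ x ∈ B) (h2 : ∀ x ∈ B, σ.symm x ∈ B) (i : ℕ) (x : B) :
    letI := algSB S B hSB
    (((sigB σ S B hSB h1 h2) ^ i • x : B) : E) = (σ ^ i) (x : E) := by
  letI := algSB S B hSB
  change (((sigB σ S B hSB h1 h2) ^ i • x : B) : E) = (σ ^ i) (x : E)
  induction i with
  | zero => simp
  | succ i ih =>
    rw [pow_succ', mul_smul, pow_succ', AlgEquiv.mul_apply, ← ih]
    rfl

theorem mkCyc {σ : E ≃ₐ[F] E} {θ : E} {d Q : ℕ} (h : CycF p σ θ d Q) (hF : GFF p F) (R : FFPrime F)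
    (S : Subring F) (B : Subring E)
    [IsDedekindDomain S] [IsDedekindDomain B]
    (hSB : ∀ a, a ∈ S ↔ algebraMap F E a ∈ B)
    (hkB : ∀ x : E, IsIntegral (ZMod p) x → x ∈ B)
    (hkS : ∀ a : S, IsUnit a → IsIntegral (ZMod p) (a : F))
    (h1 : ∀ x ∈ B, σ x ∈ B) (h2 : ∀ x ∈ B, σ.symm x ∈ B) :
    letI := algSB S B (fun a => (hSB a).1)
    Cyc (sigB σ S B (fun a => (hSB a).1) h1 h2) (⟨θ, hkB θ h.int⟩ : B) d := by
  letI := algSB S B (fun a => (hSB a).1)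
  haveI : IsScalarTower (ZMod p) F E := zmod_tower
  have hspow := sigB_pow σ S B (fun a => (hSB a).1) h1 h2
  obtain ⟨s, hs⟩ : ∃ s, s = sigB σ S B (fun a => (hSB a).1) h1 h2 := ⟨_, rfl⟩
  change Cyc (sigB σ S B (fun a => (hSB a).1) h1 h2) (⟨θ, hkB θ h.int⟩ : B) d
  change ∀ (i : ℕ) (x : B), (((sigB σ S B (fun a => (hSB a).1) h1 h2) ^ i • x : B) : E) = (σ ^ i) (x : E) at hspow
  rw [← hs] at hspow ⊢
  have hmap : ∀ a : S, ((algebraMap S B a : B) : E) = algebraMap F E (a : F) := fun a => rfl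
  have hunitk : ∀ x : B, IsIntegral (ZMod p) (x : E) → (x : E) ≠ 0 → IsUnit x := by
    intro x hx hx0
    refine IsUnit.of_mul_eq_one ⟨(x : E)⁻¹, hkB _ hx.isAlgebraic.inv.isIntegral⟩ (Subtype.ext ?_)
    exact mul_inv_cancel₀ hx0
  set M := Matrix.vandermonde (fun j : Fin d => (s ^ (j : ℕ)) • (⟨θ, hkB θ h.int⟩ : B)) with hM
  have hMmap : B.subtype.mapMatrix M = Matrix.vandermonde (fun j : Fin d => θ ^ (Q ^ (j : ℕ))) := by
    ext i j
    have := hspow i ⟨θ, hkB θ h.int⟩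
    simp only [hM, RingHom.mapMatrix_apply, Matrix.map_apply, Matrix.vandermonde_apply, map_pow]
    rw [← h.spow]
    exact congrArg (fun t => t ^ (j : ℕ)) this
  have hMunit : IsUnit M.det := by
    have hd : ((M.det : B) : E) = (Matrix.vandermonde (fun j : Fin d => θ ^ (Q ^ (j : ℕ)))).det := by
      rw [← hMmap, ← RingHom.map_det]; rfl
    apply hunitk
    · rw [hd]
      apply IsIntegral.det
      intro i j
      rw [Matrix.vandermonde_apply]
      exact (h.int.pow _).pow _
    · rw [hd]; exact h.det_ne
  refine ⟨?_, ?_, hMunit, ?_, h.dpos, ?_⟩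
  · intro a b hab
    have := congrArg Subtype.val hab
    rw [hmap, hmap] at this
    exact Subtype.ext ((algebraMap F E).injective this)
  · intro y
    obtain ⟨c, hc⟩ := h.gen (y : E)
    have hv : (B.subtype.mapMatrix M).mulVec (fun i => algebraMap F E (c i)) =
        fun j : Fin d => (((s ^ (j : ℕ)) • y : B) : E) := by
      ext j
      rw [hMmap, hspow, hc]
      simp only [map_sum, map_mul, map_pow, AlgEquiv.commutes, h.spow, Matrix.mulVec, dotProduct,
        Matrix.vandermonde_apply]
      exact Finset.sum_congr rfl fun i _ => mul_comm _ _
    have hc2 : (fun i => algebraMap F E (c i)) = (B.subtype.mapMatrix M⁻¹).mulVec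
        (fun j : Fin d => (((s ^ (j : ℕ)) • y : B) : E)) := by
      rw [← hv, Matrix.mulVec_mulVec, ← map_mul, Matrix.nonsing_inv_mul _ hMunit, map_one, Matrix.one_mulVec]
    have hcS : ∀ i, c i ∈ S := by
      intro i
      rw [hSB, congrFun hc2 i, Matrix.mulVec, dotProduct]
      refine B.sum_mem fun j _ => B.mul_mem ?_ (SetLike.coe_mem _)
      exact (M⁻¹ i j).2
    refine ⟨fun i => ⟨c i, hcS i⟩, Subtype.ext ?_⟩
    rw [hc]
    simp [hmap]
  · ext x
    have := hspow d x
    rw [h.sper] at this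
    exact this
  · intro u hu
    obtain ⟨v, hv, hv0, hvu⟩ := h.norm_surj hF R (hkS u hu) (fun h0 => hu.ne_zero (Subtype.ext h0))
    refine ⟨⟨v, hkB v hv⟩, hunitk _ hv hv0, Subtype.ext ?_⟩
    rw [hmap, ← hvu]
    simp only [nrm]
    rw [← B.coe_subtype, map_prod]
    exact Finset.prod_congr rfl fun i _ => hspow i _

end HW

end

section
set_option linter.all false
open Polynomial

namespace HW
variable {p : ℕ} [Fact p.Prime] {F : Type} [Field F] [Algebra (ZMod p) F]
variable {E : Type} [Field E] [Algebra (ZMod p) E] [Algebra F E]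

lemma sepAt_ext [FiniteDimensional F E] {σ : E ≃ₐ[F] E} {θ : E} {d Q : ℕ} (h : CycF p σ θ d Q) {τ : F}
    (hs : SepAt p F τ) : SepAt p E (algebraMap F E τ) := by
  obtain ⟨φ, hφX, hfin, hsep⟩ := hs
  refine ⟨(algebraMap F E).comp φ, by simp [hφX], RingHom.Finite.comp ?_ hfin, ?_⟩
  · rw [RingHom.finite_algebraMap]; infer_instance
  letI := φ.toAlgebra
  letI := ((algebraMap F E).comp φ).toAlgebra
  haveI : IsScalarTower (RatFunc (ZMod p)) F E := IsScalarTower.of_algebraMap_eq' rfl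
  haveI : IsScalarTower (ZMod p) F E := zmod_tower
  haveI : Algebra.IsSeparable (RatFunc (ZMod p)) F := hsep
  have h1 : IsSeparable F θ := by
    have : IsSeparable (ZMod p) θ := PerfectField.separable_of_irreducible (minpoly.irreducible h.int)
    exact this.tower_top F
  have h2 : Algebra.IsSeparable F (IntermediateField.adjoin F {θ}) :=
    (IntermediateField.isSeparable_adjoin_simple_iff_isSeparable F E).2 h1
  have h3 : IntermediateField.adjoin F {θ} = ⊤ := by
    rw [eq_top_iff]
    intro y _
    obtain ⟨c, rfl⟩ := h.gen y
    refine sum_mem fun i _ => mul_mem (IntermediateField.algebraMap_mem _ _) (pow_mem ?_ _)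
    exact IntermediateField.mem_adjoin_simple_self F θ
  haveI : Algebra.IsSeparable F E := by
    refine ⟨fun x => ?_⟩
    have hx : x ∈ IntermediateField.adjoin F {θ} := by rw [h3]; trivial
    have := Algebra.IsSeparable.isSeparable F (⟨x, hx⟩ : IntermediateField.adjoin F {θ})
    rw [IsSeparable] at this ⊢
    rwa [IntermediateField.minpoly_eq] at this
  exact Algebra.IsSeparable.trans (RatFunc (ZMod p)) F E

theorem norm_integral [FiniteDimensional F E] {σ : E ≃ₐ[F] E} {θ : E} {d Q : ℕ} (h : CycF p σ θ d Q)
    (hF : GFF p F) (R : FFPrime F) {r : ℕ} (hr0 : 0 < r)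
    (hr : Nat.card (IsLocalRing.ResidueField R.V) = Q ^ r) (hrd : Nat.Coprime r d)
    {f : F} (hfS : f ∈ RegAt R) (hf0 : f ≠ 0) (hfd : ∀ w : FFPrime F, (d : ℤ) ∣ w.z f) :
    ∃ y : E, algebraMap F E f = ∏ i ∈ Finset.range d, (σ ^ i) y := by
  obtain ⟨τ, hτ, hτR, htr, hsep⟩ := exists_sep_pole hF R
  have hE : GFF p E := hF.of_finite
  have hPt := pt_RegAt hF R
  have hreg := regAt_eq hτ hτR
  have hB := (sepAt_ext h hsep).pack.1
  have hSB : ∀ a, a ∈ RegAt R ↔ algebraMap F E a ∈ Reg (algebraMap F E τ) := by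
    intro a
    constructor
    · intro ha V hV
      rw [hreg] at ha
      exact ha (V.comap (algebraMap F E)) hV
    · intro ha
      rw [hreg]
      intro V hV
      by_cases hVt : V = ⊤
      · rw [hVt]; trivial
      obtain ⟨w, rfl⟩ := gff_exists_ffprime hF V hVt
      obtain ⟨W, e, hW⟩ := exists_above (F := F) hE w
      have hVW : ∀ x, x ∈ w.V ↔ algebraMap F E x ∈ W.V := by
        intro x
        rw [w.mem_V', W.mem_V', hW.z_eq, map_eq_zero]
        have := hW.1
        constructor
        · rintro (h | h)
          · exact Or.inl h
          · right; positivity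
        · rintro (h | h)
          · exact Or.inl h
          · right
            have he : (0 : ℤ) < e := by exact_mod_cast this
            exact nonneg_of_mul_nonneg_right h he
      rw [hVW]
      exact ha _ ((hVW τ).1 hV)
  have hkB : ∀ x : E, IsIntegral (ZMod p) x → x ∈ Reg (algebraMap F E τ) :=
    fun x hx V _ => mem_of_algebraic hx V
  have h1 : ∀ x ∈ Reg (algebraMap F E τ), σ x ∈ Reg (algebraMap F E τ) := by
    intro x hx V hV
    exact hx (V.comap (σ : E →+* E)) (by
      rw [ValuationSubring.mem_comap]; simpa using hV)
  have h2 : ∀ x ∈ Reg (algebraMap F E τ), σ.symm x ∈ Reg (algebraMap F E τ) := by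
    intro x hx V hV
    exact hx (V.comap (σ.symm : E →+* E)) (by
      rw [ValuationSubring.mem_comap]; simpa using hV)
  have hkS : ∀ a : RegAt R, IsUnit a → IsIntegral (ZMod p) (a : F) := by
    intro a ha
    exact integral_of_RegAt a.2 ((hPt.isUnit_iff.1 ha).2)
  have hcard : Nat.card (kS R (RegAt R)) = Q := by rw [card_kS (p := p), h.card]
  clear hreg hτ
  generalize Reg (algebraMap F E τ) = B at hB hSB hkB h1 h2
  generalize RegAt R = S at hPt hSB hkS hcard hfS
  haveI := hPt.good.ded
  haveI := hPt.good.hfq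
  haveI := hB.ded
  haveI := hB.hfq
  haveI := hB.cl
  letI := algSB S B (fun a => (hSB a).1)
  have hspow := sigB_pow σ S B (fun a => (hSB a).1) h1 h2
  change ∀ (i : ℕ) (x : B), (((sigB σ S B (fun a => (hSB a).1) h1 h2) ^ i • x : B) : E) = (σ ^ i) (x : E) at hspow
  have hcyc := mkCyc h hF R S B hSB hkB hkS h1 h2
  change Cyc (sigB σ S B (fun a => (hSB a).1) h1 h2) (⟨θ, hkB θ h.int⟩ : B) d at hcyc
  generalize sigB σ S B (fun a => (hSB a).1) h1 h2 = s at hspow hcyc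
  have hθs : s • (⟨θ, hkB θ h.int⟩ : B) = (⟨θ, hkB θ h.int⟩ : B) ^ Q := by
    have := hspow 1 ⟨θ, hkB θ h.int⟩
    rw [pow_one, pow_one, h.sig] at this
    exact Subtype.ext this
  have hnotfield : ∀ M : Ideal B, M.IsMaximal → M ≠ 0 := by
    intro M hM hM0
    subst hM0
    have hfB : IsField B := Ring.isField_iff_maximal_bot.2 hM
    obtain ⟨t, htS, ht0, htz⟩ := hPt.pole
    have htB : (⟨algebraMap F E t, (hSB t).1 htS⟩ : B) ≠ 0 := by
      intro h0
      exact ht0 ((map_eq_zero _).1 (congrArg Subtype.val h0))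
    obtain ⟨b, hb⟩ := hfB.mul_inv_cancel htB
    have hb' : algebraMap F E t * (b : E) = 1 := congrArg Subtype.val hb
    have hb2 : (b : E) = algebraMap F E t⁻¹ := by
      rw [map_inv₀]; exact eq_inv_of_mul_eq_one_right hb'
    have hti : t⁻¹ ∈ S := by rw [hSB, ← hb2]; exact b.2
    have := hPt.neg _ hti (inv_ne_zero ht0)
    rw [R.z_inv ht0] at this
    lia
  have hfinB : ∀ M : Ideal B, M.IsMaximal → Finite (B ⧸ M) := by
    intro M hM
    exact Ring.HasFiniteQuotients.finiteQuotient (hnotfield M hM)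
  have hH := hPt.H_top hr0 (by rw [hcard]; exact hr)
    ((isIdMap_nrmI s d).clsMap.range.comap (isIdMap_map hcyc.inj).clsMap) d h.dpos hrd (by
      intro P hP j hj
      rw [Subgroup.mem_comap, map_pow, (isIdMap_map hcyc.inj).clsMap_cls hP.ne_zero]
      rw [← cls_pow ((isIdMap_map hcyc.inj).ne P hP.ne_zero)]
      refine hcyc.prime_cond hθs hfinB hnotfield P hP (n := hPt.degData.deg P) ?_ hj
      rw [hPt.degData_card hP.ne_zero, hcard])
  have hfS0 : (⟨f, hfS⟩ : S) ≠ 0 := fun h0 => hf0 (congrArg Subtype.val h0)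
  obtain ⟨I, hI⟩ := exists_root_span hPt.good hfS0 hfd
  obtain ⟨x, y, hx, hy, hxy⟩ := hcyc.norm_of_pow (by
    intro J hJ
    have : cls J ∈ ((isIdMap_nrmI s d).clsMap.range.comap (isIdMap_map hcyc.inj).clsMap) := by
      rw [hH]; trivial
    rw [Subgroup.mem_comap, (isIdMap_map hcyc.inj).clsMap_cls hJ] at this
    exact this) hfS0 hI
  have hn : ∀ x : B, ((nrm s d x : B) : E) = ∏ i ∈ Finset.range d, (σ ^ i) (x : E) := by
    intro x
    simp only [nrm]
    rw [← B.coe_subtype, map_prod]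
    exact Finset.prod_congr rfl fun i _ => hspow i _
  have hxy' := congrArg Subtype.val hxy
  have hx' : (x : E) ≠ 0 := fun h0 => hx (Subtype.ext h0)
  change algebraMap F E f * ((nrm s d x : B) : E) = ((nrm s d y : B) : E) at hxy'
  rw [hn, hn] at hxy'
  refine ⟨(y : E) / x, ?_⟩
  simp only [map_div₀, Finset.prod_div_distrib]
  rw [← hxy', mul_div_cancel_right₀]
  exact Finset.prod_ne_zero_iff.2 fun i _ => (map_ne_zero_iff _ (σ ^ i).injective).2 hx'

/-- Hasse norm type theorem for constant extensions -/
theorem norm_theorem [FiniteDimensional F E] {σ : E ≃ₐ[F] E} {θ : E} {d Q : ℕ} (h : CycF p σ θ d Q)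
    (hF : GFF p F) (R : FFPrime F) {r : ℕ} (hr0 : 0 < r)
    (hr : Nat.card (IsLocalRing.ResidueField R.V) = Q ^ r) (hrd : Nat.Coprime r d)
    {f : F} (hf0 : f ≠ 0) (hfd : ∀ w : FFPrime F, (d : ℤ) ∣ w.z f) :
    ∃ y : E, algebraMap F E f = ∏ i ∈ Finset.range d, (σ ^ i) y := by
  have hPt := pt_RegAt hF R
  haveI := hPt.good.frac
  obtain ⟨a, b, hb, hab⟩ := IsFractionRing.div_surjective (A := RegAt R) f
  have hb0 : (b : F) ≠ 0 := fun h0 => nonZeroDivisors.ne_zero hb (Subtype.ext h0)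
  have hab' : f = (a : F) / b := hab.symm
  have hf' : f * (b : F) ^ d ∈ RegAt R := by
    obtain ⟨e, rfl⟩ : ∃ e, d = e + 1 := ⟨d - 1, by have := h.dpos; lia⟩
    rw [hab', pow_succ', ← mul_assoc, div_mul_cancel₀ _ hb0]
    exact (RegAt R).mul_mem a.2 ((RegAt R).pow_mem b.2 _)
  obtain ⟨y, hy⟩ := norm_integral h hF R hr0 hr hrd hf' (mul_ne_zero hf0 (pow_ne_zero _ hb0)) (by
    intro w
    rw [w.z_mul hf0 (pow_ne_zero _ hb0), w.z_pow hb0]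
    exact dvd_add (hfd w) (dvd_mul_right _ _))
  have hbE : algebraMap F E (b : F) ≠ 0 := by simpa using hb0
  refine ⟨y / algebraMap F E b, ?_⟩
  simp only [map_div₀, Finset.prod_div_distrib, AlgEquiv.commutes, Finset.prod_const, Finset.card_range]
  rw [← hy, map_mul, map_pow, mul_div_cancel_right₀ _ (pow_ne_zero _ hbE)]

end HW

end

section
set_option linter.all false
open Polynomial

namespace HW
variable {p : ℕ} [Fact p.Prime] {F : Type} [Field F]
variable {L : Type} [Field L] [Algebra F L] {Γ : Type} [LinearOrderedCommGroupWithZero Γ]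

structure Fr (w : FFPrime F) (val : Valuation L Γ) (π : F) : Prop where
  ne : π ≠ 0
  z1 : w.z π = 1
  lt : val (algebraMap F L π) < 1
  hv : ∀ a : F, a ≠ 0 → val (algebraMap F L a) = val (algebraMap F L π) ^ (w.z a)

lemma exists_Fr (w : FFPrime F) (V : ValuationSubring L) (h : ∀ a : F, a ∈ w.V ↔ algebraMap F L a ∈ V) :
    ∃ π, Fr w V.valuation π := by
  obtain ⟨π, hπ, hz⟩ := w.exists_z 1
  have hle : ∀ a : F, a ≠ 0 → (V.valuation (algebraMap F L a) ≤ 1 ↔ 0 ≤ w.z a) := by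
    intro a ha
    rw [V.valuation_le_one_iff, ← h, w.mem_V']
    simp [ha]
  have hone : ∀ a : F, a ≠ 0 → w.z a = 0 → V.valuation (algebraMap F L a) = 1 := by
    intro a ha h0
    apply le_antisymm ((hle a ha).2 h0.ge)
    have h1 := (hle a⁻¹ (inv_ne_zero ha)).2 (by rw [w.z_inv ha, h0]; simp)
    rw [map_inv₀, map_inv₀] at h1
    exact (inv_le_one₀ (by rw [zero_lt_iff]; simpa using ha)).1 h1
  refine ⟨π, hπ, hz, ?_, ?_⟩
  · by_contra hge
    push Not at hge
    have := (hle π⁻¹ (inv_ne_zero hπ)).1 (by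
      rw [map_inv₀, map_inv₀]; exact inv_le_one_of_one_le₀ hge)
    rw [w.z_inv hπ, hz] at this
    lia
  · intro a ha
    have hu : a / π ^ (w.z a) ≠ 0 := div_ne_zero ha (zpow_ne_zero _ hπ)
    have := hone (a / π ^ (w.z a)) hu (by
      rw [w.z_div ha (zpow_ne_zero _ hπ), w.z_zpow hπ, hz]; ring)
    rw [map_div₀, map_div₀, map_zpow₀, map_zpow₀, div_eq_one_iff_eq] at this
    · exact this
    · exact zpow_ne_zero _ (by simpa using hπ)

end HW

end

section
set_option linter.all false
open Polynomial

namespace HW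
variable {p : ℕ} [Fact p.Prime] {F : Type} [Field F]
variable {L : Type} [Field L] [Algebra F L] {Γ : Type} [LinearOrderedCommGroupWithZero Γ]

/-- Subring on which the valuation behaves like an unramified extension with
residue field inside the field with `p ^ m` elements. -/
structure Nice (p : ℕ) (val : Valuation L Γ) (π : L) (m : ℕ) (X : Subring L) : Prop where
  pi_mem : π ∈ X
  inv_mem : π⁻¹ ∈ X
  ne : π ≠ 0
  lt : val π < 1
  bdd : ∀ a ∈ X, ∃ A : ℕ, val (π ^ A * a) ≤ 1
  pr : ∀ k : ℕ, ∀ a ∈ X, val a ≤ 1 → val (a ^ (p ^ (m * k)) - a) ≤ val π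

lemma pow_le_self {a : Γ} (h : a ≤ 1) {n : ℕ} (hn : n ≠ 0) : a ^ n ≤ a := by
  simpa using pow_le_pow_right_of_le_one' h (Nat.one_le_iff_ne_zero.2 hn)

lemma pr_iter [CharP L p] {val : Valuation L Γ} {ρ : Γ} {m : ℕ} (a : L) (ha : val a ≤ 1) 
    (hρ : ρ ≤ 1) (h : val (a ^ (p ^ m) - a) ≤ ρ) (k : ℕ) : val (a ^ (p ^ (m * k)) - a) ≤ ρ := by
  induction k with
  | zero => simp
  | succ k ih =>
    have hb : p ^ m ≠ 0 := pow_ne_zero _ (Fact.out : p.Prime).ne_zero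
    have e : a ^ (p ^ (m * (k+1))) - a = (a ^ (p ^ (m * k)) - a) ^ (p ^ m) + (a ^ (p ^ m) - a) := by
      rw [sub_pow_char_pow, ← pow_mul, ← pow_add]; ring_nf
    rw [e]
    refine (val.map_add _ _).trans (max_le ?_ h)
    rw [map_pow]
    calc _ ≤ ρ ^ (p ^ m) := pow_le_pow_left' ih _
      _ ≤ ρ := pow_le_self hρ hb

lemma val_one_sub {val : Valuation L Γ} {x : L} (hx : val x < 1) : val (1 - x) = 1 := by
  have := val.map_one_sub_of_lt hx
  exact this

lemma Nice.adjoin [CharP L p] {val : Valuation L Γ} {π : L} {m : ℕ} (hm : 0 < m) {X X' : Subring L}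
    (h : Nice p val π m X) (hXX : X ≤ X') (t : L) (ht : val t ≤ 1)
    (hX' : ∀ y ∈ X', ∃ (n : ℕ) (c : ℕ → L), (∀ i, c i ∈ X) ∧ y = ∑ i ∈ Finset.range n, c i * t ^ i)
    (hu : ∀ k : ℕ, ∃ u ∈ X, val (u - 1) ≤ val π ∧ t ^ (p ^ (m * k)) = u * t) :
    Nice p val π m X' := by
  have hlt := h.lt
  have hle : val π ≤ 1 := hlt.le
  have hb : ∀ (n : ℕ) (c : ℕ → L), (∀ i, c i ∈ X) → 
      ∃ A : ℕ, ∀ i ∈ Finset.range n, val (π ^ A * c i) ≤ 1 := by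
    intro n c hc
    choose A hA using fun i => h.bdd (c i) (hc i)
    refine ⟨∑ i ∈ Finset.range n, A i, fun i hi => ?_⟩
    rw [← Finset.add_sum_erase _ _ hi, pow_add, mul_right_comm, map_mul]
    refine mul_le_one' (hA i) ?_
    rw [map_pow]; exact pow_le_one' hle _
  -- one step
  have step : ∀ k (n : ℕ) (c : ℕ → L), (∀ i, c i ∈ X) → (∀ i ∈ Finset.range n, val (c i) ≤ 1) →
      ∃ c' : ℕ → L, (∀ i, c' i ∈ X) ∧ (∀ i ∈ Finset.range n, val (c' i) ≤ 1) ∧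
      (∑ i ∈ Finset.range n, c i * t ^ i) - (∑ i ∈ Finset.range n, c i * t ^ i) ^ (p ^ (m * k)) = 
        π * ∑ i ∈ Finset.range n, c' i * t ^ i := by
    intro k n c hc hc1
    obtain ⟨u, huX, hu1, hut⟩ := hu k
    have huv : val u ≤ 1 := by
      have : u = (u - 1) + 1 := by ring
      rw [this]
      exact (val.map_add _ _).trans (max_le (hu1.trans hle) (by simp))
    have hui : ∀ i : ℕ, val (u ^ i - 1) ≤ val π := by
      intro i
      rw [← mul_geom_sum, map_mul]
      refine mul_le_of_le_of_le_one hu1 ?_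
      refine val.map_sum_le fun j _ => ?_
      rw [map_pow]; exact pow_le_one' huv _
    refine ⟨fun i => π⁻¹ * (c i - c i ^ (p ^ (m * k)) * u ^ i), fun i => ?_, fun i hi => ?_, ?_⟩
    · exact X.mul_mem h.inv_mem (X.sub_mem (hc i) (X.mul_mem (X.pow_mem (hc i) _) (X.pow_mem huX _)))
    · have e : c i - c i ^ (p ^ (m * k)) * u ^ i = 
        - ((c i ^ (p ^ (m * k)) - c i) + c i ^ (p ^ (m * k)) * (u ^ i - 1)) := by ring
      beta_reduce
      rw [e, map_mul, Valuation.map_neg, map_inv₀]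
      rw [inv_mul_le_one₀ (by rw [zero_lt_iff]; simpa using h.ne)]
      refine (val.map_add _ _).trans (max_le (h.pr k _ (hc i) (hc1 i hi)) ?_)
      rw [map_mul, map_pow]
      exact (mul_le_of_le_one_left' (pow_le_one' (hc1 i hi) _)).trans (hui i)
    · rw [sum_pow_char_pow, ← Finset.sum_sub_distrib, Finset.mul_sum]
      refine Finset.sum_congr rfl fun i _ => ?_
      rw [mul_pow, pow_right_comm t, hut, mul_pow]
      have := h.ne
      beta_reduce
      field_simp
  have intle : ∀ (n : ℕ) (c : ℕ → L), (∀ i ∈ Finset.range n, val (c i) ≤ 1) → 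
      val (∑ i ∈ Finset.range n, c i * t ^ i) ≤ 1 := by
    intro n c hc
    refine val.map_sum_le fun i hi => ?_
    rw [map_mul, map_pow]
    exact mul_le_one' (hc i hi) (pow_le_one' ht _)
  have hπ0 : 0 < val π := by rw [zero_lt_iff]; simpa using h.ne
  -- division
  have divs : ∀ k A : ℕ, A < p ^ (m * k) → ∀ (n : ℕ) (c : ℕ → L), (∀ i, c i ∈ X) → 
      (∀ i ∈ Finset.range n, val (c i) ≤ 1) → val (∑ i ∈ Finset.range n, c i * t ^ i) ≤ val π ^ A →
      ∃ c' : ℕ → L, (∀ i, c' i ∈ X) ∧ (∀ i ∈ Finset.range n, val (c' i) ≤ 1) ∧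
        val ((∑ i ∈ Finset.range n, c i * t ^ i) - π ^ A * ∑ i ∈ Finset.range n, c' i * t ^ i) 
          ≤ val π ^ (A + 1) := by
    intro k A
    induction A with
    | zero => 
      intro _ n c hc hc1 _
      exact ⟨c, hc, hc1, by simp⟩
    | succ A ih =>
      intro hA n c hc hc1 hv
      obtain ⟨c₁, h1, h2, h3⟩ := step k n c hc hc1
      have hY : val ((∑ i ∈ Finset.range n, c i * t ^ i) ^ (p ^ (m * k))) ≤ val π ^ (A + 1 + 1) := by
        rw [map_pow]
        calc _ ≤ (val π ^ (A + 1)) ^ (p ^ (m * k)) := pow_le_pow_left' hv _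
          _ = val π ^ ((A + 1) * (p ^ (m * k))) := (pow_mul _ _ _).symm
          _ ≤ _ := pow_le_pow_right_of_le_one' hle (by nlinarith)
      obtain ⟨c₂, h4, h5, h6⟩ := ih (by lia) n c₁ h1 h2 (by
        have : val (π * ∑ i ∈ Finset.range n, c₁ i * t ^ i) ≤ val π ^ (A + 1) := by
          rw [← h3]
          exact (val.map_sub _ _).trans (max_le hv (hY.trans
            (pow_le_pow_right_of_le_one' hle (by lia))))
        rw [map_mul, pow_succ'] at this
        exact le_of_mul_le_mul_left this hπ0)
      refine ⟨c₂, h4, h5, ?_⟩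
      have e : (∑ i ∈ Finset.range n, c i * t ^ i) - π ^ (A + 1) * ∑ i ∈ Finset.range n, c₂ i * t ^ i
        = π * ((∑ i ∈ Finset.range n, c₁ i * t ^ i) - π ^ A * ∑ i ∈ Finset.range n, c₂ i * t ^ i) + 
          (∑ i ∈ Finset.range n, c i * t ^ i) ^ (p ^ (m * k)) := by
        rw [mul_sub, ← h3]; ring
      rw [e]
      refine (val.map_add _ _).trans (max_le ?_ hY)
      rw [map_mul, pow_succ' _ (A+1)]
      exact mul_le_mul_right h6 _
  refine ⟨hXX h.pi_mem, hXX h.inv_mem, h.ne, h.lt, ?_, ?_⟩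
  · intro a ha
    obtain ⟨n, c, hc, rfl⟩ := hX' a ha
    obtain ⟨A, hA⟩ := hb n c hc
    refine ⟨A, ?_⟩
    have := intle n (fun i => π ^ A * c i) hA
    simpa [Finset.mul_sum, mul_assoc] using this
  · intro k a ha hv
    refine pr_iter a hv hle ?_ k
    obtain ⟨n, c, hc, rfl⟩ := hX' a ha
    obtain ⟨A, hA⟩ := hb n c hc
    have e1 : ∑ i ∈ Finset.range n, (π ^ A * c i) * t ^ i = π ^ A * ∑ i ∈ Finset.range n, c i * t ^ i := by
      rw [Finset.mul_sum]; simp [mul_assoc]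
    obtain ⟨k', hk'⟩ : ∃ k', A < p ^ (m * k') := by
      refine ⟨A, ?_⟩
      calc A < p ^ A := Nat.lt_pow_self (Fact.out : p.Prime).one_lt
        _ ≤ _ := Nat.pow_le_pow_right (Fact.out : p.Prime).pos (by nlinarith)
    obtain ⟨c', h1, h2, h3⟩ := divs k' A hk' n (fun i => π ^ A * c i) 
      (fun i => X.mul_mem (X.pow_mem h.pi_mem _) (hc i)) hA (by
        rw [e1, map_mul, map_pow]; exact mul_le_of_le_one_right' hv)
    rw [e1, ← mul_sub, map_mul, map_pow, pow_succ] at h3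
    have h4 := le_of_mul_le_mul_left h3 (pow_pos hπ0 A)
    obtain ⟨c'', h5, h6, h7⟩ := step 1 n c' h1 h2
    rw [mul_one] at h7
    have h8 : val ((∑ i ∈ Finset.range n, c' i * t ^ i) - (∑ i ∈ Finset.range n, c' i * t ^ i) ^ (p ^ m)) ≤ val π := by
      rw [h7, map_mul]
      exact mul_le_of_le_one_right' (intle n c'' h6)
    generalize (∑ i ∈ Finset.range n, c' i * t ^ i) = Y' at *
    generalize (∑ i ∈ Finset.range n, c i * t ^ i) = Y at *
    have e2 : Y ^ (p ^ m) - Y = (Y - Y') ^ (p ^ m) - (Y - Y') - (Y' - Y' ^ (p ^ m)) := by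
      rw [sub_pow_char_pow]; ring
    rw [e2]
    refine (val.map_sub _ _).trans (max_le ((val.map_sub _ _).trans (max_le ?_ h4)) h8)
    rw [map_pow]
    exact (pow_le_self (h4.trans hle) (pow_ne_zero _ (Fact.out : p.Prime).ne_zero)).trans h4

end HW

end

section
set_option linter.all false
open Polynomial

namespace HW
variable {p : ℕ} [Fact p.Prime] {F : Type} [Field F]
variable {L : Type} [Field L] [Algebra F L] {Γ : Type} [LinearOrderedCommGroupWithZero Γ]
variable {I : Type} [Fintype I]

def ev (p : ℕ) (b : I → L) (j : ℕ) (a : I → L) : L := ∑ i, a i * b i ^ (p ^ j)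

lemma ev_pow [CharP L p] (b : I → L) (j k : ℕ) (a : I → L) : 
    (ev p b j a) ^ (p ^ k) = ev p b (j + k) (fun i => a i ^ (p ^ k)) := by
  unfold ev
  rw [sum_pow_char_pow]
  refine Finset.sum_congr rfl fun i _ => ?_
  rw [mul_pow, ← pow_mul, pow_add]

lemma pow_per {x : L} {h : ℕ} (hx : x ^ (p ^ h) = x) (k : ℕ) : x ^ (p ^ (h * k)) = x := by
  induction k with
  | zero => simp
  | succ k ih => rw [mul_add, mul_one, pow_add, pow_mul, ih, hx]

lemma pow_mod {x : L} {h : ℕ} (hx : x ^ (p ^ h) = x) {j j' : ℕ} (hj : j ≡ j' [MOD h]) : 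
    x ^ (p ^ j) = x ^ (p ^ j') := by
  have : ∀ j, x ^ (p ^ j) = x ^ (p ^ (j % h)) := by
    intro j
    conv_lhs => rw [← Nat.div_add_mod j h, pow_add, pow_mul, pow_per hx]
  rw [this j, this j', hj]

lemma ev_mod (b : I → L) {h : ℕ} (hb : ∀ i, b i ^ (p ^ h) = b i) {j j' : ℕ} (hj : j ≡ j' [MOD h])
    (a : I → L) : ev p b j a = ev p b j' a := by
  unfold ev
  refine Finset.sum_congr rfl fun i _ => ?_
  rw [pow_mod (hb i) hj]

lemma val_le_one_of_pow {val : Valuation L Γ} {x : L} {n : ℕ} (hn : 1 < n) (hx : x ^ n = x) : val x ≤ 1 := by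
  by_contra hlt
  push Not at hlt
  have h1 : val x ^ n = val x := by rw [← map_pow, hx]
  have h2 : val x ^ 1 < val x ^ n := pow_lt_pow_right₀ hlt hn
  rw [h1, pow_one] at h2
  exact lt_irrefl _ h2

theorem T1 [CharP L p] {val : Valuation L Γ} {π : L} {m h : ℕ} (hm : 0 < m) (hh : 0 < h) {X : Subring L}
    (hX : Nice p val π m X) (b : I → L) (hb : ∀ i, b i ^ (p ^ h) = b i) (J : Set ℕ)
    (hJ : ∀ j ∈ J, ∀ j' ∈ J, ∃ k, j + m * k ≡ j' [MOD h]) (N : ℕ) :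
    ∀ a : I → L, (∀ i, a i ∈ X) → (∀ i, val (a i) ≤ 1) → 
      (∀ j ∈ J, val (ev p b j a) ≤ val π ^ N) ∨ ∃ s : ℕ, ∀ j ∈ J, val (ev p b j a) = val π ^ s := by
  have hp := (Fact.out : p.Prime)
  have hb1 : ∀ i, val (b i) ≤ 1 := fun i => 
    val_le_one_of_pow (Nat.one_lt_pow hh.ne' hp.one_lt) (hb i)
  have hev : ∀ j (a : I → L) (g : Γ), (∀ i, val (a i) ≤ g) → val (ev p b j a) ≤ g := by
    intro j a g ha
    refine val.map_sum_le fun i _ => ?_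
    rw [map_mul, map_pow]
    exact mul_le_of_le_of_le_one (ha i) (pow_le_one' (hb1 i) _)
  have hsub : ∀ j (a a' : I → L), ev p b j a - ev p b j a' = ev p b j (fun i => a i - a' i) := by
    intro j a a'
    simp [ev, sub_mul, Finset.sum_sub_distrib]
  induction N with
  | zero => 
    intro a _ ha
    left; intro j _
    simpa using hev j a 1 ha
  | succ N ih =>
    intro a haX ha
    by_cases hex : ∃ j ∈ J, val (ev p b j a) = 1
    · obtain ⟨j, hj, hj1⟩ := hex
      right
      refine ⟨0, fun j' hj' => ?_⟩
      obtain ⟨k, hk⟩ := hJ j hj j' hj'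
      have h1 : val (ev p b j' (fun i => a i ^ (p ^ (m * k)))) = 1 := by
        rw [← ev_mod b hb hk, ← ev_pow, map_pow, hj1, one_pow]
      have h2 : val (ev p b j' (fun i => a i ^ (p ^ (m * k))) - ev p b j' a) < 1 := by
        rw [hsub]
        exact (hev _ _ (val π) fun i => hX.pr k _ (haX i) (ha i)).trans_lt hX.lt
      have h3 := val.map_sub_eq_of_lt_right (x := ev p b j' (fun i => a i ^ (p ^ (m * k))) - ev p b j' a)
         (y := ev p b j' (fun i => a i ^ (p ^ (m * k)))) (by rw [h1]; exact h2) 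
      rw [sub_sub_cancel_left, Valuation.map_neg, h1] at h3
      simpa using h3
    · push Not at hex
      have hlt : ∀ j ∈ J, val (ev p b j a) < 1 := fun j hj => lt_of_le_of_ne (hev j a 1 ha) (hex j hj)
      obtain ⟨a₁, ha₁⟩ : ∃ a₁ : I → L, a₁ = fun i => π⁻¹ * (a i - a i ^ (p ^ (m * h))) := ⟨_, rfl⟩
      have hkey : ∀ j ∈ J, val (ev p b j a) = val π * val (ev p b j a₁) := by
        intro j hj
        have e : ev p b j a * (1 - ev p b j a ^ (p ^ (m * h) - 1)) = π * ev p b j a₁ := by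
          have e1 : ev p b j a ^ (p ^ (m * h)) = ev p b j (fun i => a i ^ (p ^ (m * h))) := by
            rw [ev_pow]
            exact ev_mod b hb (by simp [Nat.ModEq]) _
          have e2 : ev p b j a ^ (p ^ (m * h)) = ev p b j a * ev p b j a ^ (p ^ (m * h) - 1) := by
            rw [← pow_succ', Nat.sub_add_cancel (Nat.one_le_pow _ _ hp.pos)]
          rw [mul_sub, ← e2, mul_one, e1, hsub, ha₁]
          simp only [ev, Finset.mul_sum]
          refine Finset.sum_congr rfl fun i _ => ?_
          have := hX.ne
          field_simp
        rw [← map_mul, ← e, map_mul, val_one_sub, mul_one]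
        rw [map_pow]
        refine pow_lt_one₀ zero_le' (hlt j hj) ?_
        have : 1 < p ^ (m * h) := Nat.one_lt_pow (by positivity) hp.one_lt
        lia
      have hπ0 : 0 < val π := by rw [zero_lt_iff]; simpa using hX.ne
      rcases ih a₁ (fun i => by
          rw [ha₁]; exact X.mul_mem hX.inv_mem (X.sub_mem (haX i) (X.pow_mem (haX i) _))) (fun i => by
          rw [ha₁]; beta_reduce
          rw [map_mul, map_inv₀, inv_mul_le_one₀ hπ0, val.map_sub_swap]
          exact hX.pr h _ (haX i) (ha i)) with h1 | ⟨s, hs⟩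
      · left
        intro j hj
        rw [hkey j hj, pow_succ']
        exact mul_le_mul_right (h1 j hj) _
      · right
        refine ⟨s + 1, fun j hj => ?_⟩
        rw [hkey j hj, hs j hj, pow_succ']

lemma Fr.nice [CharP L p] {w : FFPrime F} {val : Valuation L Γ} {π : F} (h : Fr w val π) {m : ℕ}
    (hf : ∀ a ∈ w.V, 0 < w.ord (a ^ (p ^ m) - a)) : 
    Nice p val (algebraMap F L π) m (algebraMap F L).range := by
  have hπ0 : 0 < val (algebraMap F L π) := by rw [zero_lt_iff]; simpa using h.ne
  refine ⟨⟨π, rfl⟩, ⟨π⁻¹, by simp⟩, by simpa using h.ne, h.lt, ?_, ?_⟩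
  · rintro _ ⟨a, rfl⟩
    by_cases ha : a = 0
    · exact ⟨0, by simp [ha]⟩
    refine ⟨(w.z a).natAbs, ?_⟩
    rw [map_mul, map_pow, h.hv a ha, ← zpow_natCast, ← zpow_add₀ hπ0.ne']
    obtain ⟨k, hk⟩ : ∃ k : ℕ, (k : ℤ) = ((w.z a).natAbs : ℤ) + w.z a := ⟨(((w.z a).natAbs : ℤ) + w.z a).toNat, by lia⟩
    rw [← hk, zpow_natCast]
    exact pow_le_one' h.lt.le _
  · rintro k _ ⟨a, rfl⟩ ha
    refine pr_iter _ ha h.lt.le ?_ k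
    by_cases ha0 : a = 0
    · simp [ha0, (Fact.out : p.Prime).ne_zero]
    have hz : 0 ≤ w.z a := by
      by_contra hlt
      push Not at hlt
      rw [h.hv a ha0] at ha
      have : 1 < val (algebraMap F L π) ^ (w.z a) := by
        exact one_lt_zpow_of_neg₀ hπ0 h.lt hlt
      exact not_lt.2 ha this
    have := hf a (w.mem_V'.2 (Or.inr hz))
    rw [w.pos_iff] at this
    rw [← map_pow, ← map_sub]
    rcases this with h0 | h0
    · rw [h0]; simp
    · by_cases h00 : a ^ (p ^ m) - a = 0
      · rw [h00]; simp
      rw [h.hv _ h00]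
      obtain ⟨k, hk⟩ : ∃ k : ℕ, (k : ℤ) = w.z (a ^ (p ^ m) - a) := ⟨(w.z (a ^ (p ^ m) - a)).toNat, by lia⟩
      rw [← hk, zpow_natCast]
      exact pow_le_self h.lt.le (by lia)

end HW

end

section
set_option linter.all false
open Polynomial

namespace HW
variable {p : ℕ} [Fact p.Prime] {F : Type} [Field F]
variable {L : Type} [Field L] [Algebra F L] {Γ : Type} [LinearOrderedCommGroupWithZero Γ]

def adj (X : Subring L) (t : L) : Subring L := (Algebra.adjoin X {t}).toSubring

lemma le_adj (X : Subring L) (t : L) : X ≤ adj X t := 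
  fun x hx => (Algebra.adjoin X {t}).algebraMap_mem ⟨x, hx⟩

lemma self_mem_adj (X : Subring L) (t : L) : t ∈ adj X t := 
  Algebra.subset_adjoin (Set.mem_singleton t)

lemma mem_adj {X : Subring L} {t y : L} (hy : y ∈ adj X t) : 
    ∃ (n : ℕ) (c : ℕ → L), (∀ i, c i ∈ X) ∧ y = ∑ i ∈ Finset.range n, c i * t ^ i := by
  have hy' : y ∈ Algebra.adjoin X {t} := hy
  rw [Algebra.adjoin_singleton_eq_range_aeval] at hy'
  obtain ⟨P, rfl⟩ := hy'
  refine ⟨P.natDegree + 1, fun i => (P.coeff i : L), fun i => (P.coeff i).2, ?_⟩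
  change aeval t P = _
  rw [aeval_eq_sum_range]
  rfl

lemma Nice.adj_const [CharP L p] {val : Valuation L Γ} {π : L} {m : ℕ} (hm : 0 < m) {X : Subring L}
    (h : Nice p val π m X) {t : L} (ht : t ^ (p ^ m) = t) : Nice p val π m (adj X t) := by
  refine h.adjoin hm (le_adj X t) t (val_le_one_of_pow (Nat.one_lt_pow hm.ne' 
    (Fact.out : p.Prime).one_lt) ht) (fun y hy => mem_adj hy) fun k => ⟨1, X.one_mem, by simp, ?_⟩
  rw [pow_per ht, one_mul]

lemma Nice.adj_root [CharP L p] {val : Valuation L Γ} {π : L} {m : ℕ} (hm : 0 < m) {X : Subring L}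
    (h : Nice p val π m X) {t : L} {d : ℕ} (hd : d ∣ p ^ m - 1) (htX : t ^ d ∈ X) 
    (ht : val (t ^ d - 1) ≤ val π) : Nice p val π m (adj X t) := by
  have hp := (Fact.out : p.Prime)
  have hd0 : d ≠ 0 := by
    rintro rfl
    have := Nat.one_lt_pow hm.ne' hp.one_lt
    rw [zero_dvd_iff] at hd
    lia
  have hv1 : val (t ^ d) ≤ 1 := by
    have : t ^ d = (t ^ d - 1) + 1 := by ring
    rw [this]
    exact (val.map_add _ _).trans (max_le (ht.trans h.lt.le) (by simp))
  have hv : val t ≤ 1 := by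
    rw [map_pow] at hv1
    exact (pow_le_one_iff hd0).1 hv1
  refine h.adjoin hm (le_adj X t) t hv (fun y hy => mem_adj hy) fun k => ?_
  have hdk : d ∣ p ^ (m * k) - 1 := hd.trans (by
    rw [pow_mul]; simpa using Nat.sub_dvd_pow_sub_pow (p ^ m) 1 k)
  obtain ⟨r, hr⟩ := hdk
  refine ⟨(t ^ d) ^ r, X.pow_mem htX _, ?_, ?_⟩
  · rw [← mul_geom_sum, map_mul]
    refine mul_le_of_le_of_le_one ht ?_
    refine val.map_sum_le fun j _ => ?_
    rw [map_pow]; exact pow_le_one' hv1 _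
  · rw [← pow_mul, ← pow_succ, ← hr, Nat.sub_add_cancel (Nat.one_le_pow _ _ hp.pos)]

/-- The valuation of a norm. -/
theorem norm_val [CharP L p] {I : Type} [Fintype I] {w : FFPrime F} {val : Valuation L Γ} {π : F} (h : Fr w val π) 
    {m hh : ℕ} (hm : 0 < m) (hh0 : 0 < hh) {X : Subring L} (hX : Nice p val (algebraMap F L π) m X)
    (b : I → L) (hb : ∀ i, b i ^ (p ^ hh) = b i) {d n₁ : ℕ} (hd : 0 < d)
    (hJ : ∀ i < d, ∀ i' < d, ∃ k, n₁ * i + m * k ≡ n₁ * i' [MOD hh])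
    (a : I → L) (ha : ∀ i, a i ∈ X) (c : F) (hc : c ≠ 0) 
    (hprod : ∏ i ∈ Finset.range d, ev p b (n₁ * i) a = algebraMap F L c) : (d : ℤ) ∣ w.z c := by
  have hπ0 : 0 < val (algebraMap F L π) := by rw [zero_lt_iff]; simpa using h.ne
  classical
  choose A' hA' using fun i => hX.bdd (a i) (ha i)
  obtain ⟨A, hA⟩ : ∃ A : ℕ, ∀ i, val (algebraMap F L π ^ A * a i) ≤ 1 := by
    refine ⟨∑ i, A' i, fun i => ?_⟩
    rw [← Finset.add_sum_erase _ _ (Finset.mem_univ i), pow_add, mul_right_comm, map_mul]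
    refine mul_le_one' (hA' i) ?_
    rw [map_pow]; exact pow_le_one' h.lt.le _
  have hev : ∀ j, ev p b j (fun i => algebraMap F L π ^ A * a i) = algebraMap F L π ^ A * ev p b j a := by
    intro j; simp [ev, Finset.mul_sum, mul_assoc]
  have hpv : ∏ i ∈ Finset.range d, val (ev p b (n₁ * i) (fun i => algebraMap F L π ^ A * a i)) 
      = val (algebraMap F L π) ^ ((A * d : ℕ) + w.z c : ℤ) := by
    simp only [hev]
    rw [← map_prod, Finset.prod_mul_distrib, hprod, map_mul, h.hv c hc, zpow_add₀ hπ0.ne', zpow_natCast]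
    simp [pow_mul]
  obtain ⟨N, hN⟩ : ∃ N : ℕ, (A * d : ℕ) + w.z c < N := ⟨((A * d : ℕ) + w.z c + 1).toNat, by lia⟩
  rcases T1 hm hh0 hX b hb {j | ∃ i < d, j = n₁ * i} (by
      rintro _ ⟨i, hi, rfl⟩ _ ⟨i', hi', rfl⟩
      exact hJ i hi i' hi') N (fun i => algebraMap F L π ^ A * a i)
      (fun i => X.mul_mem (X.pow_mem hX.pi_mem _) (ha i)) hA with h1 | ⟨s, hs⟩
  · exfalso
    have h2 : val (algebraMap F L π) ^ ((A * d : ℕ) + w.z c : ℤ) ≤ val (algebraMap F L π) ^ (N : ℤ) := by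
      rw [← hpv, zpow_natCast]
      calc _ ≤ ∏ i ∈ Finset.range d, val (algebraMap F L π) ^ N := 
            Finset.prod_le_prod' fun i hi => h1 _ ⟨i, Finset.mem_range.1 hi, rfl⟩
        _ = (val (algebraMap F L π) ^ N) ^ d := by simp
        _ ≤ _ := pow_le_self (pow_le_one' h.lt.le _) hd.ne'
    have h3 := (zpow_lt_zpow_iff_right_of_lt_one₀ hπ0 h.lt).2 hN
    exact absurd h2 (not_le.2 h3)
  · rw [Finset.prod_congr rfl (fun i hi => hs _ ⟨i, Finset.mem_range.1 hi, rfl⟩)] at hpv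
    rw [Finset.prod_const, Finset.card_range, ← pow_mul, ← zpow_natCast] at hpv
    have h3 := zpow_right_injective₀ hπ0 h.lt.ne hpv
    refine ⟨s - A, ?_⟩
    push_cast at h3
    linarith

end HW

end

section
set_option linter.all false
open Polynomial

namespace HW
variable {p : ℕ} [Fact p.Prime] {F : Type} [Field F]
variable {L : Type} [Field L] [Algebra F L] {Γ : Type} [LinearOrderedCommGroupWithZero Γ]

lemma frob_residue (w : FFPrime F) [Finite (IsLocalRing.ResidueField w.V)] {f m : ℕ} 
    (hf : Nat.card (IsLocalRing.ResidueField w.V) = p ^ f) (hfm : f ∣ m) : 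
    ∀ a ∈ w.V, 0 < w.ord (a ^ (p ^ m) - a) := by
  intro a ha
  obtain ⟨k, rfl⟩ := hfm
  have := Fintype.ofFinite (IsLocalRing.ResidueField w.V)
  have hmem : a ^ (p ^ (f * k)) - a ∈ w.V := w.V.sub_mem (w.V.pow_mem ha _) ha
  rw [← residue_eq_zero w hmem]
  have e : (⟨a ^ (p ^ (f * k)) - a, hmem⟩ : w.V) = ⟨a, ha⟩ ^ (p ^ (f * k)) - ⟨a, ha⟩ := rfl
  rw [e, map_sub, map_pow, sub_eq_zero]
  generalize IsLocalRing.residue w.V ⟨a, ha⟩ = x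
  rw [pow_mul, ← hf, Nat.card_eq_fintype_card]
  exact FiniteField.pow_card_pow k x

/-- The solution set in an auxiliary field. -/
def Sol (p d n₁ : ℕ) (κ : Type) [Field κ] [Fintype κ] (R L : Type) [Field R] [Field L] [Algebra R L] (T c : R) : Prop :=
  ∃ (z z₂ : L) (ι : κ →+* L) (y : Fin d → Fin d → κ → R), 
    algebraMap R L c * z ^ d = algebraMap R L (c + 1) ∧
    algebraMap R L T * z₂ ^ d = algebraMap R L (T + 1) ∧
    ∏ i ∈ Finset.range d, (∑ l : κ, ∑ a : Fin d, ∑ b : Fin d, 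
      algebraMap R L (y a b l) * z ^ (a : ℕ) * z₂ ^ (b : ℕ) * (ι l) ^ (p ^ (n₁ * i))) = algebraMap R L c

lemma exists_shift {m n₁ d : ℕ} (hn : 0 < n₁) (hd : 0 < d) (hm : n₁ ∣ m) (hcop : Nat.Coprime (m / n₁) d) (i i' : ℕ) :
    ∃ k, n₁ * i + m * k ≡ n₁ * i' [MOD (n₁ * d)] := by
  obtain ⟨r, rfl⟩ := hm
  rw [Nat.mul_div_cancel_left _ hn] at hcop
  obtain ⟨k, hk⟩ := Nat.exists_mul_mod_eq_of_coprime (i' + (d - 1) * i) hcop hd.ne'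
  refine ⟨k, ?_⟩
  rw [mul_assoc, ← mul_add]
  refine Nat.ModEq.mul_left' n₁ ?_
  have h1 : i + r * k ≡ i + (i' + (d - 1) * i) [MOD d] := Nat.ModEq.add_left i (by
    exact hk.2)
  refine h1.trans ?_
  obtain ⟨e, rfl⟩ : ∃ e, d = e + 1 := ⟨d - 1, by lia⟩
  have : i + (i' + (e + 1 - 1) * i) = i' + (e + 1) * i := by
    rw [Nat.add_sub_cancel]; ring
  rw [this]
  simp [Nat.ModEq]

lemma root_val {w : FFPrime F} {val : Valuation L Γ} {π : F} (h : Fr w val π) {T : F} (hT : w.z T < 0)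
    (hT0 : T ≠ 0) {z : L} {d : ℕ} (hz : algebraMap F L T * z ^ d = algebraMap F L (T + 1)) : 
    z ^ d = algebraMap F L (1 + T⁻¹) ∧ val (z ^ d - 1) ≤ val (algebraMap F L π) := by
  have hT1 : algebraMap F L T ≠ 0 := by simpa using hT0
  have e : z ^ d = algebraMap F L (1 + T⁻¹) := by
    apply mul_left_cancel₀ hT1
    rw [hz, ← map_mul]; congr 1; field_simp
  refine ⟨e, ?_⟩
  have e2 : z ^ d - 1 = algebraMap F L T⁻¹ := by rw [e]; simp
  rw [e2, h.hv _ (inv_ne_zero hT0), w.z_inv hT0]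
  obtain ⟨k, hk⟩ : ∃ k : ℕ, (k : ℤ) = - w.z T := ⟨(- w.z T).toNat, by lia⟩
  rw [← hk, zpow_natCast]
  exact pow_le_self h.lt.le (by lia)

/-- `(⇐)`, local part. -/
theorem sol_dvd [CharP L p] {κ : Type} [Field κ] [Fintype κ] {d n₁ f : ℕ} {T c : F} (hS : Sol p d n₁ κ F L T c)
    (hκ : Fintype.card κ = p ^ (n₁ * d)) (hd : 0 < d) (hn : 0 < n₁) (hdn : d ∣ p ^ n₁ - 1)
    (w : FFPrime F) [Finite (IsLocalRing.ResidueField w.V)] (hf0 : 0 < f)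
    (hf : Nat.card (IsLocalRing.ResidueField w.V) = p ^ f) 
    (V : ValuationSubring L) (hV : ∀ a : F, a ∈ w.V ↔ algebraMap F L a ∈ V)
    (hcop : Nat.Coprime (Nat.lcm f n₁ / n₁) d) (hT0 : T ≠ 0) (hT : w.z T < 0) (hc0 : c ≠ 0) (hc : w.z c < 0) :
    (d : ℤ) ∣ w.z c := by
  obtain ⟨z, z₂, ι, y, hz, hz₂, hp⟩ := hS
  obtain ⟨π, hπ⟩ := exists_Fr w V hV
  have hm : 0 < Nat.lcm f n₁ := Nat.lcm_pos hf0 hn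
  have hdm : d ∣ p ^ (Nat.lcm f n₁) - 1 := hdn.trans (by
    obtain ⟨k, hk⟩ := Nat.dvd_lcm_right f n₁
    rw [hk, pow_mul]; simpa using Nat.sub_dvd_pow_sub_pow (p ^ n₁) 1 k)
  have hX0 := hπ.nice (p := p) (m := Nat.lcm f n₁) (frob_residue w hf (Nat.dvd_lcm_left _ _))
  obtain ⟨e1, v1⟩ := root_val hπ hc hc0 hz
  obtain ⟨e2, v2⟩ := root_val hπ hT hT0 hz₂
  have hX1 := hX0.adj_root hm hdm (t := z) (by rw [e1]; exact ⟨_, rfl⟩) v1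
  have hX2 := hX1.adj_root hm hdm (t := z₂) (by rw [e2]; exact le_adj _ _ ⟨_, rfl⟩) v2
  refine norm_val hπ hm (hh := n₁ * d) (by positivity) hX2 (fun l => ι l) (fun l => by
    rw [← map_pow, ← hκ, FiniteField.pow_card]) hd 
    (fun i _ i' _ => exists_shift hn hd (Nat.dvd_lcm_right _ _) hcop i i')
    (fun l => ∑ a : Fin d, ∑ b : Fin d, algebraMap F L (y a b l) * z ^ (a : ℕ) * z₂ ^ (b : ℕ)) ?_ c hc0 ?_
  · intro l
    refine Subring.sum_mem _ fun a _ => Subring.sum_mem _ fun b _ => ?_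
    refine Subring.mul_mem _ (le_adj _ _ (Subring.mul_mem _ (le_adj _ _ ⟨_, rfl⟩) 
      (Subring.pow_mem _ (self_mem_adj _ _) _))) (Subring.pow_mem _ (self_mem_adj _ _) _)
  · rw [← hp]
    refine Finset.prod_congr rfl fun i _ => ?_
    simp only [ev, Finset.sum_mul]

end HW

end

section
set_option linter.all false
open Polynomial

namespace HW
variable {p : ℕ} [Fact p.Prime] 

lemma exists_gen (k : Type) [Field k] [Finite k] : ∃ g : k, g ≠ 0 ∧ (∀ x : k, x = 0 ∨ ∃ i : ℕ, x = g ^ i) ∧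
    (∀ a b : ℕ, g ^ a = g ^ b → a ≡ b [MOD (Nat.card k - 1)]) := by
  have := Fintype.ofFinite k
  obtain ⟨g, hg⟩ := IsCyclic.exists_generator (α := kˣ)
  have ho : orderOf g = Nat.card k - 1 := by
    rw [orderOf_eq_card_of_forall_mem_zpowers hg, Nat.card_units]
  refine ⟨g, g.ne_zero, fun x => ?_, fun a b hab => ?_⟩
  · by_cases hx : x = 0
    · exact Or.inl hx
    right
    obtain ⟨i, hi⟩ := (Submonoid.mem_powers_iff _ _).1 ((mem_powers_iff_mem_zpowers).2 (hg (Units.mk0 x hx)))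
    refine ⟨i, ?_⟩
    rw [← Units.val_pow_eq_pow_val, hi]; rfl
  · rw [← ho]
    apply pow_eq_pow_iff_modEq.1
    ext; simpa using hab

lemma pow_sub_one_dvd {a b : ℕ} (hp : 1 < p) (h : p ^ a - 1 ∣ p ^ b - 1) (ha : 0 < a) : a ∣ b := by
  have h1 := Nat.pow_sub_one_gcd_pow_sub_one p a b
  rw [Nat.gcd_eq_left h] at h1
  have h2 : 1 ≤ p ^ a := Nat.one_le_pow _ _ (by lia)
  have h3 : 1 ≤ p ^ (Nat.gcd a b) := Nat.one_le_pow _ _ (by lia)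
  have h4 : p ^ a = p ^ (Nat.gcd a b) := by lia
  have h5 := Nat.pow_right_injective hp h4
  exact Nat.gcd_eq_left_iff_dvd.1 h5.symm

lemma dvd_of_frob (k : Type) [Field k] [Finite k] {s m : ℕ} (hs : 0 < s) (hk : Nat.card k = p ^ s) 
    (h : ∀ x : k, x ^ (p ^ m) = x) : s ∣ m := by
  obtain ⟨g, g0, -, hg⟩ := exists_gen k
  have h1 := hg (p ^ m) 1 (by rw [h g, pow_one])
  have hp := (Fact.out : p.Prime)
  refine pow_sub_one_dvd hp.one_lt ?_ hs
  rw [hk] at h1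
  exact (Nat.modEq_iff_dvd' (Nat.one_le_pow _ _ hp.pos)).1 h1.symm

lemma dvd_of_hom (k k' : Type) [CommRing k] [IsDomain k] [Finite k] [Field k'] [Finite k'] {s m : ℕ} (hs : 0 < s) 
    (hk : Nat.card k = p ^ s) (hk' : Nat.card k' = p ^ m) (φ : k →+* k') : s ∣ m := by
  letI : Field k := (Finite.isField_of_domain k).toField
  refine dvd_of_frob k hs hk fun x => ?_
  apply φ.injective
  have := Fintype.ofFinite k'
  rw [map_pow, ← hk', Nat.card_eq_fintype_card, FiniteField.pow_card]

lemma gen_dist (k : Type) [Field k] [Finite k] {n : ℕ} (hn : 2 ≤ n) (hk : Nat.card k = p ^ n) : 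
   ∃ g : k, g ≠ 0 ∧ (∀ x : k, x = 0 ∨ ∃ i : ℕ, x = g ^ i) ∧
    (∀ a b : ℕ, g ^ (p ^ a) = g ^ (p ^ b) → a ≡ b [MOD n]) := by
  obtain ⟨g, g0, h1, h2⟩ := exists_gen k
  have hp := (Fact.out : p.Prime)
  have := Fintype.ofFinite k
  have hgn : g ^ (p ^ n) = g := by rw [← hk, Nat.card_eq_fintype_card, FiniteField.pow_card]
  have key : ∀ a b : ℕ, a < n → b < n → g ^ (p ^ a) = g ^ (p ^ b) → a = b := by
    intro a b ha hb hab
    have h3 := h2 _ _ hab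
    rw [hk] at h3
    have hlt : ∀ a < n, p ^ a < p ^ n - 1 := by
      intro a ha
      have e1 : p ^ a ≤ p ^ (n - 1) := Nat.pow_le_pow_right hp.pos (by lia)
      have e2 : p ^ n = p * p ^ (n - 1) := by rw [← pow_succ']; congr 1; lia
      have e3 : p ≤ p ^ (n - 1) := by simpa using Nat.pow_le_pow_right hp.pos (show 1 ≤ n - 1 by lia)
      have e4 := hp.two_le
      have e5 : 2 * p ^ (n-1) ≤ p * p ^ (n - 1) := Nat.mul_le_mul_right _ e4
      lia
    exact Nat.pow_right_injective hp.two_le (Nat.ModEq.eq_of_lt_of_lt h3 (hlt a ha) (hlt b hb))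
  refine ⟨g, g0, h1, fun a b hab => ?_⟩
  refine key (a % n) (b % n) (Nat.mod_lt _ (by lia)) (Nat.mod_lt _ (by lia)) ?_
  rw [pow_mod hgn (Nat.mod_modEq a n), pow_mod hgn (Nat.mod_modEq b n), hab]

lemma prod_reindex {M : Type} [CommMonoid M] {d r : ℕ} (hd : 0 < d) (hr : Nat.Coprime r d) (g : ℕ → M) 
    (hg : ∀ i, g (i % d) = g i) : 
    ∏ i ∈ Finset.range d, g (r * i) = ∏ i ∈ Finset.range d, g i := by
  have hinj : Set.InjOn (fun i => (r * i) % d) (Finset.range d : Set ℕ) := by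
    intro i hi j hj hij
    have hi' := Finset.mem_range.1 hi
    have hj' := Finset.mem_range.1 hj
    have : r * i ≡ r * j [MOD d] := hij
    exact Nat.ModEq.eq_of_lt_of_lt (Nat.ModEq.cancel_left_of_coprime (by rwa [Nat.gcd_comm]) this) hi' hj'
  have himg : (Finset.range d).image (fun i => (r * i) % d) = Finset.range d := by
    apply Finset.eq_of_subset_of_card_le
    · intro j hj
      obtain ⟨i, _, rfl⟩ := Finset.mem_image.1 hj
      exact Finset.mem_range.2 (Nat.mod_lt _ hd)
    · rw [Finset.card_image_of_injOn hinj]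
  conv_rhs => rw [← himg, Finset.prod_image hinj]
  exact Finset.prod_congr rfl fun i _ => (hg _).symm

end HW

end

section
set_option linter.all false
open Polynomial

namespace HW
variable {F : Type} [Field F] (w : FFPrime F)

lemma z_add_of_lt {x y : F} (hx : x ≠ 0) (h : y = 0 ∨ w.z x < w.z y) : x + y ≠ 0 ∧ w.z (x + y) = w.z x := by
  rcases h with rfl | h
  · simpa using hx
  by_cases hy : y = 0
  · simpa [hy] using hx
  have hxy : x + y ≠ 0 := by
    intro h0
    have : y = -x := by linear_combination h0
    rw [this, w.z_neg] at h
    lia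
  refine ⟨hxy, ?_⟩
  have h1 := w.z_add hx hy hxy
  have h2 := w.z_add hxy (neg_ne_zero.2 hy) (by simpa using hx)
  rw [w.z_neg] at h2
  simp only [add_neg_cancel_right] at h2
  rcases min_le_iff.1 h1 with h3 | h3 <;> rcases min_le_iff.1 h2 with h4 | h4 <;> lia

lemma dvd_of_root {c z : F} {d : ℕ} (hc : c ≠ 0) (hz : c * z ^ d = c + 1) (h : 0 < w.z c) : (d : ℤ) ∣ w.z c := by
  have h1 := z_add_of_lt w (x := 1) (y := c) one_ne_zero (Or.inr (by rw [w.z_one]; exact h))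
  rw [add_comm, w.z_one, ← hz] at h1
  have hz0 : z ^ d ≠ 0 := right_ne_zero_of_mul h1.1
  rw [w.z_mul hc hz0] at h1
  by_cases hd : d = 0
  · subst hd; rw [pow_zero, w.z_one] at h1; lia
  have hz1 : z ≠ 0 := by rintro rfl; exact hz0 (zero_pow hd)
  rw [w.z_pow hz1] at h1
  exact ⟨- w.z z, by linarith [h1.2]⟩

lemma cval_neg {T x : F} {d M : ℕ} (hd : 2 ≤ d) (hT0 : T ≠ 0) (hT : w.z T < 0) (hx : x ∈ w.V) :
    T * x ^ (M * d) + T ^ d ≠ 0 ∧ w.z (T * x ^ (M * d) + T ^ d) = d * w.z T := by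
  have h := z_add_of_lt w (x := T ^ d) (y := T * x ^ (M * d)) (pow_ne_zero _ hT0) (by
    by_cases hx0 : x ^ (M * d) = 0
    · left; simp [hx0]
    right
    have h1 := w.z_nonneg_of_mem (w.V.pow_mem hx (M * d))
    rw [w.z_pow hT0, w.z_mul hT0 hx0]
    have : (2 : ℤ) ≤ d := by exact_mod_cast hd
    nlinarith)
  rw [add_comm, w.z_pow hT0] at h
  exact h

lemma cval_pole {T x : F} {d M : ℕ} (hd : 0 < d) (hT0 : T ≠ 0) (hx0 : x ≠ 0) 
    (h : w.z T + M * d * w.z x < d * w.z T) : 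
    T * x ^ (M * d) + T ^ d ≠ 0 ∧ w.z (T * x ^ (M * d) + T ^ d) = w.z T + M * d * w.z x := by
  have h1 : w.z (T * x ^ (M * d)) = w.z T + M * d * w.z x := by
    rw [w.z_mul hT0 (pow_ne_zero _ hx0), w.z_pow hx0]; push_cast; ring
  have h := z_add_of_lt w (x := T * x ^ (M * d)) (y := T ^ d) (mul_ne_zero hT0 (pow_ne_zero _ hx0)) (by
    right; rw [w.z_pow hT0, h1]; exact h)
  rwa [h1] at h

lemma dvd_c {T x c z z₂ : F} {d M : ℕ} (hd : 2 ≤ d) (hM : 0 < M) (hT0 : T ≠ 0) (hc : c = T * x ^ (M * d) + T ^ d)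
    (hc0 : c ≠ 0) (hz : c * z ^ d = c + 1) (hz₂ : T * z₂ ^ d = T + 1) (hx : w.z T < 0 → x ∈ w.V) : 
    (d : ℤ) ∣ w.z c := by
  rcases lt_or_ge (w.z T) 0 with hT | hT
  · rw [hc, (cval_neg w hd hT0 hT (hx hT)).2]
    exact dvd_mul_right _ _
  · have hdT : (d : ℤ) ∣ w.z T := by
      rcases hT.eq_or_lt with h0 | h0
      · rw [← h0]; exact dvd_zero _
      · exact dvd_of_root w hT0 hz₂ h0
    rcases lt_trichotomy (w.z c) 0 with h | h | h
    · have hx0 : x ≠ 0 := by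
        rintro rfl
        rw [zero_pow (by positivity), mul_zero, zero_add] at hc
        rw [hc, w.z_pow hT0] at h
        have : 0 ≤ (d : ℤ) * w.z T := by positivity
        lia
      have hlt : w.z T + M * d * w.z x < d * w.z T := by
        by_contra hge
        push Not at hge
        have h1 : w.z (T * x ^ (M * d)) = w.z T + M * d * w.z x := by
          rw [w.z_mul hT0 (pow_ne_zero _ hx0), w.z_pow hx0]; push_cast; ring
        have h2 := w.z_add (x := T * x ^ (M * d)) (y := T ^ d) (mul_ne_zero hT0 (pow_ne_zero _ hx0))
          (pow_ne_zero _ hT0) (by rw [← hc]; exact hc0)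
        rw [h1, ← hc, w.z_pow hT0] at h2
        have : 0 ≤ (d : ℤ) * w.z T := by positivity
        rcases min_le_iff.1 h2 with h3 | h3 <;> lia
      rw [hc, (cval_pole w (by lia) hT0 hx0 hlt).2]
      exact dvd_add hdT ⟨M * w.z x, by ring⟩
    · rw [h]; exact dvd_zero _
    · exact dvd_of_root w hc0 hz h

end HW

end

section
set_option linter.all false
open Polynomial

namespace HW
variable {p : ℕ} [Fact p.Prime] {F : Type} [Field F] [Algebra (ZMod p) F]
variable {E : Type} [Field E] [Algebra (ZMod p) E] [Algebra F E]
variable {κ₁ κ : Type} [Field κ₁] [Field κ] [Finite κ] [Algebra κ₁ κ]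

theorem exists_cyc (hF : GFF p F) (R : FFPrime F) {d n₁ κ₀ κ' : ℕ} (hd : 2 ≤ d) (hn : 0 < n₁)
    (hκ : Nat.card κ = p ^ (n₁ * d)) (hfr : Module.finrank κ₁ κ = d) 
    (hQ : Nat.card (integralClosure (ZMod p) F) = p ^ κ₀) (hκ₀ : κ₀ = n₁ * κ') (hcop : Nat.Coprime κ' d)
    (ι : κ →+* E) (φ₁ : κ₁ →+* F) (hφ : ∀ c, algebraMap F E (φ₁ c) = ι (algebraMap κ₁ κ c)) 
    (g : κ) (hg : ∀ a b : ℕ, g ^ (p ^ a) = g ^ (p ^ b) → a ≡ b [MOD (n₁ * d)])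
    (htop : Algebra.adjoin F {ι g} = ⊤) :
    ∃ σ : E ≃ₐ[F] E, CycF p σ (ι g) d (p ^ κ₀) := by
  have hp := (Fact.out : p.Prime)
  have := zmod_tower (p := p) (A := F) (B := E)
  have := Fintype.ofFinite κ
  have hgn : g ^ (p ^ (n₁ * d)) = g := by rw [← hκ, Nat.card_eq_fintype_card, FiniteField.pow_card]
  obtain ⟨θ, hθ⟩ : ∃ θ, θ = ι g := ⟨_, rfl⟩
  rw [← hθ] at htop ⊢
  have hθn : θ ^ (p ^ (n₁ * d)) = θ := by rw [hθ, ← map_pow, hgn]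
  have hN : 1 < p ^ (n₁ * d) := Nat.one_lt_pow (by positivity) hp.one_lt
  have hmon : (X ^ (p ^ (n₁ * d)) - X : (ZMod p)[X]).Monic := by
    apply monic_X_pow_sub
    rw [degree_X]; exact_mod_cast hN
  have hintp : IsIntegral (ZMod p) θ := ⟨_, hmon, by simp [hθn]⟩
  have hintg : IsIntegral F θ := hintp.tower_top
  -- degree bound
  have : FiniteDimensional κ₁ κ := FiniteDimensional.of_finrank_pos (by lia)
  have hgint : IsIntegral κ₁ g := IsIntegral.of_finite κ₁ g
  have hdeg : (minpoly F θ).natDegree ≤ d := by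
    have h1 : ((minpoly κ₁ g).map φ₁).Monic := (minpoly.monic hgint).map _
    have h2 : aeval θ ((minpoly κ₁ g).map φ₁) = 0 := by
      have e : (algebraMap F E).comp φ₁ = ι.comp (algebraMap κ₁ κ) := RingHom.ext hφ
      rw [aeval_def, eval₂_map, e, hθ, ← hom_eval₂, ← aeval_def, minpoly.aeval, map_zero]
    have h3 := natDegree_le_of_dvd (minpoly.dvd F θ h2) h1.ne_zero
    rw [natDegree_map_eq_of_injective φ₁.injective] at h3
    exact h3.trans ((minpoly.natDegree_le g).trans hfr.le)
  -- conjugate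
  have hcoef : ∀ i, IsIntegral (ZMod p) ((minpoly F θ).coeff i) := fun i =>
    isIntegral_coeff_of_dvd (X ^ (p ^ (n₁ * d)) - X) _ hmon (minpoly.monic hintg)
      (minpoly.dvd F θ (by simp [hθn])) i
  have : CharP F p := hF.charP
  have : CharP E p := (RingHom.charP_iff (algebraMap F E) (algebraMap F E).injective p).1 inferInstance
  have hroot : aeval (θ ^ (p ^ κ₀)) (minpoly F θ) = 0 := by
    have h0 := minpoly.aeval F θ
    rw [aeval_eq_sum_range] at h0 ⊢
    have h1 := congrArg (· ^ (p ^ κ₀)) h0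
    beta_reduce at h1
    rw [sum_pow_char_pow, zero_pow (pow_ne_zero _ hp.ne_zero)] at h1
    rw [← h1]
    refine Finset.sum_congr rfl fun i _ => ?_
    rw [Algebra.smul_def, Algebra.smul_def, mul_pow, ← map_pow, ← hQ, const_pow_card hF R (hcoef i), 
      pow_right_comm]
  let pb := PowerBasis.ofAdjoinEqTop hintg htop
  have hpg : pb.gen = θ := PowerBasis.ofAdjoinEqTop_gen hintg htop
  have hpd : pb.dim = (minpoly F θ).natDegree := PowerBasis.ofAdjoinEqTop_dim hintg htop
  have hfin : FiniteDimensional F E := pb.finite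
  let τ : E →ₐ[F] E := pb.lift (θ ^ (p ^ κ₀)) (by rw [hpg]; exact hroot)
  have hτ : τ θ = θ ^ (p ^ κ₀) := by
    have : τ pb.gen = θ ^ (p ^ κ₀) := pb.lift_gen (θ ^ (p ^ κ₀)) (by rw [hpg]; exact hroot)
    rwa [hpg] at this
  have hbij : Function.Bijective τ := Algebra.IsAlgebraic.algHom_bijective τ
  refine ⟨AlgEquiv.ofBijective τ hbij, ?_, ?_, ?_, ?_, by lia, hintp, hQ.symm⟩
  · intro y
    have hy := pb.basis.sum_repr y
    obtain ⟨c, hc⟩ : ∃ c : ℕ → F, ∀ i : Fin pb.dim, c i = pb.basis.repr y i := 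
      ⟨fun i => if h : i < pb.dim then pb.basis.repr y ⟨i, h⟩ else 0, fun i => by simp⟩
    refine ⟨fun i => if (i : ℕ) < pb.dim then c i else 0, ?_⟩
    rw [Fin.sum_univ_eq_sum_range (fun i => algebraMap F E (if i < pb.dim then c i else 0) * θ ^ i) d]
    have hle : pb.dim ≤ d := by rw [hpd]; exact hdeg
    rw [← Finset.sum_subset (Finset.range_subset_range.2 hle) (by
      intro i _ hi
      rw [if_neg (by simpa using hi)]; simp)]
    rw [← hy, Finset.sum_range]
    refine Finset.sum_congr rfl fun i _ => ?_
    rw [if_pos i.2, hc, pb.basis_eq_pow, hpg, Algebra.smul_def]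
  · exact hτ
  · rw [← pow_mul]
    have := pow_mod hθn (j := κ₀ * d) (j' := 0) (by
      rw [hκ₀, Nat.modEq_zero_iff_dvd]; exact ⟨κ', by ring⟩)
    rw [this]; simp
  · intro i hi j hj hij
    rw [← pow_mul, ← pow_mul, hθ, ← map_pow, ← map_pow] at hij
    have h1 := hg _ _ (ι.injective hij)
    rw [hκ₀, mul_assoc, mul_assoc] at h1
    have h2 := Nat.ModEq.mul_left_cancel' hn.ne' h1
    exact Nat.ModEq.eq_of_lt_of_lt (Nat.ModEq.cancel_left_of_coprime (by rwa [Nat.gcd_comm]) h2) hi hj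

end HW

end

section
set_option linter.all false
open Polynomial

namespace HW
variable {p : ℕ} [Fact p.Prime] {F : Type} [Field F] 
variable {E : Type} [Field E] [Algebra (ZMod p) E] [Algebra F E]
variable {κ₁ : Type} [Field κ₁] [Finite κ₁] 

theorem residue_info (hE : GFF p E) (w : FFPrime F) [Finite (IsLocalRing.ResidueField w.V)]
    (R : FFPrime E) (hV : ∀ a : F, a ∈ w.V ↔ algebraMap F E a ∈ R.V) {d n₁ f : ℕ} (hd : 2 ≤ d) (hn : 0 < n₁)
    (hdn : d ∣ p ^ n₁ - 1) (hf0 : 0 < f) (hf : Nat.card (IsLocalRing.ResidueField w.V) = p ^ f) 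
    (hκ : Nat.card κ₁ = p ^ n₁) (hcop : Nat.Coprime (Nat.lcm f n₁ / n₁) d)
    {T c : F} (hT0 : T ≠ 0) (hT : w.z T < 0) (hc0 : c ≠ 0) (hc : w.z c < 0)
    (φ₁ : κ₁ →+* E) (z z₂ : E) (hz : algebraMap F E c * z ^ d = algebraMap F E (c + 1))
    (hz₂ : algebraMap F E T * z₂ ^ d = algebraMap F E (T + 1)) 
    (htop : Algebra.adjoin F ({z, z₂} ∪ Set.range φ₁) = ⊤) :
    ∃ κ₀ κ' r : ℕ, Nat.card (integralClosure (ZMod p) E) = p ^ κ₀ ∧ κ₀ = n₁ * κ' ∧ 0 < r ∧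
      Nat.card (IsLocalRing.ResidueField R.V) = (p ^ κ₀) ^ r ∧ Nat.Coprime κ' d ∧ Nat.Coprime r d := by
  have hp := (Fact.out : p.Prime)
  have : CharP E p := hE.charP
  have := finite_residue hE R
  have := finite_consts hE R
  obtain ⟨π, hπ⟩ := exists_Fr w R.V hV
  have hm : 0 < Nat.lcm f n₁ := Nat.lcm_pos hf0 hn
  have hdm : d ∣ p ^ (Nat.lcm f n₁) - 1 := hdn.trans (by
    obtain ⟨k, hk⟩ := Nat.dvd_lcm_right f n₁
    rw [hk, pow_mul]; simpa using Nat.sub_dvd_pow_sub_pow (p ^ n₁) 1 k)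
  have := Fintype.ofFinite κ₁
  have hκn : ∀ x : κ₁, x ^ (p ^ n₁) = x := fun x => by 
    rw [← hκ, Nat.card_eq_fintype_card, FiniteField.pow_card]
  have hX0 := hπ.nice (p := p) (m := Nat.lcm f n₁) (frob_residue w hf (Nat.dvd_lcm_left _ _))
  obtain ⟨e1, v1⟩ := root_val hπ hc hc0 hz
  obtain ⟨e2, v2⟩ := root_val hπ hT hT0 hz₂
  have hX1 := hX0.adj_root hm hdm (t := z) (by rw [e1]; exact ⟨_, rfl⟩) v1
  have hX2 := hX1.adj_root hm hdm (t := z₂) (by rw [e2]; exact le_adj _ _ ⟨_, rfl⟩) v2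
  obtain ⟨g₁, -, hg₁, -⟩ := exists_gen κ₁
  have hX3 := hX2.adj_const hm (t := φ₁ g₁) (by
    obtain ⟨k, hk⟩ := Nat.dvd_lcm_right f n₁
    rw [hk, pow_per (by rw [← map_pow, hκn])])
  obtain ⟨X, hXe⟩ : ∃ X, X = (adj (adj (adj (algebraMap F E).range z) z₂) (φ₁ g₁)) := ⟨_, rfl⟩
  rw [← hXe] at hX3
  have hFX : ∀ a, algebraMap F E a ∈ X := fun a => by
    rw [hXe]; exact le_adj _ _ (le_adj _ _ (le_adj _ _ ⟨a, rfl⟩))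
  let XA : Subalgebra F E := { X.toSubsemiring with algebraMap_mem' := hFX }
  have hall : ∀ y : E, y ∈ X := by
    intro y
    have : Algebra.adjoin F ({z, z₂} ∪ Set.range φ₁) ≤ XA := by
      apply Algebra.adjoin_le
      rintro y ((rfl | rfl) | ⟨l, rfl⟩)
      · change y ∈ X; rw [hXe]; exact le_adj _ _ (le_adj _ _ (self_mem_adj _ _))
      · change y ∈ X; rw [hXe]; exact le_adj _ _ (self_mem_adj _ _)
      · change φ₁ l ∈ X
        rcases hg₁ l with rfl | ⟨i, rfl⟩
        · rw [map_zero]; exact X.zero_mem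
        · rw [map_pow, hXe]; exact Subring.pow_mem _ (self_mem_adj _ _) _
    exact this (by rw [htop]; trivial)
  have hres : ∀ x : IsLocalRing.ResidueField R.V, x ^ (p ^ (Nat.lcm f n₁)) = x := by
    intro x
    obtain ⟨⟨a, ha⟩, rfl⟩ := IsLocalRing.residue_surjective x
    have hmem : a ^ (p ^ (Nat.lcm f n₁)) - a ∈ R.V := R.V.sub_mem (R.V.pow_mem ha _) ha
    have e : (⟨a ^ (p ^ (Nat.lcm f n₁)) - a, hmem⟩ : R.V) = ⟨a, ha⟩ ^ (p ^ (Nat.lcm f n₁)) - ⟨a, ha⟩ := rfl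
    rw [← sub_eq_zero, ← map_pow, ← map_sub, ← e, IsLocalRing.residue_eq_zero_iff, 
      ValuationSubring.valuation_lt_one_iff]
    have h1 := hX3.pr 1 a (hall a) ((R.V.valuation_le_one_iff a).2 ha)
    rw [mul_one] at h1
    exact h1.trans_lt hX3.lt
  obtain ⟨κ₀, hκ₀, hQ⟩ := const_card hE R
  have : CharP (IsLocalRing.ResidueField R.V) p := by
    have h0 : ((p : ℕ) : IsLocalRing.ResidueField R.V) = 0 := by
      have : ((p : ℕ) : R.V) = 0 := by
        apply Subtype.ext; push_cast; exact CharP.cast_eq_zero E p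
      rw [← map_natCast (IsLocalRing.residue R.V), this, map_zero]
    exact (CharP.charP_iff_prime_eq_zero hp).2 h0
  have hs : ∃ s, 0 < s ∧ Nat.card (IsLocalRing.ResidueField R.V) = p ^ s := by
    have := Fintype.ofFinite (IsLocalRing.ResidueField R.V)
    obtain ⟨n, -, hn⟩ := FiniteField.card (IsLocalRing.ResidueField R.V) p
    exact ⟨n, n.pos, by rw [Nat.card_eq_fintype_card, hn]⟩
  obtain ⟨s, hs0, hs⟩ := hs
  have hsm := dvd_of_frob _ hs0 hs hres
  -- constants embed in the residue field
  have hks : κ₀ ∣ s := by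
    let ψ : integralClosure (ZMod p) E →+* R.V := 
      (integralClosure (ZMod p) E).val.toRingHom.codRestrict R.V.toSubring 
        (fun x => mem_of_algebraic x.2 R.V)
    exact dvd_of_hom _ _ hκ₀ hQ hs ((IsLocalRing.residue R.V).comp ψ)
  have hnk : n₁ ∣ κ₀ := by
    letI : Field (integralClosure (ZMod p) E) := (Finite.isField_of_domain _).toField
    let ψ : κ₁ →+* integralClosure (ZMod p) E := 
      φ₁.codRestrict (integralClosure (ZMod p) E).toSubring (fun x => by
        refine ⟨Polynomial.X ^ (p ^ n₁) - Polynomial.X, ?_, ?_⟩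
        · apply monic_X_pow_sub
          rw [degree_X]; exact_mod_cast Nat.one_lt_pow hn.ne' hp.one_lt
        · simp [← map_pow, hκn])
    exact dvd_of_hom _ _ hn hκ hQ ψ
  obtain ⟨κ', rfl⟩ := hnk
  obtain ⟨r, rfl⟩ := hks
  have hr : 0 < r := Nat.pos_of_ne_zero (by rintro rfl; simp at hs0)
  have hdiv : κ' * r ∣ Nat.lcm f n₁ / n₁ := by
    obtain ⟨k, hk⟩ := hsm
    refine ⟨k, ?_⟩
    rw [hk, mul_assoc, mul_assoc, Nat.mul_div_cancel_left _ hn, mul_assoc]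
  refine ⟨n₁ * κ', κ', r, hQ, rfl, hr, by rw [hs, pow_mul], ?_, ?_⟩
  · exact Nat.Coprime.coprime_dvd_left ((dvd_mul_right _ _).trans hdiv) hcop
  · exact Nat.Coprime.coprime_dvd_left ((dvd_mul_left _ _).trans hdiv) hcop

end HW

end

section
set_option linter.all false
open Polynomial

namespace HW
variable {p : ℕ} [Fact p.Prime] {F : Type} [Field F] 
variable {F₂ : Type} [Field F₂] [Algebra F F₂]
variable {E : Type} [Field E] [Algebra F E] [Algebra F₂ E] [IsScalarTower F F₂ E]
variable {κ₁ κ : Type} [Field κ₁] [Field κ] [Finite κ₁] [Fintype κ] [Algebra κ₁ κ]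

lemma span_all {d : ℕ} (hd : 0 < d) (z z₂ : F₂) (u u₂ : F) (hz : z ^ d = algebraMap F F₂ u) 
    (hz₂ : z₂ ^ d = algebraMap F F₂ u₂) (φ₁ : κ₁ →+* F₂) (ι : κ →+* E) 
    (hφ : ∀ c, algebraMap F₂ E (φ₁ c) = ι (algebraMap κ₁ κ c)) (g : κ)
    (htop : Algebra.adjoin F ({z, z₂} ∪ Set.range φ₁) = ⊤) (htop2 : Algebra.adjoin F₂ {ι g} = ⊤) (y : E) :
    ∃ c : Fin d → Fin d → κ → F, y = ∑ l : κ, ∑ a : Fin d, ∑ b : Fin d, 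
      algebraMap F E (c a b l) * algebraMap F₂ E z ^ (a : ℕ) * algebraMap F₂ E z₂ ^ (b : ℕ) * ι l := by
  obtain ⟨Z, hZ⟩ : ∃ Z, Z = algebraMap F₂ E z := ⟨_, rfl⟩
  obtain ⟨Z₂, hZ₂⟩ : ∃ Z, Z = algebraMap F₂ E z₂ := ⟨_, rfl⟩
  have eZ : Z ^ d = algebraMap F E u := by 
    rw [hZ, ← map_pow, hz, ← IsScalarTower.algebraMap_apply]
  have eZ₂ : Z₂ ^ d = algebraMap F E u₂ := by 
    rw [hZ₂, ← map_pow, hz₂, ← IsScalarTower.algebraMap_apply]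
  let vv : κ × Fin d × Fin d → E := fun i => Z ^ (i.2.1 : ℕ) * Z₂ ^ (i.2.2 : ℕ) * ι i.1
  let M : Submodule F E := Submodule.span F (Set.range vv)
  have hred : ∀ (W : E) (t : F) (ht : W ^ d = algebraMap F E t) (i : ℕ), ∃ (s : F) (a : Fin d), 
      W ^ i = algebraMap F E s * W ^ (a : ℕ) := by
    intro W t ht i
    refine ⟨t ^ (i / d), ⟨i % d, Nat.mod_lt _ hd⟩, ?_⟩
    rw [map_pow, ← ht, ← pow_mul, ← pow_add, Nat.div_add_mod]
  have hmon : ∀ (i j : ℕ) (l : κ), Z ^ i * Z₂ ^ j * ι l ∈ M := by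
    intro i j l
    obtain ⟨s, a, hs⟩ := hred Z u eZ i
    obtain ⟨s', b, hs'⟩ := hred Z₂ u₂ eZ₂ j
    have : Z ^ i * Z₂ ^ j * ι l = (s * s') • vv (l, a, b) := by
      rw [hs, hs', Algebra.smul_def, map_mul]; simp only [vv]; ring
    rw [this]
    exact M.smul_mem _ (Submodule.subset_span ⟨_, rfl⟩)
  let N : Subalgebra F E := 
    { carrier := {y | ∀ m ∈ M, y * m ∈ M}
      mul_mem' := fun {a b} ha hb m hm => by rw [mul_assoc]; exact ha _ (hb _ hm)
      one_mem' := fun m hm => by rwa [one_mul]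
      add_mem' := fun {a b} ha hb m hm => by rw [add_mul]; exact M.add_mem (ha _ hm) (hb _ hm)
      zero_mem' := fun m hm => by rw [zero_mul]; exact M.zero_mem
      algebraMap_mem' := fun r m hm => by rw [← Algebra.smul_def]; exact M.smul_mem _ hm }
  have hN : ∀ y : E, (∀ i, y * vv i ∈ M) → y ∈ N := by
    intro y hy m hm
    have : M ≤ M.comap (LinearMap.mulLeft F y) := by
      refine Submodule.span_le.2 ?_
      rintro _ ⟨i, rfl⟩
      exact hy i
    exact this hm
  have hZN : Z ∈ N := hN _ fun i => by
    have : Z * vv i = Z ^ ((i.2.1 : ℕ) + 1) * Z₂ ^ (i.2.2 : ℕ) * ι i.1 := by simp only [vv]; ring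
    rw [this]; exact hmon _ _ _
  have hZ₂N : Z₂ ∈ N := hN _ fun i => by
    have : Z₂ * vv i = Z ^ (i.2.1 : ℕ) * Z₂ ^ ((i.2.2 : ℕ) + 1) * ι i.1 := by simp only [vv]; ring
    rw [this]; exact hmon _ _ _
  have hιN : ∀ l, ι l ∈ N := fun l => hN _ fun i => by
    have : ι l * vv i = Z ^ (i.2.1 : ℕ) * Z₂ ^ (i.2.2 : ℕ) * ι (l * i.1) := by 
      simp only [vv, map_mul]; ring
    rw [this]; exact hmon _ _ _
  have hF₂N : ∀ a : F₂, algebraMap F₂ E a ∈ N := by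
    intro a
    have : Algebra.adjoin F ({z, z₂} ∪ Set.range φ₁) ≤ N.comap (IsScalarTower.toAlgHom F F₂ E) := by
      apply Algebra.adjoin_le
      rintro y ((rfl | rfl) | ⟨l, rfl⟩)
      · change algebraMap F₂ E y ∈ N; rwa [← hZ]
      · change algebraMap F₂ E y ∈ N; rwa [← hZ₂]
      · change algebraMap F₂ E (φ₁ l) ∈ N; rw [hφ]; exact hιN _
    exact this (by rw [htop]; trivial)
  let N' : Subalgebra F₂ E := { N.toSubsemiring with algebraMap_mem' := hF₂N }
  have hyN : y ∈ N := by
    have : Algebra.adjoin F₂ {ι g} ≤ N' := by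
      apply Algebra.adjoin_le
      rintro _ rfl
      exact hιN g
    exact this (by rw [htop2]; trivial)
  have hyM : y ∈ M := by
    have h1 : (1 : E) ∈ M := by simpa using hmon 0 0 1
    simpa using hyN 1 h1
  obtain ⟨c, hc⟩ := (Submodule.mem_span_range_iff_exists_fun F).1 hyM
  refine ⟨fun a b l => c (l, a, b), ?_⟩
  rw [← hc, Fintype.sum_prod_type]
  refine Finset.sum_congr rfl fun l _ => ?_
  rw [Fintype.sum_prod_type]
  refine Finset.sum_congr rfl fun a _ => Finset.sum_congr rfl fun b _ => ?_
  rw [Algebra.smul_def, ← hZ, ← hZ₂]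
  simp only [vv]; ring

theorem forward_mid [Algebra (ZMod p) F₂] [Algebra (ZMod p) E] (hF₂ : GFF p F₂)
    [FiniteDimensional F F₂] [FiniteDimensional F₂ E] 
    (w : FFPrime F) [Finite (IsLocalRing.ResidueField w.V)] {d n₁ f M : ℕ} (hd : 2 ≤ d) (hn : 0 < n₁) (hM : 0 < M)
    (hdn : d ∣ p ^ n₁ - 1) (hf0 : 0 < f) (hf : Nat.card (IsLocalRing.ResidueField w.V) = p ^ f) 
    (hκ₁ : Nat.card κ₁ = p ^ n₁) (hκ : Nat.card κ = p ^ (n₁ * d)) (hfr : Module.finrank κ₁ κ = d) 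
    (hcop : Nat.Coprime (Nat.lcm f n₁ / n₁) d)
    {T x c : F} (hT0 : T ≠ 0) (hT : w.z T < 0) (hc : c = T * x ^ (M * d) + T ^ d)
    (hx : ∀ w : FFPrime F, w.z T < 0 → x ∈ w.V) (hF : ∀ W : FFPrime F₂, ∃ w e, W.LiesOverWith w (algebraMap F F₂) e)
    (φ₁ : κ₁ →+* F₂) (z z₂ : F₂) (hz : algebraMap F F₂ c * z ^ d = algebraMap F F₂ (c + 1))
    (hz₂ : algebraMap F F₂ T * z₂ ^ d = algebraMap F F₂ (T + 1)) 
    (htop : Algebra.adjoin F ({z, z₂} ∪ Set.range φ₁) = ⊤) 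
    (ι : κ →+* E) (hφ : ∀ c, algebraMap F₂ E (φ₁ c) = ι (algebraMap κ₁ κ c)) (g : κ)
    (hg0 : ∀ x : κ, x = 0 ∨ ∃ i : ℕ, x = g ^ i)
    (hg : ∀ a b : ℕ, g ^ (p ^ a) = g ^ (p ^ b) → a ≡ b [MOD (n₁ * d)])
    (htop2 : Algebra.adjoin F₂ {ι g} = ⊤) : Sol p d n₁ κ F E T c := by
  have hcv := cval_neg w (M := M) hd hT0 hT (hx w hT)
  rw [← hc] at hcv
  have hc0 : c ≠ 0 := hcv.1
  have hcn : w.z c < 0 := by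
    rw [hcv.2]
    have : (2 : ℤ) ≤ d := by exact_mod_cast hd
    nlinarith
  obtain ⟨R, e, hR⟩ := exists_above hF₂ (F := F) w
  have hV : ∀ a : F, a ∈ w.V ↔ algebraMap F F₂ a ∈ R.V := by
    intro a
    by_cases ha : a = 0
    · subst ha; simp [w.V.zero_mem]
    rw [w.mem_V', R.mem_V', hR.z_eq]
    have : (0 : ℤ) < e := by exact_mod_cast hR.1
    simp [ha, mul_nonneg_iff_of_pos_left this]
  obtain ⟨κ₀, κ', r, hQ, hκ₀, hr0, hr, hk', hrd⟩ := residue_info hF₂ w R hV hd hn hdn hf0 hf hκ₁ hcop 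
    hT0 hT hc0 hcn φ₁ z z₂ hz hz₂ htop
  obtain ⟨σ, hσ⟩ := exists_cyc hF₂ R hd hn hκ hfr hQ hκ₀ hk' ι φ₁ hφ g hg htop2
  have hc0' : algebraMap F F₂ c ≠ 0 := by simpa using hc0
  have hT0' : algebraMap F F₂ T ≠ 0 := by simpa using hT0
  obtain ⟨y, hy⟩ := norm_theorem hσ hF₂ R hr0 hr hrd hc0' (fun W => by
    refine dvd_c W (T := algebraMap F F₂ T) (x := algebraMap F F₂ x) hd hM hT0' (by rw [hc]; simp) hc0' 
      (by rw [hz]; simp) (by rw [hz₂]; simp) fun hW => ?_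
    obtain ⟨w', e', hw'⟩ := hF W
    have he' : (0 : ℤ) < e' := by exact_mod_cast hw'.1
    rw [hw'.z_eq] at hW
    have h1 := hx w' (by nlinarith)
    rw [w'.mem_V'] at h1
    rw [W.mem_V', hw'.z_eq]
    rcases h1 with h1 | h1
    · left; simp [h1]
    · right; positivity)
  have ez : z ^ d = algebraMap F F₂ (1 + c⁻¹) := by
    apply mul_left_cancel₀ hc0'
    rw [hz, ← map_mul]; congr 1; field_simp
  have ez₂ : z₂ ^ d = algebraMap F F₂ (1 + T⁻¹) := by
    apply mul_left_cancel₀ hT0'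
    rw [hz₂, ← map_mul]; congr 1; field_simp
  obtain ⟨cc, hcc⟩ := span_all (by lia : 0 < d) z z₂ _ _ ez ez₂ φ₁ ι hφ g htop htop2 y
  have hιd : ∀ l, ι l ^ (p ^ (n₁ * d)) = ι l := fun l => by
    rw [← map_pow, ← hκ, Nat.card_eq_fintype_card, FiniteField.pow_card]
  have hσl : ∀ l, σ (ι l) = ι l ^ (p ^ κ₀) := by
    intro l
    rcases hg0 l with rfl | ⟨i, rfl⟩
    · simp [(Fact.out : p.Prime).ne_zero]
    · rw [map_pow, map_pow, hσ.sig, pow_right_comm]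
  have hσi : ∀ (i : ℕ) l, (σ ^ i) (ι l) = ι l ^ (p ^ (κ₀ * i)) := by
    intro i l
    induction i with
    | zero => simp
    | succ i ih => 
      rw [pow_succ', AlgEquiv.mul_apply, ih, map_pow, hσl, ← pow_mul, ← pow_add]
      congr 2; ring
  refine ⟨algebraMap F₂ E z, algebraMap F₂ E z₂, ι, cc, ?_, ?_, ?_⟩
  · rw [IsScalarTower.algebraMap_apply F F₂ E, ← map_pow, ← map_mul, hz, ← IsScalarTower.algebraMap_apply]
  · rw [IsScalarTower.algebraMap_apply F F₂ E, ← map_pow, ← map_mul, hz₂, ← IsScalarTower.algebraMap_apply]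
  · rw [IsScalarTower.algebraMap_apply F F₂ E c, hy]
    rw [← prod_reindex (by lia : 0 < d) hk' (fun i => ∑ l : κ, ∑ a : Fin d, ∑ b : Fin d, 
      algebraMap F E (cc a b l) * (algebraMap F₂ E z) ^ (a : ℕ) * (algebraMap F₂ E z₂) ^ (b : ℕ) 
        * (ι l) ^ (p ^ (n₁ * i))) (fun i => by
        refine Finset.sum_congr rfl fun l _ => Finset.sum_congr rfl fun a _ => 
          Finset.sum_congr rfl fun b _ => ?_
        rw [pow_mod (hιd l) (j := n₁ * (i % d)) (j' := n₁ * i) (Nat.ModEq.mul_left' _ (Nat.mod_modEq _ _))])]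
    refine Finset.prod_congr rfl fun i _ => ?_
    rw [hcc, map_sum]
    refine Finset.sum_congr rfl fun l _ => ?_
    rw [map_sum]
    refine Finset.sum_congr rfl fun a _ => ?_
    rw [map_sum]
    refine Finset.sum_congr rfl fun b _ => ?_
    rw [map_mul, hσi, hκ₀, mul_assoc n₁, IsScalarTower.algebraMap_apply F F₂ E]
    rw [← map_pow, ← map_pow, ← map_mul, ← map_mul, AlgEquiv.commutes]

end HW

end

section
set_option linter.all false
open Polynomial

namespace HW
variable {p : ℕ} [Fact p.Prime] {F : Type} [Field F] 

/-- transport of solutions along a commutative square -/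
lemma Sol.map {R L R' L' : Type} [Field R] [Field L] [Algebra R L] [Field R'] [Field L'] [Algebra R' L']
    {d n₁ : ℕ} {κ : Type} [Field κ] [Fintype κ] {T c : R} (h : Sol p d n₁ κ R L T c)
    (φ : R →+* R') (ψ : L →+* L') (hc : ∀ a, ψ (algebraMap R L a) = algebraMap R' L' (φ a)) :
    Sol p d n₁ κ R' L' (φ T) (φ c) := by
  obtain ⟨z, z₂, ι, y, h1, h2, h3⟩ := h
  refine ⟨ψ z, ψ z₂, ψ.comp ι, fun a b l => φ (y a b l), ?_, ?_, ?_⟩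
  · rw [← hc, ← map_pow, ← map_mul, h1, hc, map_add, map_one]
  · rw [← hc, ← map_pow, ← map_mul, h2, hc, map_add, map_one]
  · rw [← hc, ← h3, map_prod]
    refine Finset.prod_congr rfl fun i _ => ?_
    rw [map_sum]
    refine Finset.sum_congr rfl fun l _ => ?_
    rw [map_sum]
    refine Finset.sum_congr rfl fun a _ => ?_
    rw [map_sum]
    refine Finset.sum_congr rfl fun b _ => ?_
    rw [map_mul, map_mul, map_mul, hc, map_pow, map_pow, map_pow]; rfl

theorem forward_aux {Ω : Type} [Field Ω] [IsAlgClosed Ω] [Algebra F Ω] [Algebra (ZMod p) F] (hF : GFF p F)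
    {κ₁ κ : Type} [Field κ₁] [Finite κ₁] [Field κ] [Fintype κ] [Algebra κ₁ κ] (ι : κ →+* Ω)
    (w : FFPrime F) [Finite (IsLocalRing.ResidueField w.V)] {d n₁ f M : ℕ} (hd : 2 ≤ d) (hn : 0 < n₁) (hM : 0 < M)
    (hdn : d ∣ p ^ n₁ - 1) (hf0 : 0 < f) (hf : Nat.card (IsLocalRing.ResidueField w.V) = p ^ f) 
    (hκ₁ : Nat.card κ₁ = p ^ n₁) (hκ : Nat.card κ = p ^ (n₁ * d)) (hfr : Module.finrank κ₁ κ = d)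
    (hcop : Nat.Coprime (Nat.lcm f n₁ / n₁) d)
    {T x c : F} (hT0 : T ≠ 0) (hT : w.z T < 0) (hc : c = T * x ^ (M * d) + T ^ d)
    (hx : ∀ w : FFPrime F, w.z T < 0 → x ∈ w.V) : Sol p d n₁ κ F Ω T c := by
  have hp := (Fact.out : p.Prime)
  have hcv := cval_neg w (M := M) hd hT0 hT (hx w hT)
  rw [← hc] at hcv
  have hc0 : c ≠ 0 := hcv.1
  haveI := hF.charP
  have hd0 : 0 < d := by lia
  haveI : CharP Ω p := (RingHom.charP_iff (algebraMap F Ω) (algebraMap F Ω).injective p).1 inferInstance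
  obtain ⟨g, g0, hg0, hg⟩ := gen_dist (p := p) κ (n := n₁ * d) (by nlinarith) hκ
  obtain ⟨Z, hZ⟩ := IsAlgClosed.exists_pow_nat_eq (algebraMap F Ω (1 + c⁻¹)) hd0
  obtain ⟨Z₂, hZ₂⟩ := IsAlgClosed.exists_pow_nat_eq (algebraMap F Ω (1 + T⁻¹)) hd0
  obtain ⟨S, hS⟩ : ∃ S : Set Ω, S = {Z, Z₂} ∪ Set.range (fun l : κ₁ => ι (algebraMap κ₁ κ l)) := ⟨_, rfl⟩
  have hSf : S.Finite := by
    rw [hS]; exact (Set.toFinite _).union (Set.finite_range _)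
  haveI : Finite S := hSf
  have hιI : ∀ l, IsIntegral F (ι l) := fun l => by
    refine ⟨X ^ (p ^ (n₁ * d)) - X, ?_, ?_⟩
    · exact monic_X_pow_sub (by rw [degree_X]; exact_mod_cast Nat.one_lt_pow (by positivity) hp.one_lt)
    · have : ι l ^ (p ^ (n₁ * d)) = ι l := by
        rw [← map_pow, ← hκ, Nat.card_eq_fintype_card, FiniteField.pow_card]
      simp [this]
  have hSI : ∀ x ∈ S, IsIntegral F x := by
    rw [hS]
    rintro y ((rfl | rfl) | ⟨l, rfl⟩)
    · exact IsIntegral.of_pow hd0 (by rw [hZ]; exact isIntegral_algebraMap)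
    · exact IsIntegral.of_pow hd0 (by rw [hZ₂]; exact isIntegral_algebraMap)
    · exact hιI _
  obtain ⟨F₂, hF₂⟩ : ∃ F₂ : IntermediateField F Ω, F₂ = IntermediateField.adjoin F S := ⟨_, rfl⟩
  haveI : FiniteDimensional F F₂ := by rw [hF₂]; exact IntermediateField.finiteDimensional_adjoin hSI
  have hsub : S ⊆ F₂ := by rw [hF₂]; exact IntermediateField.subset_adjoin F S
  have hF₂' : F₂.toSubalgebra = Algebra.adjoin F S := by 
    rw [hF₂]; exact IntermediateField.adjoin_toSubalgebra_of_isAlgebraic fun x hx => (hSI x hx).isAlgebraic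
  have hZm : Z ∈ F₂ := hsub (by rw [hS]; simp)
  have hZ₂m : Z₂ ∈ F₂ := hsub (by rw [hS]; simp)
  let φ₁ : κ₁ →+* F₂ := (ι.comp (algebraMap κ₁ κ)).codRestrict F₂ (fun l => hsub (by rw [hS]; right; exact ⟨l, rfl⟩))
  have hgI : IsIntegral F₂ (ι g) := (hιI g).tower_top
  let E : IntermediateField F₂ Ω := IntermediateField.adjoin F₂ {ι g}
  haveI : FiniteDimensional F₂ E := IntermediateField.adjoin.finiteDimensional hgI
  have hgE : ι g ∈ E := IntermediateField.mem_adjoin_simple_self _ _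
  have hιE : ∀ l, ι l ∈ E := fun l => by
    rcases hg0 l with rfl | ⟨i, rfl⟩
    · simp
    · rw [map_pow]; exact pow_mem hgE i
  let ι' : κ →+* E := ι.codRestrict E hιE
  have hGF₂ : GFF p F₂ := hF.of_finite
  haveI := hGF₂.charP
  haveI : CharP E p := (RingHom.charP_iff (algebraMap F E) (algebraMap F E).injective p).1 inferInstance
  letI : Algebra (ZMod p) F₂ := ZMod.algebra F₂ p
  letI : Algebra (ZMod p) E := ZMod.algebra E p
  have main : Sol p d n₁ κ F E T c := by
    refine forward_mid (κ₁ := κ₁) hGF₂ w hd hn hM hdn hf0 hf hκ₁ hκ hfr hcop hT0 hT hc hx (fun W => exists_below hF W) φ₁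
      ⟨Z, hZm⟩ ⟨Z₂, hZ₂m⟩ ?_ ?_ ?_ ι' (fun l => rfl) g hg0 hg ?_
    · apply Subtype.ext
      change algebraMap F Ω c * Z ^ d = algebraMap F Ω (c + 1)
      rw [hZ, ← map_mul]; congr 1; field_simp
    · apply Subtype.ext
      change algebraMap F Ω T * Z₂ ^ d = algebraMap F Ω (T + 1)
      rw [hZ₂, ← map_mul]; congr 1; field_simp
    · rw [eq_top_iff]
      rintro ⟨y, hy⟩ -
      have hy' : y ∈ Algebra.adjoin F S := by rw [← hF₂']; exact hy
      have him : S = F₂.val '' ({⟨Z, hZm⟩, ⟨Z₂, hZ₂m⟩} ∪ Set.range φ₁) := by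
        rw [Set.image_union, ← Set.range_comp, Set.image_pair, hS]; rfl
      rw [him, ← AlgHom.map_adjoin] at hy'
      obtain ⟨y', hy1, hy2⟩ := hy'
      have : y' = ⟨y, hy⟩ := Subtype.ext hy2
      rwa [← this]
    · rw [eq_top_iff]
      rintro ⟨y, hy⟩ -
      have hy' : y ∈ Algebra.adjoin F₂ {ι g} := by 
        rw [← IntermediateField.adjoin_simple_toSubalgebra_of_isAlgebraic hgI.isAlgebraic]; exact hy
      have him : ({ι g} : Set Ω) = E.val '' {ι' g} := by
        rw [Set.image_singleton]; rfl
      rw [him, ← AlgHom.map_adjoin] at hy'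
      obtain ⟨y', hy1, hy2⟩ := hy'
      have : y' = ⟨y, hy⟩ := Subtype.ext hy2
      rwa [← this]
  exact main.map (RingHom.id F) E.val.toRingHom (fun a => rfl)

theorem forward {Ω : Type} [Field Ω] [IsAlgClosed Ω] [Algebra F Ω] [Algebra (ZMod p) F] (hF : GFF p F)
    {κ : Type} [Field κ] [Fintype κ]
    (w : FFPrime F) [Finite (IsLocalRing.ResidueField w.V)] {d n₁ f M : ℕ} (hd : 2 ≤ d) (hn : 0 < n₁) (hM : 0 < M)
    (hdn : d ∣ p ^ n₁ - 1) (hf0 : 0 < f) (hf : Nat.card (IsLocalRing.ResidueField w.V) = p ^ f) 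
    (hκ : Nat.card κ = p ^ (n₁ * d)) 
    (hcop : Nat.Coprime (Nat.lcm f n₁ / n₁) d)
    {T x c : F} (hT0 : T ≠ 0) (hT : w.z T < 0) (hc : c = T * x ^ (M * d) + T ^ d)
    (hx : ∀ w : FFPrime F, w.z T < 0 → x ∈ w.V) : Sol p d n₁ κ F Ω T c := by
  have hp := (Fact.out : p.Prime)
  have hcv := cval_neg w (M := M) hd hT0 hT (hx w hT)
  rw [← hc] at hcv
  have hc0 : c ≠ 0 := hcv.1
  have hnd : 0 < n₁ * d := by positivity
  haveI : CharP κ p := by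
    rw [Nat.card_eq_fintype_card] at hκ
    exact charP_of_card_eq_prime_pow hκ
  haveI := hF.charP
  haveI : CharP Ω p := (RingHom.charP_iff (algebraMap F Ω) (algebraMap F Ω).injective p).1 inferInstance
  letI : Algebra (ZMod p) κ := ZMod.algebra κ p
  letI : Algebra (ZMod p) Ω := ZMod.algebra Ω p
  obtain ⟨e⟩ := FiniteField.nonempty_algHom_of_finrank_dvd (F := ZMod p) (K := GaloisField p n₁) (L := κ) (by
    rw [GaloisField.finrank p hn.ne']
    have h1 := Module.natCard_eq_pow_finrank (K := ZMod p) (V := κ)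
    rw [hκ, Nat.card_zmod] at h1
    rw [← Nat.pow_right_injective hp.two_le h1]
    exact dvd_mul_right _ _)
  have hκ₁ : Nat.card (GaloisField p n₁) = p ^ n₁ := GaloisField.card p n₁ hn.ne'
  letI : Algebra (GaloisField p n₁) κ := e.toRingHom.toAlgebra
  have hfr : Module.finrank (GaloisField p n₁) κ = d := by
    have h1 := Module.natCard_eq_pow_finrank (K := GaloisField p n₁) (V := κ)
    rw [hκ, hκ₁, ← pow_mul] at h1
    exact (Nat.eq_of_mul_eq_mul_left hn (Nat.pow_right_injective hp.two_le h1)).symm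
  have ι : κ →ₐ[ZMod p] Ω := IsAlgClosed.lift
  exact forward_aux hF ι.toRingHom w hd hn hM hdn hf0 hf hκ₁ hκ hfr hcop hT0 hT hc hx
end HW

end

section
set_option linter.all false
open Polynomial

namespace HW
variable {p : ℕ} [Fact p.Prime] {F : Type} [Field F] 

lemma hasResidueCard_iff (w : FFPrime F) [Finite (IsLocalRing.ResidueField w.V)] (n : ℕ) :
    w.HasResidueCard n ↔ n = Nat.card (IsLocalRing.ResidueField w.V) := by
  classical
  haveI := Fintype.ofFinite (IsLocalRing.ResidueField w.V)
  have key : ∀ (x y : w.V), IsLocalRing.residue w.V x = IsLocalRing.residue w.V y ↔ 0 < w.ord ((x : F) - y) := by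
    intro x y
    rw [← sub_eq_zero, ← map_sub]
    exact residue_eq_zero w (x - y).2
  constructor
  · rintro ⟨s, rfl, h1, h2, h3⟩
    rw [← Nat.card_eq_finsetCard s]
    refine Nat.card_congr (Equiv.ofBijective (fun x : s => IsLocalRing.residue w.V ⟨x.1, h1 x.1 x.2⟩) ⟨?_, ?_⟩)
    · intro x y hxy
      by_contra hne
      exact h2 x.1 x.2 y.1 y.2 (fun h => hne (Subtype.ext h)) ((key _ _).1 hxy)
    · intro k
      obtain ⟨z, rfl⟩ := IsLocalRing.residue_surjective k
      obtain ⟨x, hx, hx'⟩ := h3 z z.2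
      exact ⟨⟨x, hx⟩, ((key z ⟨x, h1 x hx⟩).2 hx').symm⟩
  · rintro rfl
    choose g hg using IsLocalRing.residue_surjective (R := w.V)
    refine ⟨Finset.univ.image (fun k => (g k : F)), ?_, ?_, ?_, ?_⟩
    · rw [Finset.card_image_of_injective, Finset.card_univ, Nat.card_eq_fintype_card]
      intro a b hab
      rw [← hg a, ← hg b, Subtype.ext hab]
    · intro x hx
      obtain ⟨k, -, rfl⟩ := Finset.mem_image.1 hx
      exact (g k).2
    · intro x hx y hy hxy
      obtain ⟨k, -, rfl⟩ := Finset.mem_image.1 hx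
      obtain ⟨l, -, rfl⟩ := Finset.mem_image.1 hy
      rw [← key, hg, hg]
      rintro rfl; exact hxy rfl
    · intro z hz
      refine ⟨g (IsLocalRing.residue w.V ⟨z, hz⟩), Finset.mem_image.2 ⟨_, Finset.mem_univ _, rfl⟩, ?_⟩
      have := (key ⟨z, hz⟩ (g (IsLocalRing.residue w.V ⟨z, hz⟩))).1 (by rw [hg])
      exact this

lemma card_residue [Algebra (ZMod p) F] (hF : GFF p F) (w : FFPrime F) :
    ∃ f, 0 < f ∧ Nat.card (IsLocalRing.ResidueField w.V) = p ^ f := by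
  haveI := finite_residue hF w
  haveI := hF.charP
  haveI := Fintype.ofFinite (IsLocalRing.ResidueField w.V)
  have : CharP (IsLocalRing.ResidueField w.V) p := by
    rw [CharP.charP_iff_prime_eq_zero Fact.out]
    have : (p : w.V) = 0 := by
      apply Subtype.ext
      simp [CharP.cast_eq_zero]
    rw [← map_natCast (IsLocalRing.residue w.V), this, map_zero]
  obtain ⟨n, -, hn⟩ := FiniteField.card (IsLocalRing.ResidueField w.V) p
  exact ⟨n, n.pos, by rw [Nat.card_eq_fintype_card, hn]⟩

lemma card_residue_pow {L : Type} [Field L] [Algebra F L] {w : FFPrime F} {W : FFPrime L}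
    [Finite (IsLocalRing.ResidueField w.V)] [Finite (IsLocalRing.ResidueField W.V)]
    {e : ℕ} (h : W.LiesOverWith w (algebraMap F L) e) : 
    ∃ f, 0 < f ∧ Nat.card (IsLocalRing.ResidueField W.V) = Nat.card (IsLocalRing.ResidueField w.V) ^ f := by
  have he : (0 : ℤ) < e := by exact_mod_cast h.1
  have h1 : ∀ a, a ∈ w.V ↔ algebraMap F L a ∈ W.V := by
    intro a
    rw [w.mem_V', W.mem_V', h.z_eq]
    simp [mul_nonneg_iff_of_pos_left he]
  let ψ : w.V →+* W.V := ((algebraMap F L).comp w.V.subtype).codRestrict W.V.toSubring (fun a => (h1 a).1 a.2)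
  haveI : IsLocalHom ψ := ⟨fun a ha => by
    by_contra hn
    have ha0 : IsLocalRing.residue w.V a = 0 := by
      rw [IsLocalRing.residue_eq_zero_iff, IsLocalRing.mem_maximalIdeal]; exact hn
    have ha1 : (0 : WithTop ℤ) < w.ord a := (residue_eq_zero w a.2).1 ha0
    have ha2 : IsLocalRing.residue W.V (ψ a) ≠ 0 := by
      rw [ne_eq, IsLocalRing.residue_eq_zero_iff, IsLocalRing.mem_maximalIdeal]
      exact fun h => h ha
    apply ha2
    apply (residue_eq_zero W (ψ a).2).2
    rw [W.pos_iff]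
    rw [w.pos_iff] at ha1
    change algebraMap F L a = 0 ∨ 0 < W.z (algebraMap F L a)
    rw [h.z_eq]
    rcases ha1 with h | h
    · left; rw [h, map_zero]
    · right; positivity⟩
  letI := (IsLocalRing.ResidueField.map ψ).toAlgebra
  exact ⟨Module.finrank (IsLocalRing.ResidueField w.V) (IsLocalRing.ResidueField W.V), Module.finrank_pos, 
    Module.natCard_eq_pow_finrank⟩

lemma resDeg_spec {L : Type} [Field L] [Algebra F L] {w : FFPrime F} {W : FFPrime L}
    [Finite (IsLocalRing.ResidueField w.V)] [Finite (IsLocalRing.ResidueField W.V)]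
    {e : ℕ} (h : W.LiesOverWith w (algebraMap F L) e) : 0 < W.resDeg w ∧ 
      Nat.card (IsLocalRing.ResidueField W.V) = Nat.card (IsLocalRing.ResidueField w.V) ^ (W.resDeg w) := by
  obtain ⟨f, hf, hf'⟩ := card_residue_pow h
  have hex : ∃ f : ℕ, 0 < f ∧ ∃ m n : ℕ, 1 < m ∧ w.HasResidueCard m ∧
      W.HasResidueCard n ∧ n = m ^ f := ⟨f, hf, _, _, Finite.one_lt_card, 
      (hasResidueCard_iff w _).2 rfl, (hasResidueCard_iff W _).2 rfl, hf'⟩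
  have hs := hex.choose_spec
  rw [FFPrime.resDeg, dif_pos hex]
  obtain ⟨h1, m, n, -, h2, h3, h4⟩ := hs
  refine ⟨h1, ?_⟩
  rw [hasResidueCard_iff] at h2 h3
  rw [← h2, ← h3, h4]

lemma padic_resDeg {L : Type} [Field L] [Algebra F L] [FiniteDimensional F L] [Algebra (ZMod p) F] [Algebra (ZMod p) L]
    (hF : GFF p F) {w : FFPrime F} {W : FFPrime L} {q : ℕ} (hq : q.Prime) {fw : ℕ} (hfw0 : 0 < fw)
    (hfw : Nat.card (IsLocalRing.ResidueField w.V) = p ^ fw)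
    {e : ℕ} (h : W.LiesOverWith w (algebraMap F L) e) : ∃ f, 0 < f ∧ 
      Nat.card (IsLocalRing.ResidueField W.V) = p ^ f ∧ padicValNat q f = padicValNat q fw + padicValNat q (W.resDeg w) := by
  haveI := finite_residue hF w
  haveI := finite_residue (hF.of_finite (L := L)) W
  haveI : Fact q.Prime := ⟨hq⟩
  obtain ⟨h1, h2⟩ := resDeg_spec h
  refine ⟨fw * W.resDeg w, by positivity, ?_, padicValNat.mul (by lia) (by lia)⟩
  rw [h2, hfw, pow_mul]

lemma arith {p q : ℕ} [Fact p.Prime] (hq : q.Prime) (hqp : q ≠ p) (B N : ℕ) :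
    ∃ n₁, 0 < n₁ ∧ q ^ N ∣ p ^ n₁ - 1 ∧ ∀ f, 0 < f → padicValNat q f ≤ B → 
      Nat.Coprime (Nat.lcm f n₁ / n₁) (q ^ N) := by
  haveI : Fact q.Prime := ⟨hq⟩
  have hp := (Fact.out : p.Prime)
  have hφ : 0 < Nat.totient (q ^ N) := Nat.totient_pos.2 (by have := hq.pos; positivity)
  have hq0 := hq.pos
  refine ⟨q ^ B * Nat.totient (q ^ N), by positivity, ?_, ?_⟩
  · have hc : Nat.Coprime p (q ^ N) := Nat.Coprime.pow_right _ ((Nat.coprime_primes hp hq).2 hqp.symm)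
    have := Nat.ModEq.pow_totient hc
    have h2 := this.pow (q ^ B)
    rw [one_pow, ← pow_mul, mul_comm] at h2
    exact (Nat.modEq_iff_dvd' (Nat.one_le_pow _ _ hp.pos)).1 h2.symm
  · intro f hf hfB
    obtain ⟨n₁, hn₁⟩ : ∃ n₁, n₁ = q ^ B * Nat.totient (q ^ N) := ⟨_, rfl⟩
    rw [← hn₁]
    have hn0 : 0 < n₁ := by rw [hn₁]; positivity
    apply Nat.Coprime.pow_right
    rw [Nat.coprime_comm, hq.coprime_iff_not_dvd]
    intro hd
    have hBn : B ≤ padicValNat q n₁ := by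
      rw [← padicValNat_dvd_iff_le hn0.ne']
      rw [hn₁]; exact dvd_mul_right _ _
    have hg : Nat.lcm f n₁ / n₁ = f / Nat.gcd f n₁ := by
      rw [Nat.lcm, Nat.mul_comm f n₁, Nat.mul_div_assoc _ (Nat.gcd_dvd_left _ _), Nat.mul_div_cancel_left _ hn0]
    rw [hg] at hd
    obtain ⟨u, hu⟩ := hd
    have hfg : f = Nat.gcd f n₁ * (q * u) := by
      rw [← hu, Nat.mul_div_cancel' (Nat.gcd_dvd_left _ _)]
    have h3 : q ^ padicValNat q f ∣ Nat.gcd f n₁ := 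
      Nat.dvd_gcd pow_padicValNat_dvd ((pow_dvd_pow _ (hfB.trans hBn)).trans pow_padicValNat_dvd)
    have h4 : q ^ (padicValNat q f + 1) ∣ f := by
      conv_rhs => rw [hfg]
      rw [pow_succ]
      exact mul_dvd_mul h3 (dvd_mul_right _ _)
    exact pow_succ_padicValNat_not_dvd hf.ne' h4
end HW

end

section
set_option linter.all false
open Polynomial

namespace HW
variable {p : ℕ} [Fact p.Prime] {K : Type} [Field K] {BK : Type} [Field BK] [Algebra K BK] [Algebra.IsAlgebraic K BK]

lemma main_back [Algebra (ZMod p) K] (hK : GFF p K) (v : FFPrime K) {T : K} {m₀ C d n₁ M B q : ℕ} (hq : q.Prime)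
    (hT0 : T ≠ 0) (hTm : v.z T = - (m₀ : ℤ)) (hm₀ : 0 < m₀) (hd : C * m₀ < d) (hM : C * m₀ ≤ M)
    (hn : 0 < n₁) (hdn : d ∣ p ^ n₁ - 1) 
    (hram : ∀ F : IntermediateField K BK, FiniteDimensional K F →
      ∀ w : FFPrime F, w.LiesOver v (algebraMap K F) → w.ramIdx v (algebraMap K F) ≤ C)
    {fv : ℕ} (hfv0 : 0 < fv) (hfv : Nat.card (IsLocalRing.ResidueField v.V) = p ^ fv)
    (hres : ∀ F : IntermediateField K BK, FiniteDimensional K F →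
      ∀ w : FFPrime F, w.LiesOver v (algebraMap K F) → padicValNat q fv + padicValNat q (w.resDeg v) ≤ B)
    (hcop : ∀ f, 0 < f → padicValNat q f ≤ B → Nat.Coprime (Nat.lcm f n₁ / n₁) d)
    {κ : Type} [Field κ] [Fintype κ] (hκ : Fintype.card κ = p ^ (n₁ * d))
    {L : Type} [Field L] [Algebra BK L] {x : BK}
    (hS : Sol p d n₁ κ BK L (algebraMap K BK T) (algebraMap K BK T * x ^ (M * d) + algebraMap K BK T ^ d)) :
    x ∈ valIntegralClosure v BK := by
  classical
  by_contra hx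
  letI : Algebra K L := ((algebraMap BK L).comp (algebraMap K BK)).toAlgebra
  haveI : IsScalarTower K BK L := IsScalarTower.of_algebraMap_eq' rfl
  obtain ⟨V, hxV, hV⟩ := exists_val_above v L (x := algebraMap BK L x) (by
    rintro ⟨P, h1, h2, h3⟩
    refine hx ⟨P, h1, h2, ?_⟩
    rw [aeval_algebraMap_apply] at h3
    simpa using h3)
  obtain ⟨z, z₂, ι, y, e1, e2, e3⟩ := hS
  obtain ⟨S, hS⟩ : ∃ S : Set BK, S = {x} ∪ Set.range (fun i : Fin d × Fin d × κ => y i.1 i.2.1 i.2.2) := ⟨_, rfl⟩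
  have hSf : S.Finite := by rw [hS]; exact (Set.finite_singleton _).union (Set.finite_range _)
  haveI : Finite S := hSf
  obtain ⟨F, hF⟩ : ∃ F : IntermediateField K BK, F = IntermediateField.adjoin K S := ⟨_, rfl⟩
  haveI : FiniteDimensional K F := by 
    rw [hF]; exact IntermediateField.finiteDimensional_adjoin fun x _ => Algebra.IsIntegral.isIntegral x
  have hsub : S ⊆ F := by rw [hF]; exact IntermediateField.subset_adjoin K S
  have hxF : x ∈ F := hsub (by rw [hS]; simp)
  have hyF : ∀ a b l, y a b l ∈ F := fun a b l => hsub (by rw [hS]; right; exact ⟨(a, b, l), rfl⟩)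
  have hGF : GFF p F := hK.of_finite
  haveI := hGF.charP
  haveI : CharP L p := (RingHom.charP_iff (algebraMap F L) (algebraMap F L).injective p).1 inferInstance
  letI : Algebra (ZMod p) F := ZMod.algebra F p
  have hVt : V.comap (algebraMap F L) ≠ ⊤ := by
    intro h
    apply hxV
    have : (⟨x, hxF⟩ : F) ∈ V.comap (algebraMap F L) := by rw [h]; trivial
    exact this
  obtain ⟨w, hw⟩ := gff_exists_ffprime hGF _ hVt
  have hcm := comap_eq_of_le v hVt (fun a ha => hV a ha)
  obtain ⟨e, he⟩ := v.liesOverWith_of_comap w (algebraMap K F) (fun a => by 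
    rw [hw, ← hcm]; rfl)
  haveI := finite_residue hGF w
  obtain ⟨f, hf0, hf, hfq⟩ := padic_resDeg hK hq hfv0 hfv he
  have hcop' := hcop f hf0 (by rw [hfq]; exact hres F inferInstance w ⟨e, he⟩)
  have heC : e ≤ C := by rw [← he.ramIdx_eq]; exact hram F inferInstance w ⟨e, he⟩
  obtain ⟨x', hx'⟩ : ∃ x' : F, x' = ⟨x, hxF⟩ := ⟨_, rfl⟩
  have hxw : x' ∉ w.V := by
    rw [hw, hx']; exact hxV
  rw [w.mem_V'] at hxw
  push Not at hxw
  obtain ⟨hx0, hxz⟩ := hxw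
  obtain ⟨T', hT'⟩ : ∃ T' : F, T' = algebraMap K F T := ⟨_, rfl⟩
  have hT'0 : T' ≠ 0 := by rw [hT']; simpa using hT0
  have hzT : w.z T' = - ((e * m₀ : ℕ) : ℤ) := by rw [hT', he.z_eq, hTm]; push_cast; ring
  have he0 := he.1
  have ht0 : 0 < e * m₀ := by positivity
  have ht1 : e * m₀ ≤ C * m₀ := Nat.mul_le_mul_right _ heC
  generalize e * m₀ = t at *
  have hd0 : 0 < d := by lia
  have hineq : w.z T' + M * d * w.z x' < d * w.z T' := by
    rw [hzT]
    have h1 : (t : ℤ) ≤ M := by exact_mod_cast ht1.trans hM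
    have h2 : (0 : ℤ) < t := by exact_mod_cast ht0
    have h3 : (0 : ℤ) < d := by exact_mod_cast hd0
    have h4 : (M : ℤ) * d * w.z x' ≤ M * d * (-1) := mul_le_mul_of_nonneg_left (by lia) (by positivity)
    nlinarith
  obtain ⟨hc0, hcz⟩ := cval_pole w (d := d) (M := M) hd0 hT'0 hx0 hineq
  have hTn : w.z T' < 0 := by rw [hzT]; lia
  have hSF : Sol p d n₁ κ F L T' (T' * x' ^ (M * d) + T' ^ d) := by
    refine ⟨z, z₂, ι, fun a b l => ⟨y a b l, hyF a b l⟩, ?_, ?_, ?_⟩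
    · rw [hx', hT']; exact e1
    · rw [hT']; exact e2
    · rw [hx', hT']; exact e3
  have hdvd := sol_dvd hSF hκ hd0 hn hdn w hf0 hf V (fun a => by rw [hw]; rfl) hcop' hT'0 hTn hc0 
    (by rw [hcz]; refine hineq.trans ?_; have : (0 : ℤ) < d := by exact_mod_cast hd0
        nlinarith)
  rw [hcz, hzT] at hdvd
  have h5 : (d : ℤ) ∣ t := by
    have h6 : (d : ℤ) ∣ M * d * w.z x' := ⟨M * w.z x', by ring⟩
    have := (Int.dvd_add_left h6).1 hdvd
    simpa using this
  have h7 : d ∣ t := by exact_mod_cast h5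
  have := Nat.le_of_dvd ht0 h7
  lia

lemma main_fwd [Algebra (ZMod p) K] (hK : GFF p K) (v : FFPrime K) {T : K} {d n₁ M B q : ℕ} (hq : q.Prime)
    (hT0 : T ≠ 0) (hTm : v.z T < 0) (hTreg : T ∈ RegAt v) (hd : 2 ≤ d) (hM : 0 < M)
    (hn : 0 < n₁) (hdn : d ∣ p ^ n₁ - 1) 
    {fv : ℕ} (hfv0 : 0 < fv) (hfv : Nat.card (IsLocalRing.ResidueField v.V) = p ^ fv)
    (hres : ∀ F : IntermediateField K BK, FiniteDimensional K F →
      ∀ w : FFPrime F, w.LiesOver v (algebraMap K F) → padicValNat q fv + padicValNat q (w.resDeg v) ≤ B)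
    (hcop : ∀ f, 0 < f → padicValNat q f ≤ B → Nat.Coprime (Nat.lcm f n₁ / n₁) d)
    {κ : Type} [Field κ] [Fintype κ] (hκ : Fintype.card κ = p ^ (n₁ * d))
    {x : BK} (hx : x ∈ valIntegralClosure v BK) : 
    Sol p d n₁ κ BK (AlgebraicClosure BK) (algebraMap K BK T) (algebraMap K BK T * x ^ (M * d) + algebraMap K BK T ^ d) := by
  obtain ⟨F, hF⟩ : ∃ F : IntermediateField K BK, F = IntermediateField.adjoin K {x} := ⟨_, rfl⟩
  haveI : FiniteDimensional K F := by 
    rw [hF]; exact IntermediateField.adjoin.finiteDimensional (Algebra.IsIntegral.isIntegral x)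
  have hxF : x ∈ F := by rw [hF]; exact IntermediateField.mem_adjoin_simple_self _ _
  have hGF : GFF p F := hK.of_finite
  haveI := hGF.charP
  letI : Algebra (ZMod p) F := ZMod.algebra F p
  obtain ⟨w, e, he⟩ := exists_above hGF v
  haveI := finite_residue hGF w
  obtain ⟨f, hf0, hf, hfq⟩ := padic_resDeg hK hq hfv0 hfv he
  have hcop' := hcop f hf0 (by rw [hfq]; exact hres F inferInstance w ⟨e, he⟩)
  have he0 : (0 : ℤ) < e := by exact_mod_cast he.1
  have key := forward (Ω := AlgebraicClosure BK) hGF (κ := κ) w hd hn hM hdn hf0 hf 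
    (by rw [Nat.card_eq_fintype_card, hκ]) hcop' (T := algebraMap K F T) (x := ⟨x, hxF⟩) (by simpa using hT0)
    (by rw [he.z_eq]; nlinarith) rfl (by
      intro W hW
      obtain ⟨u, e', he'⟩ := exists_below hK (F := K) W
      have he0' : (0 : ℤ) < e' := by exact_mod_cast he'.1
      rw [he'.z_eq] at hW
      have huT : T ∉ u.V := by
        rw [u.mem_V']; push Not; exact ⟨hT0, by nlinarith⟩
      have huv : u.V = v.V := by
        by_contra hne
        exact huT (hTreg _ hne)
      obtain ⟨P, hP, hPc, hP0⟩ := hx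
      refine mem_of_monic W.V (hP.map (algebraMap K F)) (fun n => ?_) ?_
      · have h1 : P.coeff n ∈ u.V := by rw [huv]; exact hPc n
        rw [coeff_map, W.mem_V', he'.z_eq]
        rw [u.mem_V'] at h1
        rcases h1 with h1 | h1
        · left; rw [h1, map_zero]
        · right; positivity
      · apply Subtype.ext
        rw [eval_map_algebraMap]
        exact ((aeval_algebraMap_apply BK (⟨x, hxF⟩ : F) P).symm.trans hP0 :))
  have := key.map (algebraMap F BK) (RingHom.id (AlgebraicClosure BK)) (fun a => rfl)
  rw [map_add, map_mul, map_pow, map_pow] at this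
  exact this

theorem main_equiv [Algebra (ZMod p) K] (hK : GFF p K) (v : FFPrime K) {q : ℕ} (hq : q.Prime) (hqp : q ≠ p)
    (hram : UnifAbsBoundedRam BK v) (hres : UnifQBoundedRes q BK v) : 
    ∃ (d n₁ M : ℕ) (κ : Type) (_ : Field κ) (_ : Fintype κ) (T : BK), 0 < d ∧ ∀ x : BK, x ∈ valIntegralClosure v BK ↔
      ∃ (L : Type) (_ : Field L) (_ : Algebra BK L), Sol p d n₁ κ BK L T (T * x ^ (M * d) + T ^ d) := by
  obtain ⟨C, hC⟩ := hram
  obtain ⟨C₂, hC₂⟩ := hres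
  haveI := finite_residue hK v
  obtain ⟨fv, hfv0, hfv⟩ := card_residue hK v
  obtain ⟨T, hTr, hTv⟩ := exists_pole hK v
  rw [v.mem_V'] at hTv
  push Not at hTv
  obtain ⟨hT0, hTz⟩ := hTv
  obtain ⟨m₀, hm₀⟩ : ∃ m₀ : ℕ, v.z T = - (m₀ : ℤ) := ⟨(-v.z T).toNat, by lia⟩
  have hm0 : 0 < m₀ := by lia
  obtain ⟨N, hN⟩ : ∃ N, C * m₀ + 2 ≤ q ^ N := ⟨_, (Nat.lt_pow_self hq.one_lt (n := C * m₀ + 2)).le⟩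
  obtain ⟨n₁, hn, hdn, hcop⟩ := arith (p := p) hq hqp (padicValNat q fv + C₂) N
  generalize q ^ N = d at *
  have hnd : n₁ * d ≠ 0 := by
    have : 0 < d := by lia
    positivity
  letI : Fintype (GaloisField p (n₁ * d)) := Fintype.ofFinite _
  have hκ : Fintype.card (GaloisField p (n₁ * d)) = p ^ (n₁ * d) := by
    rw [← Nat.card_eq_fintype_card, GaloisField.card p _ hnd]
  refine ⟨d, n₁, C * m₀ + 1, GaloisField p (n₁ * d), inferInstance, inferInstance, algebraMap K BK T, by lia, fun x => ⟨fun hx => ?_, ?_⟩⟩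
  · exact ⟨AlgebraicClosure BK, inferInstance, inferInstance, main_fwd hK v hq hT0 hTz hTr (by lia) (by lia) hn hdn hfv0 hfv
      (B := padicValNat q fv + C₂) (fun F hF w hw => Nat.add_le_add_left (hC₂ F hF w hw) _) hcop hκ hx⟩
  · rintro ⟨L, _, _, hS⟩
    exact main_back hK v hq hT0 hm₀ hm0 (by lia : C * m₀ < d) (by lia) hn hdn hC hfv0 hfv 
      (B := padicValNat q fv + C₂) (fun F hF w hw => Nat.add_le_add_left (hC₂ F hF w hw) _) hcop hκ hS
end HW

end

section
set_option linter.all false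
open Polynomial

namespace HW
variable {p : ℕ} {R : Type} [Field R] {κ : Type} [Field κ] [Fintype κ]

/-- solutions in a possibly noncommutative algebra -/
def SolM (p d n₁ : ℕ) (κ : Type) [Field κ] [Fintype κ] {R : Type} [Field R] (A : Type) [Ring A] [Algebra R A] (T c : R) 
    (y : Fin d → Fin d → κ → R) (z z₂ : A) (μ : κ → A) : Prop :=
  z * z₂ = z₂ * z ∧ (∀ l, z * μ l = μ l * z) ∧ (∀ l, z₂ * μ l = μ l * z₂) ∧ μ 1 = 1 ∧ 
  (∀ l l', μ (l + l') = μ l + μ l') ∧ (∀ l l', μ (l * l') = μ l * μ l') ∧ 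
  algebraMap R A c * z ^ d = algebraMap R A (c + 1) ∧ algebraMap R A T * z₂ ^ d = algebraMap R A (T + 1) ∧
  (List.ofFn fun i : Fin d => (∑ l : κ, ∑ a : Fin d, ∑ b : Fin d, algebraMap R A (y a b l) * z ^ (a : ℕ) * z₂ ^ (b : ℕ) 
    * (μ l) ^ (p ^ (n₁ * (i : ℕ))))).prod = algebraMap R A c

lemma SolM.map_iff {d n₁ : ℕ} {A B : Type} [Ring A] [Algebra R A] [Ring B] [Algebra R B] (f : A →ₐ[R] B) {T c : R}
    {y : Fin d → Fin d → κ → R} {z z₂ : A} {μ : κ → A} (hf : Function.Injective f) :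
    SolM p d n₁ κ B T c y (f z) (f z₂) (fun l => f (μ l)) ↔ SolM p d n₁ κ A T c y z z₂ μ := by
  unfold SolM
  have key : (List.ofFn fun i : Fin d => (∑ l : κ, ∑ a : Fin d, ∑ b : Fin d, algebraMap R B (y a b l) * (f z) ^ (a : ℕ) * (f z₂) ^ (b : ℕ) 
    * (f (μ l)) ^ (p ^ (n₁ * (i : ℕ))))).prod = f (List.ofFn fun i : Fin d => (∑ l : κ, ∑ a : Fin d, ∑ b : Fin d, algebraMap R A (y a b l) * z ^ (a : ℕ) * z₂ ^ (b : ℕ) 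
    * (μ l) ^ (p ^ (n₁ * (i : ℕ))))).prod := by
    rw [map_list_prod, List.map_ofFn]
    congr 2
    funext i
    simp only [Function.comp, map_sum, map_mul, map_pow, AlgHom.commutes]
  rw [key]
  simp only [← AlgHom.commutes f, ← map_mul, ← map_pow, ← map_add, hf.eq_iff, ← map_one f]

lemma SolM.map {d n₁ : ℕ} {A B : Type} [Ring A] [Algebra R A] [Ring B] [Algebra R B] (f : A →ₐ[R] B) {T c : R}
    {y : Fin d → Fin d → κ → R} {z z₂ : A} {μ : κ → A} (h : SolM p d n₁ κ A T c y z z₂ μ) :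
    SolM p d n₁ κ B T c y (f z) (f z₂) (fun l => f (μ l)) := by
  obtain ⟨h1, h2, h3, h4, h5, h6, h7, h8, h9⟩ := h
  refine ⟨?_, fun l => ?_, fun l => ?_, ?_, fun l l' => ?_, fun l l' => ?_, ?_, ?_, ?_⟩
  · rw [← map_mul, h1, map_mul]
  · rw [← map_mul, h2, map_mul]
  · rw [← map_mul, h3, map_mul]
  · beta_reduce; rw [h4, map_one]
  · beta_reduce; rw [h5, map_add]
  · beta_reduce; rw [h6, map_mul]
  · rw [← AlgHom.commutes f, ← map_pow, ← map_mul, h7, AlgHom.commutes]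
  · rw [← AlgHom.commutes f, ← map_pow, ← map_mul, h8, AlgHom.commutes]
  · rw [← AlgHom.commutes f, ← h9, map_list_prod, List.map_ofFn]
    congr 2
    funext i
    simp only [Function.comp, map_sum, map_mul, map_pow, AlgHom.commutes]

lemma SolM.sol {d n₁ : ℕ} {L : Type} [Field L] [Algebra R L] {T c : R}
    {y : Fin d → Fin d → κ → R} {z z₂ : L} {μ : κ → L} (h : SolM p d n₁ κ L T c y z z₂ μ) : Sol p d n₁ κ R L T c := by
  obtain ⟨h1, h2, h3, h4, h5, h6, h7, h8, h9⟩ := h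
  refine ⟨z, z₂, ⟨⟨⟨μ, h4⟩, h6⟩, by simpa using h5 0 0, h5⟩, y, h7, h8, ?_⟩
  rw [List.prod_ofFn] at h9
  rw [Finset.prod_range]
  exact h9

lemma Sol.solM {d n₁ : ℕ} {L : Type} [Field L] [Algebra R L] {T c : R} (h : Sol p d n₁ κ R L T c) : 
    ∃ y z z₂ , ∃ (ι : κ →+* L), SolM p d n₁ κ L T c y z z₂ ι := by
  obtain ⟨z, z₂, ι, y, h7, h8, h9⟩ := h
  refine ⟨y, z, z₂, ι, mul_comm _ _, fun _ => mul_comm _ _, fun _ => mul_comm _ _, map_one _, map_add _, map_mul _, h7, h8, ?_⟩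
  rw [List.prod_ofFn]
  rw [Finset.prod_range] at h9
  exact h9

lemma mat_to_field {d n₁ n : ℕ} (hn : 0 < n) {T c : R} {y : Fin d → Fin d → κ → R} {z z₂ : Matrix (Fin n) (Fin n) R} 
    {μ : κ → Matrix (Fin n) (Fin n) R} (h : SolM p d n₁ κ (Matrix (Fin n) (Fin n) R) T c y z z₂ μ) :
    ∃ (L : Type) (_ : Field L) (_ : Algebra R L), Sol p d n₁ κ R L T c := by
  haveI : Nonempty (Fin n) := ⟨⟨0, hn⟩⟩
  obtain ⟨S, hS⟩ : ∃ S : Set (Matrix (Fin n) (Fin n) R), S = {z, z₂} ∪ Set.range μ := ⟨_, rfl⟩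
  have hcomm : ∀ a ∈ S, ∀ b ∈ S, a * b = b * a := by
    obtain ⟨h1, h2, h3, h4, h5, h6, -⟩ := h
    rw [hS]
    rintro a ((rfl | rfl) | ⟨l, rfl⟩) b ((rfl | rfl) | ⟨l', rfl⟩)
    · rfl
    · exact h1
    · exact h2 _
    · exact h1.symm
    · rfl
    · exact h3 _
    · exact (h2 _).symm
    · exact (h3 _).symm
    · rw [← h6, mul_comm, h6]
  letI : CommRing (Algebra.adjoin R S) := Algebra.adjoinCommRingOfComm R hcomm
  have hzm : z ∈ Algebra.adjoin R S := Algebra.subset_adjoin (by rw [hS]; simp)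
  have hz₂m : z₂ ∈ Algebra.adjoin R S := Algebra.subset_adjoin (by rw [hS]; simp)
  have hμm : ∀ l, μ l ∈ Algebra.adjoin R S := fun l => Algebra.subset_adjoin (by rw [hS]; right; exact ⟨l, rfl⟩)
  have hA : SolM p d n₁ κ (Algebra.adjoin R S) T c y ⟨z, hzm⟩ ⟨z₂, hz₂m⟩ (fun l => ⟨μ l, hμm l⟩) := by
    rw [← SolM.map_iff (Algebra.adjoin R S).val Subtype.val_injective]
    exact h
  obtain ⟨I, hI⟩ := Ideal.exists_maximal (Algebra.adjoin R S)
  letI := Ideal.Quotient.field I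
  exact ⟨Algebra.adjoin R S ⧸ I, inferInstance, inferInstance, (hA.map (Ideal.Quotient.mkₐ R I)).sol⟩

lemma field_to_mat {d n₁ : ℕ} (hd : 0 < d) {T c : R} {L : Type} [Field L] [Algebra R L] (h : Sol p d n₁ κ R L T c) {n : ℕ}
    (hn : n = (Fintype.card (κ × Fin d × Fin d)).factorial) :
    ∃ y z z₂ μ, SolM p d n₁ κ (Matrix (Fin n) (Fin n) R) T c y z z₂ μ := by
  obtain ⟨y, Z, Z₂, ι, hS⟩ := h.solM
  have hroot : ∀ (a : R) (w : L), algebraMap R L a * w ^ d = algebraMap R L (a + 1) → 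
      w ^ d = algebraMap R L (1 + a⁻¹) := by
    intro a w haw
    have ha : a ≠ 0 := by
      rintro rfl
      simp at haw
    apply mul_left_cancel₀ (show algebraMap R L a ≠ 0 by simpa using ha)
    rw [haw, ← map_mul]; congr 1; field_simp
  have hZ := hroot c Z hS.2.2.2.2.2.2.1
  have hZ₂ := hroot T Z₂ hS.2.2.2.2.2.2.2.1
  obtain ⟨S, hSd⟩ : ∃ S : Set L, S = {Z, Z₂} ∪ Set.range ι := ⟨_, rfl⟩
  have hSI : ∀ x ∈ S, IsIntegral R x := by
    rw [hSd]
    rintro y ((rfl | rfl) | ⟨l, rfl⟩)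
    · exact IsIntegral.of_pow hd (by rw [hZ]; exact isIntegral_algebraMap)
    · exact IsIntegral.of_pow hd (by rw [hZ₂]; exact isIntegral_algebraMap)
    · refine ⟨X ^ (Fintype.card κ) - X, ?_, ?_⟩
      · exact monic_X_pow_sub (by rw [degree_X]; exact_mod_cast Fintype.one_lt_card)
      · have : ι l ^ (Fintype.card κ) = ι l := by
          rw [← map_pow, FiniteField.pow_card]
        simp [this]
  obtain ⟨E, hE⟩ : ∃ E : IntermediateField R L, E = IntermediateField.adjoin R S := ⟨_, rfl⟩
  have hsub : S ⊆ E := by rw [hE]; exact IntermediateField.subset_adjoin R S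
  have hE' : E.toSubalgebra = Algebra.adjoin R S := by 
    rw [hE]; exact IntermediateField.adjoin_toSubalgebra_of_isAlgebraic fun x hx => (hSI x hx).isAlgebraic
  have hZm : Z ∈ E := hsub (by rw [hSd]; simp)
  have hZ₂m : Z₂ ∈ E := hsub (by rw [hSd]; simp)
  let φ : κ →+* E := ι.codRestrict E (fun l => hsub (by rw [hSd]; right; exact ⟨l, rfl⟩))
  have hSE : SolM p d n₁ κ E T c y ⟨Z, hZm⟩ ⟨Z₂, hZ₂m⟩ φ := by
    rw [← SolM.map_iff E.val Subtype.val_injective]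
    exact hS
  have htop : Algebra.adjoin R ({⟨Z, hZm⟩, ⟨Z₂, hZ₂m⟩} ∪ Set.range φ) = (⊤ : Subalgebra R E) := by
    rw [eq_top_iff]
    rintro ⟨y, hy⟩ -
    have hy' : y ∈ Algebra.adjoin R S := by rw [← hE']; exact hy
    have him : S = E.val '' ({⟨Z, hZm⟩, ⟨Z₂, hZ₂m⟩} ∪ Set.range φ) := by
      rw [Set.image_union, ← Set.range_comp, Set.image_pair, hSd]; rfl
    rw [him, ← AlgHom.map_adjoin] at hy'
    obtain ⟨y', hy1, hy2⟩ := hy'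
    have : y' = ⟨y, hy⟩ := Subtype.ext hy2
    rwa [← this]
  have hspan := span_all (F := R) (F₂ := E) (E := E) (κ₁ := κ) (κ := κ) hd ⟨Z, hZm⟩ ⟨Z₂, hZ₂m⟩ (1 + c⁻¹) (1 + T⁻¹) (Subtype.ext hZ) (Subtype.ext hZ₂)
    φ φ (fun _ => rfl) 1 htop (by
      rw [eq_top_iff]
      intro y _
      exact Subalgebra.algebraMap_mem (Algebra.adjoin E {φ 1}) y)
  let vv : κ × Fin d × Fin d → E := fun i => ⟨Z, hZm⟩ ^ (i.2.1 : ℕ) * ⟨Z₂, hZ₂m⟩ ^ (i.2.2 : ℕ) * φ i.1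
  have htop' : Submodule.span R (Set.range vv) = ⊤ := by
    rw [eq_top_iff]
    intro y _
    obtain ⟨cc, hcc⟩ := hspan y
    rw [hcc]
    refine Submodule.sum_mem _ fun l _ => Submodule.sum_mem _ fun a _ => Submodule.sum_mem _ fun b _ => ?_
    rw [mul_assoc, mul_assoc, ← mul_assoc (_ ^ (a : ℕ)), ← Algebra.smul_def]
    exact Submodule.smul_mem _ _ (Submodule.subset_span ⟨(l, a, b), rfl⟩)
  haveI : FiniteDimensional R E := ⟨⟨(Set.finite_range vv).toFinset, by simpa using htop'⟩⟩
  have hle : Module.finrank R E ≤ Fintype.card (κ × Fin d × Fin d) := by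
    have := finrank_range_le_card (R := R) vv
    rwa [Set.finrank, htop', finrank_top] at this
  have hpos : 0 < Module.finrank R E := Module.finrank_pos
  have hdv : Module.finrank R E ∣ n := by rw [hn]; exact Nat.dvd_factorial hpos hle
  obtain ⟨k, hk⟩ := hdv
  have hfr : Module.finrank R (Fin k → E) = n := by
    rw [Module.finrank_pi_fintype]; simp [hk, mul_comm]
  let b := Module.finBasisOfFinrankEq R (Fin k → E) hfr
  let f : E →ₐ[R] Matrix (Fin n) (Fin n) R := (LinearMap.toMatrixAlgEquiv b).toAlgHom.comp (Algebra.lsmul R R (Fin k → E))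
  exact ⟨_, _, _, _, hSE.map f⟩

end HW

end

section
set_option linter.all false
open Polynomial

namespace HW
variable {R : Type} [Field R] {τ : Type}

/-- polynomial functions -/
def PFn (R τ : Type) [Field R] : Subring ((τ → R) → R) :=
  (Pi.ringHom (fun s : τ → R => MvPolynomial.eval s) : MvPolynomial τ R →+* ((τ → R) → R)).range

lemma mem_PFn {f : (τ → R) → R} : f ∈ PFn R τ ↔ ∃ P : MvPolynomial τ R, ∀ s, MvPolynomial.eval s P = f s := by
  constructor
  · rintro ⟨P, rfl⟩; exact ⟨P, fun s => rfl⟩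
  · rintro ⟨P, h⟩; exact ⟨P, funext h⟩

lemma PFn.const (a : R) : (fun _ => a) ∈ PFn R τ := mem_PFn.2 ⟨MvPolynomial.C a, by simp⟩
lemma PFn.var (t : τ) : (fun s => s t) ∈ PFn R τ := mem_PFn.2 ⟨MvPolynomial.X t, by simp⟩

variable {n : ℕ}
/-- polynomial matrix functions -/
def PMat (n : ℕ) (R τ : Type) [Field R] : Subring ((τ → R) → Matrix (Fin n) (Fin n) R) where
  carrier := {f | ∀ i j, (fun s => f s i j) ∈ PFn R τ}
  mul_mem' {f g} hf hg i j := by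
    have : (fun s => (f * g) s i j) = ∑ k, (fun s => f s i k) * (fun s => g s k j) := by
      funext s
      simp [Matrix.mul_apply]
    rw [this]
    exact sum_mem fun k _ => mul_mem (hf i k) (hg k j)
  one_mem' i j := PFn.const _
  add_mem' {f g} hf hg i j := add_mem (hf i j) (hg i j)
  zero_mem' i j := PFn.const _
  neg_mem' {f} hf i j := neg_mem (hf i j)

lemma PMat.alg {f : (τ → R) → R} (hf : f ∈ PFn R τ) : 
    (fun s => algebraMap R (Matrix (Fin n) (Fin n) R) (f s)) ∈ PMat n R τ := by
  intro i j
  by_cases h : i = j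
  · subst h; simpa [Matrix.algebraMap_matrix_apply] using hf
  · simpa [Matrix.algebraMap_matrix_apply, h] using PFn.const (0 : R)

/-- algebraic conditions -/
def AlgC (P : (τ → R) → Prop) : Prop := 
  ∃ (J : Type) (_ : Finite J) (Q : J → MvPolynomial τ R), ∀ s, P s ↔ ∀ j, MvPolynomial.eval s (Q j) = 0

lemma AlgC.and {P P' : (τ → R) → Prop} (h : AlgC P) (h' : AlgC P') : AlgC (fun s => P s ∧ P' s) := by
  obtain ⟨J, _, Q, hQ⟩ := h
  obtain ⟨J', _, Q', hQ'⟩ := h'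
  exact ⟨J ⊕ J', inferInstance, Sum.elim Q Q', fun s => by beta_reduce; rw [hQ, hQ']; simp⟩

lemma AlgC.all {α : Type} [Finite α] {P : α → (τ → R) → Prop} (h : ∀ a, AlgC (P a)) : AlgC (fun s => ∀ a, P a s) := by
  choose J hJ Q hQ using h
  exact ⟨Σ a, J a, inferInstance, fun x => Q x.1 x.2, fun s => by simp [hQ, Sigma.forall]⟩

lemma AlgC.eq {f g : (τ → R) → Matrix (Fin n) (Fin n) R} (hf : f ∈ PMat n R τ) (hg : g ∈ PMat n R τ) :
    AlgC (fun s => f s = g s) := by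
  have h := fun i j => mem_PFn.1 ((PMat n R τ).sub_mem hf hg i j)
  choose Q hQ using h
  refine ⟨Fin n × Fin n, inferInstance, fun x => Q x.1 x.2, fun s => ?_⟩
  simp only [hQ, Prod.forall, Pi.sub_apply, Matrix.sub_apply, sub_eq_zero]
  exact ⟨fun h i j => by rw [h], fun h => by ext i j; exact h i j⟩

lemma existDefinable_of {X : Set R} [Finite τ] {P : (Option τ → R) → Prop} (hP : AlgC P) 
    (hX : ∀ x, x ∈ X ↔ ∃ s : τ → R, P (fun o => o.elim x s)) : ExistDefinable X := by
  obtain ⟨J, _, Q, hQ⟩ := hP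
  obtain ⟨k, ⟨e⟩⟩ := Finite.exists_equiv_fin τ
  obtain ⟨m, ⟨e'⟩⟩ := Finite.exists_equiv_fin J
  refine ⟨k, m, fun i => MvPolynomial.rename (fun o : Option τ => o.elim 0 (fun t => (e t).succ)) (Q (e'.symm i)), fun x => ?_⟩
  rw [hX]
  have key : ∀ y : Fin k → R, (Fin.cons x y : Fin (k+1) → R) ∘ (fun o : Option τ => o.elim 0 (fun t => (e t).succ))
      = fun o => o.elim x (fun t => y (e t)) := by
    intro y; funext o
    cases o <;> simp
  constructor
  · rintro ⟨s, hs⟩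
    refine ⟨fun i => s (e.symm i), fun i => ?_⟩
    rw [MvPolynomial.eval_rename, key]
    simpa using (hQ _).1 hs _
  · rintro ⟨y, hy⟩
    refine ⟨fun t => y (e t), (hQ _).2 fun j => ?_⟩
    have := hy (e' j)
    rw [MvPolynomial.eval_rename, key] at this
    simpa using this

variable {κ : Type} [Field κ] [Fintype κ] {p d n₁ : ℕ} 

theorem sol_definable (hd : 0 < d) (T : R) (g : R → R) (hg : ∃ G : R[X], ∀ x, g x = G.eval x) : 
    ExistDefinable {x : R | ∃ (L : Type) (_ : Field L) (_ : Algebra R L), Sol p d n₁ κ R L T (g x)} := by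
  classical
  obtain ⟨n, hn⟩ : ∃ n, n = (Fintype.card (κ × Fin d × Fin d)).factorial := ⟨_, rfl⟩
  have hn0 : 0 < n := by rw [hn]; exact Nat.factorial_pos _
  let τ := (Fin d × Fin d × κ) ⊕ (Option (Option κ)) × Fin n × Fin n
  let yy : (Option τ → R) → Fin d → Fin d → κ → R := fun s a b l => s (some (Sum.inl (a, b, l)))
  let mm : Option (Option κ) → (Option τ → R) → Matrix (Fin n) (Fin n) R := 
    fun k s => Matrix.of fun i j => s (some (Sum.inr (k, i, j)))
  have hyy : ∀ a b l, (fun s => yy s a b l) ∈ PFn R (Option τ) := fun a b l => PFn.var _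
  have hmm : ∀ k, mm k ∈ PMat n R (Option τ) := fun k i j => PFn.var _
  have hgg : (fun s : Option τ → R => g (s none)) ∈ PFn R (Option τ) := by
    obtain ⟨G, hG⟩ := hg
    refine mem_PFn.2 ⟨aeval (MvPolynomial.X none) G, fun s => ?_⟩
    rw [hG, aeval_def, hom_eval₂, eval₂_eq_eval_map]
    have : ((MvPolynomial.eval s).comp (algebraMap R (MvPolynomial (Option τ) R))) = RingHom.id R := by
      ext r; simp [MvPolynomial.algebraMap_eq]
    rw [this, map_id, MvPolynomial.eval_X]
  let P : (Option τ → R) → Prop := fun s => SolM p d n₁ κ (Matrix (Fin n) (Fin n) R) T (g (s none)) (yy s)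
    (mm none s) (mm (some none) s) (fun l => mm (some (some l)) s)
  have hP : AlgC P := by
    refine AlgC.and (AlgC.eq (mul_mem (hmm _) (hmm _)) (mul_mem (hmm _) (hmm _))) ?_
    refine AlgC.and (AlgC.all fun l => AlgC.eq (mul_mem (hmm _) (hmm _)) (mul_mem (hmm _) (hmm _))) ?_
    refine AlgC.and (AlgC.all fun l => AlgC.eq (mul_mem (hmm _) (hmm _)) (mul_mem (hmm _) (hmm _))) ?_
    refine AlgC.and (AlgC.eq (hmm _) (one_mem _)) ?_
    refine AlgC.and (AlgC.all fun l => AlgC.all fun l' => AlgC.eq (hmm _) (add_mem (hmm _) (hmm _))) ?_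
    refine AlgC.and (AlgC.all fun l => AlgC.all fun l' => AlgC.eq (hmm _) (mul_mem (hmm _) (hmm _))) ?_
    refine AlgC.and (AlgC.eq (mul_mem (PMat.alg hgg) (pow_mem (hmm _) _)) (PMat.alg (add_mem hgg (one_mem _)))) ?_
    refine AlgC.and (AlgC.eq (mul_mem (PMat.alg (PFn.const _)) (pow_mem (hmm _) _)) (PMat.alg (PFn.const _))) ?_
    refine AlgC.eq ?_ (PMat.alg hgg)
    have : (fun s => (List.ofFn fun i : Fin d => (∑ l : κ, ∑ a : Fin d, ∑ b : Fin d, 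
          algebraMap R (Matrix (Fin n) (Fin n) R) (yy s a b l) * (mm none s) ^ (a : ℕ) * (mm (some none) s) ^ (b : ℕ) 
          * (mm (some (some l)) s) ^ (p ^ (n₁ * (i : ℕ))))).prod) = 
        (List.ofFn fun i : Fin d => (∑ l : κ, ∑ a : Fin d, ∑ b : Fin d, 
          (fun s => algebraMap R (Matrix (Fin n) (Fin n) R) (yy s a b l)) * (mm none) ^ (a : ℕ) * (mm (some none)) ^ (b : ℕ) 
          * (mm (some (some l))) ^ (p ^ (n₁ * (i : ℕ))))).prod := by
      funext s
      rw [Pi.list_prod_apply, List.map_ofFn]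
      congr 2
      funext i
      simp only [Function.comp, Finset.sum_apply, Pi.mul_apply, Pi.pow_apply]
    rw [this]
    refine list_prod_mem fun x hx => ?_
    obtain ⟨i, rfl⟩ := (List.mem_ofFn' _ _).1 hx
    exact sum_mem fun l _ => sum_mem fun a _ => sum_mem fun b _ => 
      mul_mem (mul_mem (mul_mem (PMat.alg (hyy _ _ _)) (pow_mem (hmm _) _)) (pow_mem (hmm _) _)) (pow_mem (hmm _) _)
  refine existDefinable_of hP fun x => ⟨?_, ?_⟩
  · rintro ⟨L, _, _, hS⟩
    obtain ⟨y, z, z₂, μ, h⟩ := field_to_mat hd hS hn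
    exact ⟨Sum.elim (fun i => y i.1 i.2.1 i.2.2) (fun i => i.1.elim z (fun o => o.elim z₂ μ) i.2.1 i.2.2), h⟩
  · rintro ⟨s, hs⟩
    exact mat_to_field hn0 hs

end HW

end

/-- If the prime `v` of the global function field `K` has uniformly
absolutely bounded ramification and uniformly `q`-bounded relative degree in the
algebraic extension `BK` of `K`, then the integral closure in `BK` of the valuation
ring of `v` is existentially (diophantine) definable over `BK`. -/
theorem statement0 (p q : ℕ) [Fact p.Prime] (hq : q.Prime) (hqp : q ≠ p)
    (K : Type) [Field K] [Algebra (RatFunc (ZMod p)) K]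
    [FiniteDimensional (RatFunc (ZMod p)) K]
    (BK : Type) [Field BK] [Algebra K BK] [Algebra.IsAlgebraic K BK]
    (v : FFPrime K)
    (hram : UnifAbsBoundedRam BK v)
    (hres : UnifQBoundedRes q BK v) :
    ExistDefinable (valIntegralClosure v BK) := by
  have hK : HW.GFF p K := ⟨algebraMap (RatFunc (ZMod p)) K, by
    rw [RingHom.finite_algebraMap]; infer_instance⟩
  haveI := hK.charP
  letI : Algebra (ZMod p) K := ZMod.algebra K p
  obtain ⟨d, n₁, M, κ, _, _, T, hd, hx⟩ := HW.main_equiv (BK := BK) hK v hq hqp hram hres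
  have hdef := HW.sol_definable (R := BK) (κ := κ) (p := p) (n₁ := n₁) hd T (fun x => T * x ^ (M * d) + T ^ d)
    ⟨Polynomial.C T * Polynomial.X ^ (M * d) + Polynomial.C T ^ d, fun x => by simp⟩
  have hset : valIntegralClosure v BK = {x : BK | ∃ (L : Type) (_ : Field L) (_ : Algebra BK L), 
      HW.Sol p d n₁ κ BK L T (T * x ^ (M * d) + T ^ d)} := Set.ext hx
  rw [hset]
  exact hdef
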